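/- For every ε > 0 there exists C > 0 such that for all z ∈ ℂ with Im z ≥ C, C·(Im z)^{4/9} ≤ Re z, and Re z ≤ (Im z)/C: m(z) > 0 and |1/m(z) − K(z)| ≤ ε·K(z) + C·(Re z)^{−1/4}·(Im z)^{−1/3}, where, setting y = Re z / Im z, K(z) = √π · exp(−(Im z)^{5/6}·Im ∫_{−√y}^{√y} (1 − i y + i x²)^{1/3} dx) / (6^{1/2}·(Im z)^{1/3}·(Re z)^{1/4}). (This expresses the precise resolvent asymptotics of the cubic non-self-adjoint operator in the regime (Im z)^{4/9} ≪ Re z ≪ Im z; the exponent equals (4/9)(Re z)^{3/2}/(Im z)^{2/3}(1 + O(Re z/Im z)).) -/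

import Mathlib

open Complex MeasureTheory

/-- `mP z` is the infimum of `‖𝒫u − zu‖_{L²}/‖u‖_{L²}` over nonzero Schwartz functions,
where `𝒫 = Dₓ² + ix³` is the cubic non-self-adjoint operator; `1/mP z = ‖(𝒫 − z)^{-1}‖`. -/
noncomputable def mP (z : ℂ) : ℝ :=
  sInf {r : ℝ | ∃ u : SchwartzMap ℝ ℂ, u ≠ 0 ∧
    r = (eLpNorm (fun x : ℝ =>
          -(deriv (deriv ⇑u) x) + Complex.I * (x:ℂ) ^ 3 * u x - z * u x) 2 volume).toReal
        / (eLpNorm (⇑u) 2 volume).toReal}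

section Aux

noncomputable def aOp (lam : ℂ) (R : ℝ → ℂ) (t : ℝ) : ℂ :=
  cexp (lam * t) * ∫ τ in Set.Iic t, cexp (-lam * τ) * R τ

lemma aOp_int {lam : ℂ} (hl : lam.re < 0) {R : ℝ → ℂ} (hR : Continuous R) {B : ℝ}
    (hB : ∀ t, ‖R t‖ ≤ B) (t : ℝ) :
    IntegrableOn (fun τ : ℝ => cexp (-lam * τ) * R τ) (Set.Iic t) := by
  have h1 : IntegrableOn (fun τ : ℝ => B * Real.exp ((-lam.re) * τ)) (Set.Iic t) :=
    (integrableOn_exp_mul_Iic (by linarith) t).const_mul B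
  refine Integrable.mono' h1 (by fun_prop) (Filter.Eventually.of_forall fun τ => ?_)
  rw [norm_mul, Complex.norm_exp]
  have : (-lam * (τ : ℂ)).re = -lam.re * τ := by simp
  rw [this, mul_comm]
  exact mul_le_mul_of_nonneg_right (hB τ) (Real.exp_pos _).le

lemma aOp_bound {lam : ℂ} (hl : lam.re < 0) {R : ℝ → ℂ} {B : ℝ}
    (hB : ∀ t, ‖R t‖ ≤ B) (t : ℝ) : ‖aOp lam R t‖ ≤ B / (-lam.re) := by
  have h1 : IntegrableOn (fun τ : ℝ => B * Real.exp ((-lam.re) * τ)) (Set.Iic t) :=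
    (integrableOn_exp_mul_Iic (by linarith) t).const_mul B
  have h2 : ‖∫ τ in Set.Iic t, cexp (-lam * τ) * R τ‖ ≤
      ∫ τ in Set.Iic t, B * Real.exp ((-lam.re) * τ) := by
    refine norm_integral_le_of_norm_le h1 (Filter.Eventually.of_forall fun τ => ?_)
    rw [norm_mul, Complex.norm_exp]
    have : (-lam * (τ : ℂ)).re = -lam.re * τ := by simp
    rw [this, mul_comm]
    exact mul_le_mul_of_nonneg_right (hB τ) (Real.exp_pos _).le
  rw [integral_const_mul, integral_exp_mul_Iic (by linarith)] at h2
  unfold aOp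
  rw [norm_mul, Complex.norm_exp]
  have : (lam * (t : ℂ)).re = lam.re * t := by simp
  rw [this]
  calc _ ≤ Real.exp (lam.re * t) * (B * (Real.exp (-lam.re * t) / -lam.re)) := by gcongr
    _ = (Real.exp (lam.re * t) * Real.exp (-lam.re * t)) * B / (-lam.re) := by ring
    _ = _ := by rw [← Real.exp_add]; simp

lemma aOp_deriv {lam : ℂ} (hl : lam.re < 0) {R : ℝ → ℂ} (hR : Continuous R) {B : ℝ}
    (hB : ∀ t, ‖R t‖ ≤ B) (t : ℝ) :
    HasDerivAt (aOp lam R) (lam * aOp lam R t + R t) t := by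
  have hc : Continuous (fun τ : ℝ => cexp (-lam * τ) * R τ) := by fun_prop
  have h1 : HasDerivAt (fun t : ℝ => ∫ τ in Set.Iic t, cexp (-lam * τ) * R τ)
      (cexp (-lam * t) * R t) t := by
    have h2 : HasDerivAt (fun t : ℝ => (∫ τ in Set.Iic (0:ℝ), cexp (-lam * τ) * R τ)
        + ∫ τ in (0:ℝ)..t, cexp (-lam * τ) * R τ) (cexp (-lam * t) * R t) t :=
      (hc.integral_hasStrictDerivAt 0 t).hasDerivAt.const_add _
    refine h2.congr_of_eventuallyEq (Filter.Eventually.of_forall fun s => ?_)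
    have := intervalIntegral.integral_Iic_sub_Iic (aOp_int hl hR hB 0) (aOp_int hl hR hB s)
    simp only at this ⊢
    rw [← this]; ring
  have h3 : HasDerivAt (fun t : ℝ => cexp (lam * t)) (lam * cexp (lam * t)) t := by
    have := ((hasDerivAt_id (t : ℂ)).const_mul lam).cexp.comp_ofReal
    simpa [mul_comm] using this
  have h4 := h3.mul h1
  refine h4.congr_deriv ?_
  unfold aOp
  have : cexp (lam * t) * (cexp (-lam * t) * R t) = R t := by
    rw [← mul_assoc, ← Complex.exp_add]; simp
  rw [this]; ring

lemma aOp_sub {lam : ℂ} (hl : lam.re < 0) {R S : ℝ → ℂ} (hR : Continuous R) (hS : Continuous S)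
    {B B' : ℝ} (hB : ∀ t, ‖R t‖ ≤ B) (hB' : ∀ t, ‖S t‖ ≤ B') (t : ℝ) :
    aOp lam R t - aOp lam S t = aOp lam (fun s => R s - S s) t := by
  unfold aOp
  rw [← mul_sub, ← integral_sub (aOp_int hl hR hB t) (aOp_int hl hS hB' t)]
  congr 2; ext τ; ring

noncomputable def bOp (lam : ℂ) (R : ℝ → ℂ) (t : ℝ) : ℂ := aOp (-lam) (fun s => R (-s)) (-t)

noncomputable def lmm : ℂ := ⟨-(√3) / 2, -3 / 2⟩
noncomputable def lmp : ℂ := ⟨(√3) / 2, -3 / 2⟩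

lemma lmm_re : lmm.re < 0 := by
  have : (0:ℝ) < √3 := by positivity
  simp only [lmm]; linarith
lemma lmp_re : (-lmp).re < 0 := by simp [lmp]

lemma s3 : (√3 : ℝ) * √3 = 3 := Real.mul_self_sqrt (by norm_num)

lemma lmm_eq : lmm ^ 2 + 3 * I * lmm - 3 = 0 := by
  have := s3
  apply Complex.ext <;> simp [lmm, pow_two] <;> nlinarith
lemma lmp_eq : lmp ^ 2 + 3 * I * lmp - 3 = 0 := by
  have := s3
  apply Complex.ext <;> simp [lmp, pow_two] <;> nlinarith
lemma lmp_sub : lmp - lmm = (√3 : ℝ) := by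
  apply Complex.ext <;> simp [lmp, lmm]; ring
lemma norm_lmm : ‖lmm‖ = √3 := by
  have := s3
  rw [Complex.norm_def, Complex.normSq_apply]; congr 1; simp [lmm]; nlinarith
lemma norm_lmp : ‖lmp‖ = √3 := by
  have := s3
  rw [Complex.norm_def, Complex.normSq_apply]; congr 1; simp [lmp]; nlinarith

noncomputable def dOp (R : ℝ → ℂ) (t : ℝ) : ℂ := (aOp lmm R t + bOp lmp R t) / (√3 : ℝ)
noncomputable def eOp (R : ℝ → ℂ) (t : ℝ) : ℂ :=
  (lmm * aOp lmm R t + lmp * bOp lmp R t) / (√3 : ℝ)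

lemma ab_bound {R : ℝ → ℂ} {B : ℝ} (hB : ∀ t, ‖R t‖ ≤ B) (t : ℝ) :
    ‖aOp lmm R t‖ ≤ 2 * B / √3 ∧ ‖bOp lmp R t‖ ≤ 2 * B / √3 := by
  have h3 : (0:ℝ) < √3 := by positivity
  constructor
  · refine (aOp_bound lmm_re hB t).trans (le_of_eq ?_)
    simp only [lmm]; field_simp
  · refine (aOp_bound lmp_re (fun t => hB (-t)) (-t)).trans (le_of_eq ?_)
    simp only [lmp, neg_re]; field_simp

lemma dOp_bound {R : ℝ → ℂ} {B : ℝ} (hB : ∀ t, ‖R t‖ ≤ B) (t : ℝ) : ‖dOp R t‖ ≤ 3 * B := by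
  have h3 : (0:ℝ) < √3 := by positivity
  have hs := s3
  have hB0 : 0 ≤ B := (norm_nonneg _).trans (hB 0)
  obtain ⟨ha, hb⟩ := ab_bound hB t
  unfold dOp
  rw [norm_div, Complex.norm_real, Real.norm_of_nonneg h3.le, div_le_iff₀ h3]
  refine (norm_add_le _ _).trans ((add_le_add ha hb).trans ?_)
  rw [← add_div, div_le_iff₀ h3]; nlinarith

lemma eOp_bound {R : ℝ → ℂ} {B : ℝ} (hB : ∀ t, ‖R t‖ ≤ B) (t : ℝ) : ‖eOp R t‖ ≤ 3 * B := by
  have h3 : (0:ℝ) < √3 := by positivity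
  have hs := s3
  have hB0 : 0 ≤ B := (norm_nonneg _).trans (hB 0)
  obtain ⟨ha, hb⟩ := ab_bound hB t
  unfold eOp
  rw [norm_div, Complex.norm_real, Real.norm_of_nonneg h3.le, div_le_iff₀ h3]
  have h1 : ‖lmm * aOp lmm R t‖ ≤ 2 * B := by
    rw [norm_mul, norm_lmm]
    calc _ ≤ √3 * (2 * B / √3) := by gcongr
      _ = _ := by field_simp
  have h2 : ‖lmp * bOp lmp R t‖ ≤ 2 * B := by
    rw [norm_mul, norm_lmp]
    calc _ ≤ √3 * (2 * B / √3) := by gcongr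
      _ = _ := by field_simp
  refine (norm_add_le _ _).trans ((add_le_add h1 h2).trans ?_)
  have : (4/3:ℝ) ≤ √3 := by
    apply Real.le_sqrt_of_sq_le; norm_num
  nlinarith

lemma bOp_deriv {R : ℝ → ℂ} (hR : Continuous R) {B : ℝ}
    (hB : ∀ t, ‖R t‖ ≤ B) (t : ℝ) :
    HasDerivAt (bOp lmp R) (lmp * bOp lmp R t - R t) t := by
  have h := aOp_deriv lmp_re (R := fun s => R (-s)) (by fun_prop) (fun t => hB (-t)) (-t)
  have h2 := h.scomp t (hasDerivAt_neg t)
  refine (h2.congr_deriv ?_)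
  simp [bOp]; ring

lemma dOp_deriv {R : ℝ → ℂ} (hR : Continuous R) {B : ℝ}
    (hB : ∀ t, ‖R t‖ ≤ B) (t : ℝ) : HasDerivAt (dOp R) (eOp R t) t := by
  have h := ((aOp_deriv lmm_re hR hB t).add (bOp_deriv hR hB t)).div_const ((√3 : ℝ) : ℂ)
  refine h.congr_deriv ?_
  unfold eOp; ring

lemma eOp_deriv {R : ℝ → ℂ} (hR : Continuous R) {B : ℝ}
    (hB : ∀ t, ‖R t‖ ≤ B) (t : ℝ) :
    HasDerivAt (eOp R) (3 * dOp R t - 3 * I * eOp R t - R t) t := by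
  have h := (((aOp_deriv lmm_re hR hB t).const_mul lmm).add
    ((bOp_deriv hR hB t).const_mul lmp)).div_const ((√3 : ℝ) : ℂ)
  refine h.congr_deriv ?_
  have h3 : ((√3 : ℝ) : ℂ) ≠ 0 := by exact_mod_cast (by positivity : (√3:ℝ) ≠ 0)
  unfold dOp eOp
  field_simp
  linear_combination (aOp lmm R t) * lmm_eq + (bOp lmp R t) * lmp_eq - R t * lmp_sub

lemma dOp_sub {R S : ℝ → ℂ} (hR : Continuous R) (hS : Continuous S)
    {B B' : ℝ} (hB : ∀ t, ‖R t‖ ≤ B) (hB' : ∀ t, ‖S t‖ ≤ B') (t : ℝ) :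
    dOp R t - dOp S t = dOp (fun s => R s - S s) t ∧
    eOp R t - eOp S t = eOp (fun s => R s - S s) t := by
  have h1 := aOp_sub lmm_re hR hS hB hB' t
  have h2 := aOp_sub lmp_re (R := fun s => R (-s)) (S := fun s => S (-s)) (by fun_prop)
    (by fun_prop) (fun t => hB (-t)) (fun t => hB' (-t)) (-t)
  unfold dOp eOp bOp
  constructor
  · rw [← h1, ← h2]; ring
  · rw [← h1, ← h2]; ring


noncomputable def psi (ω0 ω1 ω2 δ η : ℂ) : ℂ :=
  3*I*ω0*ω1 + ω2 + 3*(1-ω0^2)*δ - 3*ω0*δ^2 - δ^3 + 3*I*ω1*δ + 3*I*(ω0-1)*η + 3*I*δ*η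

lemma norm_bd {a b : ℂ} {x y : ℝ} (ha : ‖a‖ ≤ x) (hb : ‖b‖ ≤ y) : ‖a * b‖ ≤ x * y := by
  rw [norm_mul]; exact mul_le_mul ha hb (norm_nonneg _) ((norm_nonneg _).trans ha)
lemma norm_bd_add {a b : ℂ} {x y : ℝ} (ha : ‖a‖ ≤ x) (hb : ‖b‖ ≤ y) : ‖a + b‖ ≤ x + y :=
  (norm_add_le _ _).trans (add_le_add ha hb)
lemma norm_bd_sub {a b : ℂ} {x y : ℝ} (ha : ‖a‖ ≤ x) (hb : ‖b‖ ≤ y) : ‖a - b‖ ≤ x + y :=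
  (norm_sub_le _ _).trans (add_le_add ha hb)

lemma psi_diff {ω0 ω1 ω2 δ η δ' η' : ℂ} {r : ℝ} (h0 : ‖ω0 - 1‖ ≤ 1/10000)
    (h1 : ‖ω1‖ ≤ 1/10000) (hd : ‖δ‖ ≤ 3/1000) (he : ‖η‖ ≤ 3/1000)
    (hd' : ‖δ'‖ ≤ 3/1000) (hr1 : ‖δ - δ'‖ ≤ 3 * r) (hr2 : ‖η - η'‖ ≤ 3 * r) :
    ‖psi ω0 ω1 ω2 δ η - psi ω0 ω1 ω2 δ' η'‖ ≤ r / 2 := by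
  have hr : 0 ≤ r := by have := (norm_nonneg _).trans hr1; linarith
  have e : psi ω0 ω1 ω2 δ η - psi ω0 ω1 ω2 δ' η' =
      (δ - δ') * ((-3 * (ω0 - 1)) * (2 + (ω0 - 1)) - (3 + 3 * (ω0 - 1)) * (δ + δ')
        - (δ * δ + δ * δ' + δ' * δ') + (3 * I) * ω1 + (3 * I) * η)
      + (η - η') * ((3 * I) * (ω0 - 1) + (3 * I) * δ') := by
    unfold psi; ring
  rw [e]
  have h2 : ‖(2:ℂ)‖ ≤ 2 := by simp
  have h3 : ‖(3:ℂ)‖ ≤ 3 := by simp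
  have hm3 : ‖(-3:ℂ)‖ ≤ 3 := by simp
  have h3I : ‖3 * I‖ ≤ 3 := by simp
  have A1 := norm_bd (norm_bd hm3 h0) (norm_bd_add h2 h0)
  have A2 := norm_bd (norm_bd_add h3 (norm_bd h3 h0)) (norm_bd_add hd hd')
  have A3 := norm_bd_add (norm_bd_add (norm_bd hd hd) (norm_bd hd hd')) (norm_bd hd' hd')
  have A := norm_bd hr1 (norm_bd_add (norm_bd_add (norm_bd_sub (norm_bd_sub A1 A2) A3)
    (norm_bd h3I h1)) (norm_bd h3I he))
  have B := norm_bd hr2 (norm_bd_add (norm_bd h3I h0) (norm_bd h3I hd'))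
  refine (norm_bd_add A B).trans ?_
  nlinarith

lemma psi_bd {ω0 ω1 ω2 δ η : ℂ} {e : ℝ} (he : e ≤ 1/10000) (h0 : ‖ω0 - 1‖ ≤ 1/10000)
    (h1 : ‖ω1‖ ≤ e) (h2 : ‖ω2‖ ≤ e) (hd : ‖δ‖ ≤ 30 * e) (hη : ‖η‖ ≤ 30 * e) :
    ‖psi ω0 ω1 ω2 δ η‖ ≤ 10 * e := by
  have he0 : 0 ≤ e := (norm_nonneg _).trans h1
  have := psi_diff (ω0 := ω0) (ω1 := ω1) (ω2 := ω2) (δ := δ) (η := η) (δ' := 0) (η' := 0)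
    (r := 10 * e) h0 (h1.trans he) (by linarith) (by linarith) (by simp; norm_num)
    (by simpa using hd.trans (by linarith)) (by simpa using hη.trans (by linarith))
  have h3I : ‖3 * I‖ ≤ 3 := by simp
  have h4 : ‖psi ω0 ω1 ω2 0 0‖ ≤ 5 * e := by
    have e1 : psi ω0 ω1 ω2 0 0 = (3 * I) * (((ω0 - 1) + 1) * ω1) + ω2 := by unfold psi; ring
    rw [e1]
    have h1' : ‖(1:ℂ)‖ ≤ 1 := by simp
    refine (norm_bd_add (norm_bd h3I (norm_bd (norm_bd_add h0 h1') h1)) h2).trans ?_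
    nlinarith
  calc _ = ‖(psi ω0 ω1 ω2 δ η - psi ω0 ω1 ω2 0 0) + psi ω0 ω1 ω2 0 0‖ := by ring_nf
    _ ≤ 10 * e / 2 + 5 * e := norm_bd_add this h4
    _ = _ := by ring

open BoundedContinuousFunction in
lemma fix_exists {ω0 ω1 ω2 : ℝ → ℂ} (c0 : Continuous ω0) (c1 : Continuous ω1)
    (c2 : Continuous ω2) {e : ℝ} (he : e ≤ 1/10000) (h0 : ∀ t, ‖ω0 t - 1‖ ≤ 1/10000)
    (h1 : ∀ t, ‖ω1 t‖ ≤ e) (h2 : ∀ t, ‖ω2 t‖ ≤ e) :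
    ∃ R : ℝ → ℂ, Continuous R ∧ (∀ t, ‖R t‖ ≤ 10 * e) ∧
      ∀ t, R t = psi (ω0 t) (ω1 t) (ω2 t) (dOp R t) (eOp R t) := by
  have he0 : 0 ≤ e := (norm_nonneg _).trans (h1 0)
  let s : Set (ℝ →ᵇ ℂ) := Metric.closedBall 0 (10 * e)
  have mem : ∀ R : ℝ →ᵇ ℂ, R ∈ s ↔ ∀ t, ‖R t‖ ≤ 10 * e := by
    intro R
    rw [mem_closedBall_zero_iff, BoundedContinuousFunction.norm_le (by positivity)]
  have cd : ∀ R : ℝ →ᵇ ℂ, Continuous (dOp R) ∧ Continuous (eOp R) := fun R =>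
    ⟨continuous_iff_continuousAt.2 fun t =>
      (dOp_deriv R.continuous (R.norm_coe_le_norm) t).continuousAt,
     continuous_iff_continuousAt.2 fun t =>
      (eOp_deriv R.continuous (R.norm_coe_le_norm) t).continuousAt⟩
  have bd : ∀ R ∈ s, ∀ t, ‖psi (ω0 t) (ω1 t) (ω2 t) (dOp R t) (eOp R t)‖ ≤ 10 * e := by
    intro R hR t
    have hR := (mem R).1 hR
    exact psi_bd he (h0 t) (h1 t) (h2 t) ((dOp_bound hR t).trans (by linarith))
      ((eOp_bound hR t).trans (by linarith))
  have cpsi : ∀ R : ℝ →ᵇ ℂ, Continuous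
      (fun t => psi (ω0 t) (ω1 t) (ω2 t) (dOp R t) (eOp R t)) := by
    intro R
    have := (cd R).1
    have := (cd R).2
    unfold psi
    fun_prop
  classical
  let Ψ : (ℝ →ᵇ ℂ) → (ℝ →ᵇ ℂ) := fun R => if h : R ∈ s then
    BoundedContinuousFunction.ofNormedAddCommGroup _ (cpsi R) (10 * e) (bd R h) else R
  have Ψv : ∀ R ∈ s, ∀ t, Ψ R t = psi (ω0 t) (ω1 t) (ω2 t) (dOp R t) (eOp R t) := by
    intro R hR t
    simp only [Ψ, dif_pos hR]; rfl
  have hmaps : Set.MapsTo Ψ s s := by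
    intro R hR
    rw [mem]
    intro t
    rw [Ψv R hR]; exact bd R hR t
  have hcontr : ContractingWith (1/2) (hmaps.restrict Ψ s s) := by
    refine ⟨by rw [← NNReal.coe_lt_coe]; norm_num, LipschitzWith.of_dist_le_mul ?_⟩
    rintro ⟨R, hR⟩ ⟨S, hS⟩
    change dist (Ψ R) (Ψ S) ≤ _ * dist R S
    rw [BoundedContinuousFunction.dist_le (by positivity)]
    intro t
    rw [Ψv R hR, Ψv S hS, dist_eq_norm]
    have hRb := (mem R).1 hR
    have hSb := (mem S).1 hS
    have hd : ∀ t, ‖R t - S t‖ ≤ dist R S := fun t => by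
      rw [← dist_eq_norm]; exact BoundedContinuousFunction.dist_coe_le_dist t
    have hsub := dOp_sub R.continuous S.continuous hRb hSb t
    refine (psi_diff (r := dist R S) (h0 t) ((h1 t).trans he)
      ((dOp_bound hRb t).trans (by linarith))
      ((eOp_bound hRb t).trans (by linarith)) ((dOp_bound hSb t).trans (by linarith)) ?_ ?_).trans ?_
    · rw [hsub.1]; exact dOp_bound hd t
    · rw [hsub.2]; exact eOp_bound hd t
    · apply le_of_eq; simp; ring
  have hsc : IsComplete s := Metric.isClosed_closedBall.isComplete
  have h0s : (0 : ℝ →ᵇ ℂ) ∈ s := by rw [mem]; intro t; simp; positivity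
  obtain ⟨R, hRs, hfix, -⟩ := hcontr.exists_fixedPoint' hsc hmaps h0s (edist_ne_top _ _)
  refine ⟨R, R.continuous, (mem R).1 hRs, fun t => ?_⟩
  rw [← Ψv R hRs t, hfix]

lemma riccati {ω0 : ℝ → ℂ} (c0 : ContDiff ℝ (⊤ : ℕ∞) ω0) {e : ℝ} (he : e ≤ 1/10000)
    (h0 : ∀ t, ‖ω0 t - 1‖ ≤ 1/10000)
    (h1 : ∀ t, ‖deriv ω0 t‖ ≤ e) (h2 : ∀ t, ‖deriv (deriv ω0) t‖ ≤ e) :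
    ∃ ω : ℝ → ℂ, ContDiff ℝ (⊤ : ℕ∞) ω ∧ (∀ t, ‖ω t - ω0 t‖ ≤ 30 * e) ∧
      (∀ t, ‖deriv ω t - deriv ω0 t‖ ≤ 30 * e) ∧
      ∀ t, ω t ^ 3 - 3 * I * ω t * deriv ω t - deriv (deriv ω) t = ω0 t ^ 3 := by
  have c1 : ContDiff ℝ (⊤ : ℕ∞) (deriv ω0) := ((contDiff_infty_iff_deriv).1 c0).2
  have c2 : ContDiff ℝ (⊤ : ℕ∞) (deriv (deriv ω0)) := ((contDiff_infty_iff_deriv).1 c1).2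
  obtain ⟨R, cR, bR, fR⟩ := fix_exists c0.continuous c1.continuous c2.continuous he h0 h1 h2
  have hd := dOp_deriv cR bR
  have hη := eOp_deriv cR bR
  have dd : deriv (dOp R) = eOp R := funext fun t => (hd t).deriv
  have de : deriv (eOp R) = fun t => 3 * dOp R t - 3 * I * eOp R t - R t :=
    funext fun t => (hη t).deriv
  have smooth : ∀ n : ℕ, ContDiff ℝ n (dOp R) ∧ ContDiff ℝ n (eOp R) := by
    intro n
    induction n with
    | zero =>
      simp only [Nat.cast_zero, contDiff_zero]
      exact ⟨continuous_iff_continuousAt.2 fun t => (hd t).continuousAt,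
        continuous_iff_continuousAt.2 fun t => (hη t).continuousAt⟩
    | succ n ih =>
      obtain ⟨i1, i2⟩ := ih
      have k0 : ContDiff ℝ n ω0 := c0.of_le (by exact_mod_cast le_top)
      have k1 : ContDiff ℝ n (deriv ω0) := c1.of_le (by exact_mod_cast le_top)
      have k2 : ContDiff ℝ n (deriv (deriv ω0)) := c2.of_le (by exact_mod_cast le_top)
      have kR : ContDiff ℝ n R := by
        have : R = fun t => psi (ω0 t) (deriv ω0 t) (deriv (deriv ω0) t) (dOp R t) (eOp R t) :=
          funext fR
        rw [this]
        unfold psi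
        fun_prop
      constructor
      · rw [Nat.cast_succ, contDiff_succ_iff_deriv]
        refine ⟨fun t => (hd t).differentiableAt, by simp, ?_⟩
        rw [dd]; exact i2
      · rw [Nat.cast_succ, contDiff_succ_iff_deriv]
        refine ⟨fun t => (hη t).differentiableAt, by simp, ?_⟩
        rw [de]; fun_prop
  have sd : ContDiff ℝ (⊤ : ℕ∞) (dOp R) := contDiff_infty.2 fun n => (smooth n).1
  have D0 : ∀ t, HasDerivAt ω0 (deriv ω0 t) t := fun t =>
    (c0.differentiable (by simp) t).hasDerivAt
  have D1 : ∀ t, HasDerivAt (deriv ω0) (deriv (deriv ω0) t) t := fun t =>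
    (c1.differentiable (by simp) t).hasDerivAt
  have e1 : deriv (fun t => ω0 t + dOp R t) = fun t => deriv ω0 t + eOp R t :=
    funext fun t => ((D0 t).add (hd t)).deriv
  have e2 : deriv (fun t => deriv ω0 t + eOp R t) =
      fun t => deriv (deriv ω0) t + (3 * dOp R t - 3 * I * eOp R t - R t) :=
    funext fun t => ((D1 t).add (hη t)).deriv
  refine ⟨fun t => ω0 t + dOp R t, c0.add sd, fun t => ?_, fun t => ?_, fun t => ?_⟩
  · simpa using (dOp_bound bR t).trans (by linarith)
  · rw [e1]; simpa using (eOp_bound bR t).trans (by linarith)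
  · rw [e1, e2]
    have := fR t
    unfold psi at this
    simp only
    linear_combination this


noncomputable def cr (τ : ℝ) : ℂ := (1 + I * (τ : ℂ)) ^ ((1:ℂ)/3)

lemma W_ne (τ : ℝ) : (1 + I * (τ : ℂ)) ≠ 0 := by
  intro h
  have := congrArg Complex.re h
  simp at this

lemma W_slit (τ : ℝ) : (1 + I * (τ : ℂ)) ∈ Complex.slitPlane := by
  left; simp

lemma cr_cube (τ : ℝ) : cr τ ^ 3 = 1 + I * τ := by
  have := cpow_nat_inv_pow (1 + I * (τ : ℂ)) (n := 3) (by norm_num)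
  unfold cr
  rw [one_div]
  exact_mod_cast this

lemma cr_exp (τ : ℝ) : cr τ = cexp (Complex.log (1 + I * (τ : ℂ)) / 3) := by
  unfold cr
  rw [cpow_def_of_ne_zero (W_ne τ)]; ring_nf

lemma cr_norm (τ : ℝ) : 1 ≤ ‖cr τ‖ := by
  have h : ‖cr τ‖ ^ 3 = ‖1 + I * (τ : ℂ)‖ := by rw [← norm_pow, cr_cube]
  have h2 : 1 ≤ ‖1 + I * (τ : ℂ)‖ := by
    have := Complex.abs_re_le_norm (1 + I * (τ : ℂ))
    simpa using this
  by_contra hc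
  push Not at hc
  have : ‖cr τ‖ ^ 3 < 1 := pow_lt_one₀ (norm_nonneg _) hc (by norm_num)
  linarith

lemma cr_den (τ : ℝ) : 1 ≤ ‖cr τ ^ 2 + cr τ + 1‖ := by
  have harg : |Complex.arg (1 + I * (τ : ℂ))| < Real.pi / 2 := by
    rw [Complex.abs_arg_lt_pi_div_two_iff]; left; simp
  rw [abs_lt] at harg
  have hpi := Real.pi_pos
  have h1 : 0 ≤ (cr τ).re := by
    rw [cr_exp, Complex.exp_re]
    have : (Complex.log (1 + I * (τ : ℂ)) / 3).im = Complex.arg (1 + I * (τ : ℂ)) / 3 := by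
      have := Complex.div_ofReal_im (Complex.log (1 + I * (τ : ℂ))) 3
      rw [← Complex.log_im]; exact_mod_cast this
    rw [this]
    exact mul_nonneg (Real.exp_pos _).le
      (Real.cos_nonneg_of_neg_pi_div_two_le_of_le (by linarith) (by linarith))
  have h2 : 0 ≤ (cr τ ^ 2).re := by
    have e : cr τ ^ 2 = cexp (((2/3:ℝ):ℂ) * Complex.log (1 + I * (τ : ℂ))) := by
      rw [cr_exp, ← Complex.exp_nat_mul]; congr 1; push_cast; ring
    rw [e, Complex.exp_re, Complex.im_ofReal_mul, Complex.log_im]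
    exact mul_nonneg (Real.exp_pos _).le
      (Real.cos_nonneg_of_neg_pi_div_two_le_of_le (by linarith) (by linarith))
  have := Complex.abs_re_le_norm (cr τ ^ 2 + cr τ + 1)
  have h3 : (cr τ ^ 2 + cr τ + 1).re = (cr τ ^ 2).re + (cr τ).re + 1 := by simp
  rw [h3] at this
  have := le_abs_self ((cr τ ^ 2).re + (cr τ).re + 1)
  linarith

lemma cr_sub (τ : ℝ) : ‖cr τ - 1‖ ≤ |τ| := by
  have h : (cr τ - 1) * (cr τ ^ 2 + cr τ + 1) = I * τ := by
    have := cr_cube τ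
    linear_combination this
  have h2 := congrArg norm h
  rw [norm_mul, norm_mul, Complex.norm_I, Complex.norm_real, one_mul, Real.norm_eq_abs] at h2
  have := cr_den τ
  nlinarith [norm_nonneg (cr τ - 1)]

lemma cr_im {y x K : ℝ} (hy : 0 < y) (hK : |x| ≤ K) (hyK : y * K ≤ 1) :
    |3 / y * (cr (y * x)).im - x| ≤ 4 * K * y * |x| := by
  set w := cr (y * x) with hw
  have hden := cr_den (y * x)
  have hsub := cr_sub (y * x)
  rw [← hw] at hden hsub
  have hne : w ^ 2 + w + 1 ≠ 0 := by
    intro h; rw [h] at hden; simp at hden; linarith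
  have h : (w - 1) * (w ^ 2 + w + 1) = I * ((y * x : ℝ) : ℂ) := by
    have := cr_cube (y * x)
    rw [← hw] at this
    linear_combination this
  have hyc : (y : ℂ) ≠ 0 := by exact_mod_cast hy.ne'
  have e1 : (3 / y * w.im - x : ℝ) = ((3 / (I * y)) * (w - 1) - x : ℂ).re := by
    have : (3 / (I * y)) * (w - 1) = ((3 / y : ℝ) : ℂ) * (-I * (w - 1)) := by
      push_cast
      rw [mul_comm I, ← div_div, Complex.div_I]; ring
    rw [this, Complex.sub_re, Complex.re_ofReal_mul]
    simp
  have e2 : ((3 / (I * y)) * (w - 1) - x : ℂ) * (w ^ 2 + w + 1) = x * ((1 - w) * (3 + (w - 1))) := by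
    push_cast at h
    field_simp
    linear_combination 3 * h
  rw [e1]
  refine (Complex.abs_re_le_norm _).trans ?_
  have e3 := congrArg norm e2
  rw [norm_mul, norm_mul, norm_mul, Complex.norm_real, Real.norm_eq_abs, norm_sub_rev 1 w] at e3
  have hyx : |y * x| ≤ y * K := by rw [abs_mul, abs_of_pos hy]; gcongr
  have h4 : ‖3 + (w - 1)‖ ≤ 4 := by
    refine (norm_add_le _ _).trans ?_
    have : ‖(3:ℂ)‖ = 3 := by simp
    rw [this]; linarith
  have h5 : ‖w - 1‖ * ‖3 + (w - 1)‖ ≤ (y * K) * 4 :=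
    mul_le_mul (hsub.trans hyx) h4 (norm_nonneg _) ((abs_nonneg _).trans hyx)
  calc _ ≤ ‖((3 / (I * y)) * (w - 1) - x : ℂ)‖ * ‖w ^ 2 + w + 1‖ :=
        le_mul_of_one_le_right (norm_nonneg _) hden
    _ = |x| * (‖w - 1‖ * ‖3 + (w - 1)‖) := e3
    _ ≤ |x| * ((y * K) * 4) := by gcongr
    _ = _ := by ring

lemma cr_deriv {g : ℝ → ℝ} {g' t : ℝ} (hg : HasDerivAt g g' t) :
    HasDerivAt (fun t => cr (g t)) (I * g' / (3 * cr (g t) ^ 2)) t := by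
  have h1 : HasDerivAt (fun t => 1 + I * ((g t : ℝ) : ℂ)) (I * g') t :=
    (hg.ofReal_comp.const_mul I).const_add 1
  have h2 := ((h1.clog_real (W_slit _)).div_const 3).cexp
  have e : (fun t => cr (g t)) = fun t => cexp (Complex.log (1 + I * ((g t : ℝ) : ℂ)) / 3) :=
    funext fun t => cr_exp _
  rw [e]
  refine h2.congr_deriv ?_
  rw [← cr_exp]
  have hn : cr (g t) ≠ 0 := by
    intro h; have := cr_norm (g t); rw [h] at this; simp at this; linarith
  rw [← cr_cube]
  field_simp

lemma cr_contDiff {g : ℝ → ℝ} (hg : ContDiff ℝ (⊤ : ℕ∞) g) :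
    ContDiff ℝ (⊤ : ℕ∞) (fun t => cr (g t)) := by
  have e : (fun t => cr (g t)) = fun t => cexp (Complex.log (1 + I * ((g t : ℝ) : ℂ)) / 3) :=
    funext fun t => cr_exp _
  rw [e]
  have h1 : ContDiff ℝ (⊤ : ℕ∞) (fun t => 1 + I * ((g t : ℝ) : ℂ)) :=
    contDiff_const.add (contDiff_const.mul (Complex.ofRealCLM.contDiff.comp hg))
  have h2 : ContDiff ℝ (⊤ : ℕ∞) (fun t => Complex.log (1 + I * ((g t : ℝ) : ℂ))) := by
    rw [contDiff_iff_contDiffAt]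
    intro t
    exact ((Complex.contDiffAt_log (W_slit _)).restrict_scalars ℝ).comp t h1.contDiffAt
  exact (h2.div_const 3).cexp

lemma cr_bounds {g : ℝ → ℝ} (hg : ContDiff ℝ (⊤ : ℕ∞) g) {A B : ℝ}
    (hA : ∀ t, |deriv g t| ≤ A) (hB : ∀ t, |deriv (deriv g) t| ≤ B) (t : ℝ) :
    ‖deriv (fun t => cr (g t)) t‖ ≤ A ∧ ‖deriv (deriv (fun t => cr (g t))) t‖ ≤ B + A ^ 2 := by
  have hg1 : ContDiff ℝ (⊤ : ℕ∞) (deriv g) := ((contDiff_infty_iff_deriv).1 hg).2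
  have D0 : ∀ t, HasDerivAt g (deriv g t) t := fun t =>
    (hg.differentiable (by simp) t).hasDerivAt
  have D1 : ∀ t, HasDerivAt (deriv g) (deriv (deriv g) t) t := fun t =>
    (hg1.differentiable (by simp) t).hasDerivAt
  have hn : ∀ t, cr (g t) ≠ 0 := by
    intro t h; have := cr_norm (g t); rw [h] at this; simp at this; linarith
  have e1 : deriv (fun t => cr (g t)) = fun t => I * ((deriv g t : ℝ) : ℂ) / (3 * cr (g t) ^ 2) :=
    funext fun t => (cr_deriv (D0 t)).deriv
  have hA0 : 0 ≤ A := (abs_nonneg _).trans (hA 0)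
  have hB0 : 0 ≤ B := (abs_nonneg _).trans (hB 0)
  have b1 : ∀ t, ‖I * ((deriv g t : ℝ) : ℂ) / (3 * cr (g t) ^ 2)‖ ≤ A / 3 := by
    intro t
    have h1 := one_le_pow₀ (n := 2) (cr_norm (g t))
    rw [norm_div, norm_mul, norm_mul, norm_pow, Complex.norm_I, Complex.norm_real, one_mul,
      Real.norm_eq_abs, div_le_div_iff₀ (by simp; positivity) (by norm_num)]
    have : ‖(3:ℂ)‖ = 3 := by simp
    rw [this]
    nlinarith [hA t, mul_le_mul_of_nonneg_left h1 hA0]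
  refine ⟨?_, ?_⟩
  · rw [e1]; exact (b1 t).trans (by linarith)
  · have h2 : HasDerivAt (fun t => I * ((deriv g t : ℝ) : ℂ) / (3 * cr (g t) ^ 2))
        (I * ((deriv (deriv g) t : ℝ) : ℂ) / (3 * cr (g t) ^ 2)
          - 2 * (I * ((deriv g t : ℝ) : ℂ) / (3 * cr (g t) ^ 2)) ^ 2 / cr (g t)) t := by
      have h3 := (((D1 t).ofReal_comp.const_mul I)).div
        (((cr_deriv (D0 t)).pow 2).const_mul (3:ℂ))
        (mul_ne_zero (by norm_num) (pow_ne_zero 2 (hn t)))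
      refine h3.congr_deriv ?_
      have := hn t
      simp
      field_simp
    rw [e1, h2.deriv]
    have h1 := one_le_pow₀ (n := 2) (cr_norm (g t))
    have k1 : ‖I * ((deriv (deriv g) t : ℝ) : ℂ) / (3 * cr (g t) ^ 2)‖ ≤ B := by
      rw [norm_div, norm_mul, norm_mul, norm_pow, Complex.norm_I, Complex.norm_real, one_mul,
        Real.norm_eq_abs, div_le_iff₀ (by simp; positivity)]
      have : ‖(3:ℂ)‖ = 3 := by simp
      rw [this]
      nlinarith [hB t, mul_le_mul_of_nonneg_left h1 hB0]
    have k2 : ‖2 * (I * ((deriv g t : ℝ) : ℂ) / (3 * cr (g t) ^ 2)) ^ 2 / cr (g t)‖ ≤ A ^ 2 := by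
      rw [norm_div, norm_mul, norm_pow, div_le_iff₀ (by linarith [cr_norm (g t)])]
      have : ‖(2:ℂ)‖ = 2 := by simp
      rw [this]
      have := pow_le_pow_left₀ (norm_nonneg _) (b1 t) 2
      have := mul_le_mul_of_nonneg_left (cr_norm (g t)) (sq_nonneg A)
      nlinarith [sq_nonneg A]
    exact (norm_sub_le _ _).trans (add_le_add k1 k2)

lemma pot_exists (M : ℝ) (hM : 1 ≤ M) : ∃ V : ℝ → ℝ, ContDiff ℝ (⊤ : ℕ∞) V ∧
    (∀ s ∈ Set.Icc (-M) M, V s = s ^ 2 - 1) ∧ ∃ K : ℝ, 1 ≤ K ∧ (∀ s, |V s| ≤ K) ∧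
      (∀ s, |deriv V s| ≤ K) ∧ (∀ s, |deriv (deriv V) s| ≤ K) := by
  let χ : ContDiffBump (0:ℝ) := ⟨M, 2 * M, by linarith, by linarith⟩
  have hχ : ContDiff ℝ (⊤ : ℕ∞) (χ : ℝ → ℝ) := χ.contDiff
  have hV : ContDiff ℝ (⊤ : ℕ∞) (fun s => χ s * (s ^ 2 - 1)) := by fun_prop
  have hs : HasCompactSupport (fun s => χ s * (s ^ 2 - 1)) := χ.hasCompactSupport.mul_right
  have hV1 := ((contDiff_infty_iff_deriv).1 hV).2
  have hV2 := ((contDiff_infty_iff_deriv).1 hV1).2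
  obtain ⟨K0, h0⟩ := hs.exists_bound_of_continuous hV.continuous
  obtain ⟨K1, h1⟩ := hs.deriv.exists_bound_of_continuous hV1.continuous
  obtain ⟨K2, h2⟩ := hs.deriv.deriv.exists_bound_of_continuous hV2.continuous
  refine ⟨_, hV, ?_, max 1 (max K0 (max K1 K2)), le_max_left _ _, ?_, ?_, ?_⟩
  · intro s hs
    have : χ s = 1 := χ.one_of_mem_closedBall (by
      simp only [χ, Metric.mem_closedBall, Real.dist_eq, sub_zero]; exact abs_le.2 hs)
    simp [this]
  · intro s; exact (h0 s).trans (by simp)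
  · intro s; exact (h1 s).trans (by simp)
  · intro s; exact (h2 s).trans (by simp)

lemma pack (M : ℝ) (hM : 1 ≤ M) : ∃ C : ℝ, 0 < C ∧ ∃ y0 : ℝ, 0 < y0 ∧ y0 ≤ 1 ∧
    ∀ h y : ℝ, 0 < h → h ≤ 1 → 0 < y → y ≤ y0 →
    ∃ ω : ℝ → ℂ, ContDiff ℝ (⊤ : ℕ∞) ω ∧ (∀ s, ‖ω s - 1‖ ≤ C * y) ∧ (∀ s, ‖deriv ω s‖ ≤ C * y) ∧
      (∀ s ∈ Set.Icc (-M) M, ω s ^ 3 - 3 * I * ((y * h / 3 : ℝ) : ℂ) * ω s * deriv ω s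
        - ((y * h / 3 : ℝ) : ℂ) ^ 2 * deriv (deriv ω) s = 1 + I * ((y * (s ^ 2 - 1) : ℝ) : ℂ)) ∧
      (∀ s ∈ Set.Icc (-M) M, |3 / y * (ω s).im - 3 / y * (cr (y * (s ^ 2 - 1))).im| ≤ C * y * h) ∧
      (∀ s ∈ Set.Icc (-M) M, |3 / y * (cr (y * (s ^ 2 - 1))).im - (s ^ 2 - 1)|
        ≤ C * y * |s ^ 2 - 1|) := by
  obtain ⟨V, cV, hV, K, hK1, hK0, hKd, hKdd⟩ := pot_exists M hM
  have hKK : K ≤ K ^ 2 := by nlinarith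
  have hK2 : 1 ≤ K ^ 2 := by nlinarith
  refine ⟨200 * K ^ 2, by positivity, 1 / (20000 * K ^ 2), by positivity, ?_, ?_⟩
  · rw [div_le_one (by positivity)]; linarith
  intro h y hh hh1 hy hyy
  have hyK : y * K ^ 2 ≤ 1 / 20000 := by
    rw [le_div_iff₀ (by positivity)] at hyy; linarith
  have hyK' : y * K ≤ 1 / 20000 := (mul_le_mul_of_nonneg_left hKK hy.le).trans hyK
  have hy1 : y ≤ 1 := by nlinarith
  set σ := y * h / 3 with hσ
  have hσ0 : 0 < σ := by positivity
  have hσ1 : σ ≤ 1 := by nlinarith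
  let g : ℝ → ℝ := fun t => y * V (σ * t)
  have cg : ContDiff ℝ (⊤ : ℕ∞) g := contDiff_const.mul (cV.comp (contDiff_const.mul contDiff_id))
  have cV1 := ((contDiff_infty_iff_deriv).1 cV).2
  have DV : ∀ t, HasDerivAt V (deriv V t) t := fun t => (cV.differentiable (by simp) t).hasDerivAt
  have DV1 : ∀ t, HasDerivAt (deriv V) (deriv (deriv V) t) t := fun t =>
    (cV1.differentiable (by simp) t).hasDerivAt
  have Dl : ∀ t : ℝ, HasDerivAt (fun t => σ * t) σ t := fun t => by
    simpa using (hasDerivAt_id t).const_mul σ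
  have dg : deriv g = fun t => y * (deriv V (σ * t) * σ) := funext fun t =>
    (((DV (σ * t)).comp t (Dl t)).const_mul y).deriv
  have dg2 : deriv (deriv g) = fun t => y * (deriv (deriv V) (σ * t) * σ * σ) := by
    rw [dg]; exact funext fun t =>
      ((((DV1 (σ * t)).comp t (Dl t)).mul_const σ).const_mul y).deriv
  have bA : ∀ t, |deriv g t| ≤ y * σ * K := by
    intro t
    rw [dg]; simp only [abs_mul, abs_of_pos hy, abs_of_pos hσ0]
    calc y * (|deriv V (σ * t)| * σ) ≤ y * (K * σ) := by gcongr; exact hKd _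
      _ = _ := by ring
  have bB : ∀ t, |deriv (deriv g) t| ≤ y * σ * K := by
    intro t
    rw [dg2]; simp only [abs_mul, abs_of_pos hy, abs_of_pos hσ0]
    calc y * (|deriv (deriv V) (σ * t)| * σ * σ) ≤ y * (K * σ * 1) := by gcongr; exact hKdd _
      _ = _ := by ring
  have hyσ : 0 < y * σ := by positivity
  have he1 : y * σ * K ≤ 2 * (y * σ * K ^ 2) := by nlinarith
  have he2 : y * σ * K + (y * σ * K) ^ 2 ≤ 2 * (y * σ * K ^ 2) := by
    have : (y * σ * K) ^ 2 ≤ y * σ * K ^ 2 := by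
      have : (y * σ * K) ^ 2 = (y * σ * K ^ 2) * (y * σ) := by ring
      rw [this]; exact mul_le_of_le_one_right (by positivity) (by nlinarith)
    nlinarith
  have hgb : ∀ t, |g t| ≤ y * K := by
    intro t; simp only [g, abs_mul, abs_of_pos hy]; gcongr; exact hK0 _
  obtain ⟨w, cw, w0, w1, weq⟩ := riccati (ω0 := fun t => cr (g t)) (cr_contDiff cg)
    (e := 2 * (y * σ * K ^ 2)) (by nlinarith)
    (fun t => (cr_sub _).trans ((hgb t).trans (by linarith)))
    (fun t => ((cr_bounds cg bA bB t).1).trans he1)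
    (fun t => ((cr_bounds cg bA bB t).2).trans he2)
  have cw1 := ((contDiff_infty_iff_deriv).1 cw).2
  have Dw : ∀ t, HasDerivAt w (deriv w t) t := fun t => (cw.differentiable (by simp) t).hasDerivAt
  have Dw1 : ∀ t, HasDerivAt (deriv w) (deriv (deriv w) t) t := fun t =>
    (cw1.differentiable (by simp) t).hasDerivAt
  have Dd : ∀ s : ℝ, HasDerivAt (fun s => s / σ) (1 / σ) s := fun s => (hasDerivAt_id s).div_const σ
  have d1 : deriv (fun s => w (s / σ)) = fun s => ((1 / σ : ℝ) : ℂ) * deriv w (s / σ) :=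
    funext fun s => by
      have := ((Dw (s / σ)).scomp s (Dd s)).deriv
      simpa [Function.comp_def] using this
  have d2 : deriv (fun s => ((1 / σ : ℝ) : ℂ) * deriv w (s / σ)) =
      fun s => ((1 / σ : ℝ) : ℂ) * (((1 / σ : ℝ) : ℂ) * deriv (deriv w) (s / σ)) :=
    funext fun s => by
      have := (((Dw1 (s / σ)).scomp s (Dd s)).const_mul ((1 / σ : ℝ) : ℂ)).deriv
      simpa [Function.comp_def] using this
  have hσc : (σ : ℂ) ≠ 0 := by exact_mod_cast hσ0.ne'
  refine ⟨fun s => w (s / σ), cw.comp (contDiff_id.div_const σ), ?_, ?_, ?_, ?_, ?_⟩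
  · intro s
    have a := w0 (s / σ)
    have b := (cr_sub (g (s / σ))).trans (hgb (s / σ))
    calc ‖w (s / σ) - 1‖ = ‖(w (s / σ) - cr (g (s / σ))) + (cr (g (s / σ)) - 1)‖ := by ring_nf
      _ ≤ 30 * (2 * (y * σ * K ^ 2)) + y * K := norm_bd_add a b
      _ ≤ _ := by
        have : y * σ * K ^ 2 ≤ y * K ^ 2 := by
          have := mul_le_of_le_one_right (show 0 ≤ y * K ^ 2 by positivity) hσ1
          linarith
        nlinarith
  · intro s
    rw [d1]
    have a := w1 (s / σ)
    have b := ((cr_bounds cg bA bB (s / σ)).1).trans he1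
    have c : ‖deriv w (s / σ)‖ ≤ 31 * (2 * (y * σ * K ^ 2)) := by
      calc ‖deriv w (s / σ)‖ = ‖(deriv w (s / σ) - deriv (fun t => cr (g t)) (s / σ))
            + deriv (fun t => cr (g t)) (s / σ)‖ := by ring_nf
        _ ≤ _ := (norm_bd_add a b).trans (by linarith)
    rw [norm_mul, Complex.norm_real, Real.norm_of_nonneg (by positivity), one_div,
      inv_mul_le_iff₀ hσ0]
    have : 0 < σ * (y * K ^ 2) := by positivity
    nlinarith
  · intro s hs
    rw [d1, d2]
    have := weq (s / σ)
    rw [cr_cube] at this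
    simp only [g] at this
    rw [mul_div_cancel₀ _ hσ0.ne', hV s hs] at this
    rw [← this]
    push_cast
    field_simp
  · intro s hs
    have a := w0 (s / σ)
    simp only [g] at a
    rw [mul_div_cancel₀ _ hσ0.ne', hV s hs] at a
    rw [← mul_sub, ← Complex.sub_im, abs_mul, abs_of_pos (by positivity)]
    have := (Complex.abs_im_le_norm (w (s / σ) - cr (y * (s ^ 2 - 1)))).trans a
    calc _ ≤ 3 / y * (30 * (2 * (y * σ * K ^ 2))) := by gcongr
      _ = 60 * K ^ 2 * y * h := by rw [hσ]; field_simp; ring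
      _ ≤ _ := by
        have : 0 < K ^ 2 * y * h := by positivity
        nlinarith
  · intro s hs
    have a := hK0 s
    rw [hV s hs] at a
    refine (cr_im hy a (by linarith)).trans ?_
    gcongr
    nlinarith


/-- hypothesis on the real phase derivative -/
def RhoHyp (M h κ : ℝ) (ρ : ℝ → ℝ) : Prop :=
  Continuous ρ ∧ ∀ s ∈ Set.Icc (-M) M, |ρ s - (s ^ 2 - 1)| ≤ κ * |s ^ 2 - 1| + κ * h

/-- the real phase -/
noncomputable def Rr (ρ : ℝ → ℝ) (s : ℝ) : ℝ := ∫ t in (-1:ℝ)..s, ρ t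

lemma RhoHyp.neg {M h κ : ℝ} {ρ : ℝ → ℝ} (H : RhoHyp M h κ ρ) :
    RhoHyp M h κ (fun s => ρ (-s)) := by
  refine ⟨H.1.comp continuous_neg, fun s hs => ?_⟩
  have := H.2 (-s) ⟨by linarith [hs.2], by linarith [hs.1]⟩
  simpa using this

lemma Rr_neg {ρ : ℝ → ℝ} (H : Continuous ρ) (s : ℝ) :
    Rr (fun t => ρ (-t)) (-s) = Rr ρ 1 - Rr ρ s := by
  unfold Rr
  rw [intervalIntegral.integral_comp_neg (fun t => ρ t)]
  rw [intervalIntegral.integral_interval_sub_left (H.intervalIntegrable _ _)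
    (H.intervalIntegrable _ _)]
  simp

lemma Rr_hasDeriv {ρ : ℝ → ℝ} (H : Continuous ρ) (s : ℝ) : HasDerivAt (Rr ρ) (ρ s) s :=
  (H.integral_hasStrictDerivAt (-1) s).hasDerivAt

lemma Rr_cont {ρ : ℝ → ℝ} (H : Continuous ρ) : Continuous (Rr ρ) :=
  continuous_iff_continuousAt.2 fun s => (Rr_hasDeriv H s).continuousAt

lemma int_quad (a b : ℝ) : ∫ t in a..b, (t ^ 2 - 1) = (b ^ 3 / 3 - b) - (a ^ 3 / 3 - a) := by
  rw [intervalIntegral.integral_sub (by apply Continuous.intervalIntegrable; fun_prop) (by simp)]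
  simp [integral_pow]; ring

lemma Rr_crude {M h κ : ℝ} {ρ : ℝ → ℝ} (H : RhoHyp M h κ ρ) (hM : 4 ≤ M) (hh : 0 < h) (hh1 : h ≤ 1)
    (hκ : 0 ≤ κ) (s : ℝ) (hs : s ∈ Set.Icc (-M) M) :
    |Rr ρ s + (s + 1) ^ 2 * (2 - s) / 3| ≤ 4 * κ * M ^ 3 := by
  have e : Rr ρ s + (s + 1) ^ 2 * (2 - s) / 3 = ∫ t in (-1:ℝ)..s, (ρ t - (t ^ 2 - 1)) := by
    rw [intervalIntegral.integral_sub (H.1.intervalIntegrable _ _)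
      (by apply Continuous.intervalIntegrable; fun_prop), int_quad]
    unfold Rr; ring
  rw [e, ← Real.norm_eq_abs]
  have hsub : Set.uIoc (-1) s ⊆ Set.Icc (-M) M := by
    intro t ht
    have := Set.uIoc_subset_uIcc ht
    refine (Set.uIcc_subset_Icc ⟨?_, ?_⟩ hs) this <;> linarith
  refine (intervalIntegral.norm_integral_le_of_norm_le_const (C := κ * M ^ 2 + κ) ?_).trans ?_
  · intro t ht
    refine (H.2 t (hsub ht)).trans ?_
    have h1 := hsub ht
    have : |t ^ 2 - 1| ≤ M ^ 2 := by
      rw [abs_le]; constructor <;> nlinarith [h1.1, h1.2, sq_nonneg t]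
    have a1 := mul_le_mul_of_nonneg_left this hκ
    have a2 := mul_le_mul_of_nonneg_left hh1 hκ
    linarith
  · have : |s - -1| ≤ 2 * M := by rw [abs_le]; constructor <;> linarith [hs.1, hs.2]
    calc (κ * M ^ 2 + κ) * |s - -1| ≤ (κ * M ^ 2 + κ) * (2 * M) := by gcongr
      _ = 2 * κ * (M * (M ^ 2 + 1)) := by ring
      _ ≤ 2 * κ * (M * (M ^ 2 + M ^ 2)) := by gcongr; nlinarith
      _ = _ := by ring

lemma Rr_fine {M h κ : ℝ} {ρ : ℝ → ℝ} (H : RhoHyp M h κ ρ) (hM : 4 ≤ M) (hh : 0 < h)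
    (hκ : 0 ≤ κ) (s : ℝ) (hs : s ∈ Set.Icc (-M) 1) :
    |Rr ρ s + (s + 1) ^ 2 * (2 - s) / 3| ≤ κ * ((s + 1) ^ 2 * (2 - s) / 3) + 2 * M * κ * h := by
  have e : Rr ρ s + (s + 1) ^ 2 * (2 - s) / 3 = ∫ t in (-1:ℝ)..s, (ρ t - (t ^ 2 - 1)) := by
    rw [intervalIntegral.integral_sub (H.1.intervalIntegrable _ _)
      (by apply Continuous.intervalIntegrable; fun_prop), int_quad]
    unfold Rr; ring
  rw [e, ← Real.norm_eq_abs]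
  have hsM : s ∈ Set.Icc (-M) M := ⟨hs.1, by linarith [hs.2]⟩
  have hsub : Set.uIoc (-1) s ⊆ Set.Icc (-M) M := by
    intro t ht
    have := Set.uIoc_subset_uIcc ht
    refine (Set.uIcc_subset_Icc ⟨?_, ?_⟩ hsM) this <;> linarith
  have key : ∀ c : ℝ, (∀ t ∈ Set.uIoc (-1) s, |t ^ 2 - 1| = c * (t ^ 2 - 1)) →
      ‖∫ t in (-1:ℝ)..s, (ρ t - (t ^ 2 - 1))‖ ≤
        |κ * c * ((s ^ 3 / 3 - s) - 2 / 3) + κ * h * (s + 1)| := by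
    intro c hc
    have := intervalIntegral.norm_integral_le_abs_of_norm_le (a := -1) (b := s)
      (f := fun t => ρ t - (t ^ 2 - 1)) (g := fun t => κ * c * (t ^ 2 - 1) + κ * h) (μ := volume)
      (by
        filter_upwards [ae_restrict_mem measurableSet_uIoc] with t ht
        have := H.2 t (hsub ht)
        rw [hc t ht] at this
        rw [Real.norm_eq_abs]; linarith)
      (by apply Continuous.intervalIntegrable; fun_prop)
    refine this.trans (le_of_eq ?_)
    rw [intervalIntegral.integral_add (by apply Continuous.intervalIntegrable; fun_prop) (by simp),
      intervalIntegral.integral_const_mul, int_quad]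
    congr 1; simp; ring
  have hn : 0 ≤ (s + 1) ^ 2 * (2 - s) / 3 := by
    have : 0 ≤ 2 - s := by linarith [hs.2]
    positivity
  have hl : |s + 1| ≤ 2 * M := by rw [abs_le]; constructor <;> linarith [hs.1, hs.2]
  have fin : ∀ c : ℝ, |c| ≤ 1 → |κ * c * ((s ^ 3 / 3 - s) - 2 / 3) + κ * h * (s + 1)| ≤
      κ * ((s + 1) ^ 2 * (2 - s) / 3) + 2 * M * κ * h := by
    intro c hc
    refine (abs_add_le _ _).trans (add_le_add ?_ ?_)
    · have : κ * c * ((s ^ 3 / 3 - s) - 2 / 3) = c * (-(κ * ((s + 1) ^ 2 * (2 - s) / 3))) := by ring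
      rw [this, abs_mul, abs_neg, abs_of_nonneg (mul_nonneg hκ hn)]
      exact mul_le_of_le_one_left (mul_nonneg hκ hn) hc
    · rw [abs_mul, abs_of_nonneg (by positivity : 0 ≤ κ * h)]
      calc κ * h * |s + 1| ≤ κ * h * (2 * M) := by gcongr
        _ = _ := by ring
  rcases le_total s (-1) with h1 | h1
  · refine (key 1 ?_).trans (fin 1 (by simp))
    intro t ht
    rw [Set.uIoc_of_ge h1] at ht
    rw [one_mul, abs_of_nonneg]; nlinarith [ht.2]
  · refine (key (-1) ?_).trans (fin (-1) (by simp))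
    intro t ht
    rw [Set.uIoc_of_le h1] at ht
    rw [abs_of_nonpos]; · ring
    nlinarith [ht.1, ht.2, hs.2]

lemma gauss_up (α δ M : ℝ) (hα : 0 < α) (hδ : 0 < δ) (hδ1 : δ ≤ 1) (hM : 4 ≤ M) :
    ∫ s in (-M)..0, Real.exp (-(α * ((s + 1) ^ 2 * (2 - s) / 3))) ≤
      √(Real.pi / (α * (1 - δ / 3))) + Real.exp (-(α * δ ^ 2 / 3)) * √(Real.pi / (α / 3)) := by
  have hb : 0 < α * (1 - δ / 3) := by apply mul_pos hα; linarith
  have i1 := integrable_exp_neg_mul_sq hb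
  have i2 := integrable_exp_neg_mul_sq (show 0 < α / 3 by positivity)
  have e1 : √(Real.pi / (α * (1 - δ / 3))) + Real.exp (-(α * δ ^ 2 / 3)) * √(Real.pi / (α / 3)) =
      ∫ s : ℝ, (Real.exp (-(α * (1 - δ / 3)) * (s + 1) ^ 2) +
        Real.exp (-(α * δ ^ 2 / 3)) * Real.exp (-(α / 3) * (s + 1) ^ 2)) := by
    rw [integral_add (i1.comp_add_right 1) ((i2.comp_add_right 1).const_mul _), integral_const_mul,
      integral_add_right_eq_self (fun s : ℝ => Real.exp (-(α * (1 - δ / 3)) * s ^ 2)),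
      integral_add_right_eq_self (fun s : ℝ => Real.exp (-(α / 3) * s ^ 2)),
      integral_gaussian, integral_gaussian]
  rw [e1, intervalIntegral.integral_of_le (by linarith)]
  refine le_trans ?_ (setIntegral_le_integral (s := Set.Ioc (-M) 0)
    ((i1.comp_add_right 1).add ((i2.comp_add_right 1).const_mul _)) ?_)
  · refine setIntegral_mono_on ?_ ?_ measurableSet_Ioc ?_
    · exact (Continuous.integrableOn_Icc (by fun_prop)).mono_set Set.Ioc_subset_Icc_self
    · exact ((i1.comp_add_right 1).add ((i2.comp_add_right 1).const_mul _)).integrableOn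
    · intro s hs
      show _ ≤ Real.exp (-(α * (1 - δ / 3)) * (s + 1) ^ 2) +
        Real.exp (-(α * δ ^ 2 / 3)) * Real.exp (-(α / 3) * (s + 1) ^ 2)
      rcases le_total (s + 1) δ with h1 | h1
      · refine le_add_of_le_of_nonneg (Real.exp_le_exp.2 ?_) (by positivity)
        have : 0 ≤ α * (s + 1) ^ 2 * (δ - (s + 1)) := by
          have : 0 ≤ δ - (s+1) := by linarith
          positivity
        nlinarith
      · refine le_add_of_nonneg_of_le (by positivity) ?_
        rw [← Real.exp_add]
        apply Real.exp_le_exp.2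
        have h2 : 0 ≤ (s + 1) ^ 2 * (-s) := mul_nonneg (sq_nonneg _) (by linarith [hs.2])
        have h3 : δ ^ 2 ≤ (s + 1) ^ 2 := by nlinarith
        have h4 := mul_nonneg hα.le h2
        have h5 := mul_le_mul_of_nonneg_left h3 hα.le
        nlinarith
  · exact Filter.Eventually.of_forall fun s => by positivity

lemma gauss_low (α δ : ℝ) (hα : 0 < α) (hδ : 0 < δ) (hδ1 : δ ≤ 1 / 4) :
    √(Real.pi / (α * (1 + δ / 3))) - Real.exp (-(α * (1 + δ / 3) * δ ^ 2 / 2)) *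
      √(Real.pi / (α * (1 + δ / 3) / 2))
    ≤ ∫ s in (-5/4:ℝ)..(-3/4), Real.exp (-(α * ((s + 1) ^ 2 * (2 - s) / 3))) := by
  set β := α * (1 + δ / 3) with hβ
  have hb : 0 < β := by positivity
  have i1 := (integrable_exp_neg_mul_sq hb).comp_add_right 1
  have i2 := ((integrable_exp_neg_mul_sq (show 0 < β / 2 by positivity)).comp_add_right
    1).const_mul (Real.exp (-(β * δ ^ 2 / 2)))
  have e1 : √(Real.pi / β) - Real.exp (-(β * δ ^ 2 / 2)) * √(Real.pi / (β / 2)) =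
      ∫ s : ℝ, (Real.exp (-β * (s + 1) ^ 2) -
        Real.exp (-(β * δ ^ 2 / 2)) * Real.exp (-(β / 2) * (s + 1) ^ 2)) := by
    rw [integral_sub i1 i2, integral_const_mul,
      integral_add_right_eq_self (fun s : ℝ => Real.exp (-β * s ^ 2)),
      integral_add_right_eq_self (fun s : ℝ => Real.exp (-(β / 2) * s ^ 2)),
      integral_gaussian, integral_gaussian]
  rw [e1, intervalIntegral.integral_of_le (by norm_num), ← integral_indicator measurableSet_Ioc]
  refine integral_mono (i1.sub i2) ?_ ?_
  · rw [integrable_indicator_iff measurableSet_Ioc]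
    exact (Continuous.integrableOn_Icc (by fun_prop)).mono_set Set.Ioc_subset_Icc_self
  · intro s
    show Real.exp (-β * (s + 1) ^ 2) -
        Real.exp (-(β * δ ^ 2 / 2)) * Real.exp (-(β / 2) * (s + 1) ^ 2) ≤ _
    by_cases h1 : (s + 1) ^ 2 < δ ^ 2
    · have h2 := abs_lt.1 (abs_lt_of_sq_lt_sq h1 hδ.le)
      rw [Set.indicator_of_mem (show s ∈ Set.Ioc (-5/4:ℝ) (-3/4) from
        ⟨by linarith [h2.1], by linarith [h2.2]⟩)]
      refine (sub_le_self _ (by positivity)).trans (Real.exp_le_exp.2 ?_)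
      have : 0 ≤ α * (s + 1) ^ 2 * (δ + (s + 1)) := by
        have : 0 ≤ δ + (s+1) := by linarith
        positivity
      rw [hβ]; nlinarith
    · push Not at h1
      refine le_trans ?_ (Set.indicator_nonneg (fun t _ => by positivity) _)
      rw [← Real.exp_add, sub_nonpos]
      apply Real.exp_le_exp.2
      nlinarith


lemma exp_neg_le_inv (x : ℝ) (hx : 0 < x) : Real.exp (-x) ≤ 1 / x := by
  rw [Real.exp_neg, ← one_div]
  exact one_div_le_one_div_of_le hx (by linarith [Real.add_one_le_exp x])

lemma sqrt_fac (h c : ℝ) (hh : 0 < h) (X : ℝ) (hX : X = Real.pi * h / 2 * c) :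
    √X = √(Real.pi * h / 2) * √c := by
  rw [hX, Real.sqrt_mul (by positivity)]

lemma lap_one (M ε : ℝ) (hM : 4 ≤ M) (hε : 0 < ε) : ∃ η : ℝ, 0 < η ∧ η ≤ 1 / 10 ∧
    ∀ (h κ : ℝ) (ρ : ℝ → ℝ), 0 < h → h ≤ η → 0 ≤ κ → κ ≤ η → RhoHyp M h κ ρ →
      (∫ s in (-M)..0, Real.exp (2 * Rr ρ s / h)) ≤ (1 + ε) * √(Real.pi * h / 2) ∧
      (1 - ε) * √(Real.pi * h / 2) ≤ ∫ s in (-5/4:ℝ)..(-3/4), Real.exp (2 * Rr ρ s / h) := by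
  have t1 : Filter.Tendsto (fun η : ℝ => Real.exp (4 * M * η) *
      (√(1 / ((1 - η) * (1 - η / 3))) + 9 * η)) (nhds 0) (nhds 1) := by
    have : ContinuousAt (fun η : ℝ => Real.exp (4 * M * η) *
      (√(1 / ((1 - η) * (1 - η / 3))) + 9 * η)) 0 := by
      have : ContinuousAt (fun η : ℝ => 1 / ((1 - η) * (1 - η / 3))) 0 := by
        apply ContinuousAt.div <;> [fun_prop; fun_prop; norm_num]
      exact ContinuousAt.mul (by fun_prop) ((this.sqrt).add (by fun_prop))
    simpa [ContinuousAt] using this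
  have t2 : Filter.Tendsto (fun η : ℝ => Real.exp (-(4 * M * η)) *
      (√(1 / ((1 + η) * (1 + η / 3))) - 2 * η)) (nhds 0) (nhds 1) := by
    have : ContinuousAt (fun η : ℝ => Real.exp (-(4 * M * η)) *
      (√(1 / ((1 + η) * (1 + η / 3))) - 2 * η)) 0 := by
      have : ContinuousAt (fun η : ℝ => 1 / ((1 + η) * (1 + η / 3))) 0 := by
        apply ContinuousAt.div <;> [fun_prop; fun_prop; norm_num]
      exact ContinuousAt.mul (by fun_prop) ((this.sqrt).sub (by fun_prop))
    simpa [ContinuousAt] using this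
  have q1 := t1.eventually (eventually_le_nhds (show (1:ℝ) < 1 + ε by linarith))
  have q2 := t2.eventually (eventually_ge_nhds (show 1 - ε < (1:ℝ) by linarith))
  obtain ⟨r, hr, hr'⟩ := Metric.eventually_nhds_iff.1 (q1.and q2)
  set η := min (r / 2) (1 / 10) with hη
  have hη0 : 0 < η := by positivity
  have hη1 : η ≤ 1 / 10 := min_le_right _ _
  obtain ⟨F1, F2⟩ := hr' (y := η) (by
    rw [Real.dist_eq, sub_zero, abs_of_pos hη0]
    exact lt_of_le_of_lt (min_le_left _ _) (by linarith))
  refine ⟨η ^ 3, by positivity, ?_, ?_⟩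
  · have : η ^ 3 ≤ (1 / 10) ^ 3 := by gcongr
    exact this.trans (by norm_num)
  intro h κ ρ hh hhη hκ hκη' H
  have hκη : κ ≤ η := by
    refine hκη'.trans ?_
    have := pow_le_one₀ (n := 2) hη0.le (by linarith)
    calc η ^ 3 = η * η ^ 2 := by ring
      _ ≤ η * 1 := by gcongr
      _ = η := by ring
  have sq0 : 0 ≤ √(Real.pi * h / 2) := Real.sqrt_nonneg _
  have hη2 : h / η ^ 2 ≤ η := by rw [div_le_iff₀ (by positivity)]; linarith [hhη]
  constructor
  · have hα : 0 < 2 * (1 - κ) / h := div_pos (by linarith) hh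
    have g := gauss_up (2 * (1 - κ) / h) η M hα hη0 (by linarith) hM
    have s1 : ∫ s in (-M)..0, Real.exp (2 * Rr ρ s / h) ≤ ∫ s in (-M)..0,
        Real.exp (4 * M * κ) * Real.exp (-(2 * (1 - κ) / h * ((s + 1) ^ 2 * (2 - s) / 3))) := by
      have := Rr_cont H.1
      apply intervalIntegral.integral_mono_on (by linarith)
        (by apply Continuous.intervalIntegrable; fun_prop)
        (by apply Continuous.intervalIntegrable; fun_prop)
      intro s hs
      rw [← Real.exp_add]
      apply Real.exp_le_exp.2
      have := (abs_le.1 (Rr_fine H hM hh hκ s ⟨hs.1, by linarith [hs.2]⟩)).2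
      rw [div_le_iff₀ hh]
      have : (4 * M * κ + -(2 * (1 - κ) / h * ((s + 1) ^ 2 * (2 - s) / 3))) * h =
        4 * M * κ * h - 2 * (1 - κ) * ((s + 1) ^ 2 * (2 - s) / 3) := by field_simp; ring
      rw [this]; nlinarith
    rw [intervalIntegral.integral_const_mul] at s1
    refine s1.trans ?_
    have a1 : √(Real.pi / (2 * (1 - κ) / h * (1 - η / 3))) ≤
        √(Real.pi * h / 2) * √(1 / ((1 - η) * (1 - η / 3))) := by
      have : 1 - κ ≠ 0 := by linarith
      have : 1 - η / 3 ≠ 0 := by linarith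
      have : 3 - η ≠ 0 := by linarith
      rw [sqrt_fac h (1 / ((1 - κ) * (1 - η / 3))) hh _ (by field_simp)]
      apply mul_le_mul_of_nonneg_left _ sq0
      apply Real.sqrt_le_sqrt
      have h1 : 0 < 1 - η / 3 := by linarith
      have h2 : 0 < 1 - η := by linarith
      apply one_div_le_one_div_of_le (by positivity)
      gcongr
    have a2 : √(Real.pi / (2 * (1 - κ) / h / 3)) ≤ √(Real.pi * h / 2) * 3 := by
      have : 1 - κ ≠ 0 := by linarith
      rw [sqrt_fac h (3 / (1 - κ)) hh _ (by field_simp)]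
      apply mul_le_mul_of_nonneg_left _ sq0
      rw [Real.sqrt_le_left (by norm_num), div_le_iff₀ (by linarith)]
      linarith
    have a3 : Real.exp (-(2 * (1 - κ) / h * η ^ 2 / 3)) ≤ 3 * η := by
      refine (exp_neg_le_inv _ (by positivity)).trans ?_
      have h2 : 0 < 1 - κ := by linarith
      have : 1 / (2 * (1 - κ) / h * η ^ 2 / 3) = h / η ^ 2 * (3 / (2 * (1 - κ))) := by
        field_simp
      rw [this]
      have : 3 / (2 * (1 - κ)) ≤ 3 := by
        rw [div_le_iff₀ (by linarith)]; linarith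
      have h3 : 0 ≤ h / η ^ 2 := by positivity
      calc h / η ^ 2 * (3 / (2 * (1 - κ))) ≤ η * 3 := by gcongr
        _ = _ := by ring
    calc _ ≤ Real.exp (4 * M * η) * (√(Real.pi * h / 2) * √(1 / ((1 - η) * (1 - η / 3)))
          + 3 * η * (√(Real.pi * h / 2) * 3)) := by
          refine mul_le_mul (Real.exp_le_exp.2 (by gcongr)) (g.trans ?_) ?_ (by positivity)
          · gcongr
          · exact intervalIntegral.integral_nonneg (by linarith) (fun s _ => by positivity)
      _ = (Real.exp (4 * M * η) * (√(1 / ((1 - η) * (1 - η / 3))) + 9 * η)) *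
        √(Real.pi * h / 2) := by ring
      _ ≤ _ := by gcongr
  · have hα : 0 < 2 * (1 + κ) / h := by positivity
    have g := gauss_low (2 * (1 + κ) / h) η hα hη0 (by linarith)
    have s1 : ∫ s in (-5/4:ℝ)..(-3/4),
        Real.exp (-(4 * M * κ)) * Real.exp (-(2 * (1 + κ) / h * ((s + 1) ^ 2 * (2 - s) / 3))) ≤
        ∫ s in (-5/4:ℝ)..(-3/4), Real.exp (2 * Rr ρ s / h) := by
      have := Rr_cont H.1
      apply intervalIntegral.integral_mono_on (by linarith)
        (by apply Continuous.intervalIntegrable; fun_prop)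
        (by apply Continuous.intervalIntegrable; fun_prop)
      intro s hs
      rw [← Real.exp_add]
      apply Real.exp_le_exp.2
      have := (abs_le.1 (Rr_fine H hM hh hκ s ⟨by linarith [hs.1], by linarith [hs.2]⟩)).1
      rw [le_div_iff₀ hh]
      have : (-(4 * M * κ) + -(2 * (1 + κ) / h * ((s + 1) ^ 2 * (2 - s) / 3))) * h =
        -(4 * M * κ * h) - 2 * (1 + κ) * ((s + 1) ^ 2 * (2 - s) / 3) := by field_simp; ring
      rw [this]; nlinarith
    rw [intervalIntegral.integral_const_mul] at s1
    refine le_trans ?_ s1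
    have a1 : √(Real.pi * h / 2) * √(1 / ((1 + η) * (1 + η / 3))) ≤
        √(Real.pi / (2 * (1 + κ) / h * (1 + η / 3))) := by
      rw [sqrt_fac h (1 / ((1 + κ) * (1 + η / 3))) hh (Real.pi / (2 * (1 + κ) / h * (1 + η / 3)))
        (by field_simp)]
      apply mul_le_mul_of_nonneg_left _ sq0
      apply Real.sqrt_le_sqrt
      apply one_div_le_one_div_of_le (by positivity)
      gcongr
    have a2 : √(Real.pi / (2 * (1 + κ) / h * (1 + η / 3) / 2)) ≤ √(Real.pi * h / 2) * 2 := by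
      rw [sqrt_fac h (2 / ((1 + κ) * (1 + η / 3))) hh
        (Real.pi / (2 * (1 + κ) / h * (1 + η / 3) / 2)) (by field_simp)]
      apply mul_le_mul_of_nonneg_left _ sq0
      rw [Real.sqrt_le_left (by norm_num), div_le_iff₀ (by positivity)]
      nlinarith
    have a3 : Real.exp (-(2 * (1 + κ) / h * (1 + η / 3) * η ^ 2 / 2)) ≤ η := by
      refine (exp_neg_le_inv _ (by positivity)).trans ?_
      have : 1 / (2 * (1 + κ) / h * (1 + η / 3) * η ^ 2 / 2) =
          h / η ^ 2 * (1 / ((1 + κ) * (1 + η / 3))) := by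
        field_simp
      rw [this]
      refine le_trans (mul_le_of_le_one_right (by positivity) ?_) hη2
      rw [div_le_iff₀ (by positivity)]; nlinarith
    calc (1 - ε) * √(Real.pi * h / 2) ≤
        Real.exp (-(4 * M * η)) * (√(1 / ((1 + η) * (1 + η / 3))) - 2 * η) * √(Real.pi * h / 2) := by
          gcongr
      _ = Real.exp (-(4 * M * η)) * (√(Real.pi * h / 2) * √(1 / ((1 + η) * (1 + η / 3)))
          - η * (√(Real.pi * h / 2) * 2)) := by ring
      _ ≤ Real.exp (-(4 * M * η)) * ∫ s in (-5/4:ℝ)..(-3/4),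
          Real.exp (-(2 * (1 + κ) / h * ((s + 1) ^ 2 * (2 - s) / 3))) := by
          apply mul_le_mul_of_nonneg_left _ (by positivity)
          refine le_trans ?_ g
          gcongr
      _ ≤ _ := by
          apply mul_le_mul_of_nonneg_right (Real.exp_le_exp.2 (by simp; gcongr))
          exact intervalIntegral.integral_nonneg (by norm_num) (fun s _ => by positivity)

set_option maxHeartbeats 2000000 in
/-- the full Laplace package -/
lemma laplace (M ε : ℝ) (hM : 4 ≤ M) (hε : 0 < ε) : ∃ η : ℝ, 0 < η ∧ η ≤ 1 / 10 ∧
    ∀ (h κ : ℝ) (ρ : ℝ → ℝ), 0 < h → h ≤ η → 0 ≤ κ → κ ≤ η → RhoHyp M h κ ρ →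
      (∫ s in (-(M-2))..(M-2), Real.exp (2 * Rr ρ s / h) * ∫ t in s..M, Real.exp (-(2 * Rr ρ t / h)))
        ≤ (1 + ε) * (Real.pi * h / 2) * Real.exp (-(2 * Rr ρ 1 / h)) ∧
      (1 - ε) * √(Real.pi * h / 2) ≤ ∫ s in (-5/4:ℝ)..(-3/4), Real.exp (2 * Rr ρ s / h) ∧
      (1 - ε) * √(Real.pi * h / 2) * Real.exp (-(2 * Rr ρ 1 / h)) ≤
        ∫ s in (3/4:ℝ)..(5/4), Real.exp (-(2 * Rr ρ s / h)) ∧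
      (∀ s ∈ Set.Icc (-M) M, |Rr ρ s + (s + 1) ^ 2 * (2 - s) / 3| ≤ 1 / 20) := by
  obtain ⟨ε1, hε1, hε2⟩ : ∃ ε1 : ℝ, 0 < ε1 ∧ (1 + ε1) * (1 + ε1) ≤ 1 + ε / 2 := by
    refine ⟨min 1 (ε / 6), by positivity, ?_⟩
    have := min_le_left 1 (ε / 6); have := min_le_right 1 (ε / 6)
    have : 0 < min 1 (ε / 6) := by positivity
    nlinarith
  obtain ⟨η1, h1, h1', P⟩ := lap_one M (min ε ε1) hM (by positivity)
  refine ⟨min η1 (min (1 / (80 * M ^ 3)) (ε / (400 * M ^ 2))), by positivity,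
    (min_le_left _ _).trans h1', ?_⟩
  intro h κ ρ hh hhη hκ hκη H
  have hκ1 := hκη.trans (min_le_left _ _)
  have hh1 := hhη.trans (min_le_left _ _)
  have hκ2 := hκη.trans ((min_le_right _ _).trans (min_le_left _ _))
  have hh3 := hhη.trans ((min_le_right _ _).trans (min_le_right _ _))
  rw [le_div_iff₀ (by positivity)] at hκ2 hh3
  have crude : ∀ s ∈ Set.Icc (-M) M, |Rr ρ s + (s + 1) ^ 2 * (2 - s) / 3| ≤ 1 / 20 := fun s hs =>
    (Rr_crude H hM hh (by linarith) hκ s hs).trans (by linarith)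
  have crude1 := crude 1 ⟨by linarith, by linarith⟩
  norm_num at crude1
  obtain ⟨A1, A2⟩ := P h κ ρ hh hh1 hκ hκ1 H
  obtain ⟨B1, B2⟩ := P h κ _ hh hh1 hκ hκ1 H.neg
  have cR := Rr_cont H.1
  have sq0 : 0 ≤ √(Real.pi * h / 2) := Real.sqrt_nonneg _
  have conv : ∀ s, Real.exp (2 * Rr (fun s => ρ (-s)) (-s) / h) * Real.exp (-(2 * Rr ρ 1 / h)) =
      Real.exp (-(2 * Rr ρ s / h)) := by
    intro s
    rw [Rr_neg H.1, ← Real.exp_add]; congr 1; ring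
  have conv2 : ∀ a b : ℝ, (∫ s in a..b, Real.exp (2 * Rr (fun s => ρ (-s)) s / h)) *
      Real.exp (-(2 * Rr ρ 1 / h)) = ∫ s in (-b)..(-a), Real.exp (-(2 * Rr ρ s / h)) := by
    intro a b
    rw [← intervalIntegral.integral_mul_const]
    have := intervalIntegral.integral_comp_neg (a := -b) (b := -a)
      (fun s => Real.exp (2 * Rr (fun s => ρ (-s)) s / h) * Real.exp (-(2 * Rr ρ 1 / h)))
    rw [neg_neg, neg_neg] at this
    rw [← this]
    simp_rw [conv]
  refine ⟨?_, ?_, ?_, crude⟩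
  rotate_left
  · exact le_trans (by gcongr; exact min_le_left _ _) A2
  · have := conv2 (-5/4) (-3/4)
    norm_num at this
    rw [← this]
    gcongr
    have B3 : (1 - ε) * √(Real.pi * h / 2) ≤ (1 - min ε ε1) * √(Real.pi * h / 2) := by
      gcongr; exact min_le_left _ _
    rw [show (-(5 / 4) : ℝ) = -5 / 4 by norm_num, show (-(3 / 4) : ℝ) = -3 / 4 by norm_num]
    exact B3.trans B2
  set f := fun s => Real.exp (2 * Rr ρ s / h) with hf
  set g := fun s => Real.exp (-(2 * Rr ρ s / h)) with hg
  have cf : Continuous f := by rw [hf]; fun_prop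
  have cg : Continuous g := by rw [hg]; fun_prop
  set E := Real.exp (2 * (4 / 5) / h) with hE
  -- same side
  have poly1 : ∀ s t, s ∈ Set.Icc (-M) M → t ∈ Set.Icc (-M) M → s ≤ t → (t ≤ 0 ∨ 0 ≤ s) →
      f s * g t ≤ E := by
    intro s t hs ht hst hc
    rw [hf, hg, hE]; simp only
    rw [← Real.exp_add]; apply Real.exp_le_exp.2
    have a1 := (abs_le.1 (crude s hs)).2
    have a2 := (abs_le.1 (crude t ht)).1
    have : 2 * Rr ρ s / h + -(2 * Rr ρ t / h) = 2 * (Rr ρ s - Rr ρ t) / h := by ring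
    rw [this]
    have : (t + 1) ^ 2 * (2 - t) / 3 - (s + 1) ^ 2 * (2 - s) / 3 ≤ 2 / 3 := by
      rcases hc with hc | hc
      · rcases le_total t (-1) with h2 | h2
        · have : (t + 1) ^ 2 * (2 - t) / 3 - (s + 1) ^ 2 * (2 - s) / 3 =
            -((t - s) * (t ^ 2 + t * s + s ^ 2 - 3)) / 3 := by ring
          have q : 0 ≤ (t - s) * (t ^ 2 + t * s + s ^ 2 - 3) := by
            apply mul_nonneg (by linarith); nlinarith
          rw [this]; linarith
        · have : 0 ≤ (s + 1) ^ 2 * (2 - s) := mul_nonneg (sq_nonneg _) (by linarith)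
          nlinarith [mul_nonneg (sub_nonneg.2 h2) (neg_nonneg.2 hc), mul_nonneg (mul_nonneg (sub_nonneg.2 h2) (sub_nonneg.2 h2)) (neg_nonneg.2 hc)]
      · rcases le_total s 1 with h2 | h2
        · have e1 : 0 ≤ (t - 1) ^ 2 * (t + 2) := mul_nonneg (sq_nonneg _) (by linarith)
          have e2 : (s - 1) ^ 2 * (s + 2) ≤ 2 := by nlinarith [mul_nonneg hc (sub_nonneg.2 h2), mul_nonneg hc hc]
          nlinarith
        · have : (t + 1) ^ 2 * (2 - t) / 3 - (s + 1) ^ 2 * (2 - s) / 3 =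
            -((t - s) * (t ^ 2 + t * s + s ^ 2 - 3)) / 3 := by ring
          have q : 0 ≤ (t - s) * (t ^ 2 + t * s + s ^ 2 - 3) := by
            apply mul_nonneg (by linarith); nlinarith
          rw [this]; linarith
    gcongr
    linarith
  have ss : ∀ s a, s ∈ Set.Icc (-M) M → a ∈ Set.Icc (-M) M → s ≤ a → (a ≤ 0 ∨ 0 ≤ s) →
      f s * ∫ t in s..a, g t ≤ 2 * M * E := by
    intro s a hs ha hsa hc
    rw [← intervalIntegral.integral_const_mul]
    have : ∫ t in s..a, f s * g t ≤ ∫ t in s..a, E := by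
      apply intervalIntegral.integral_mono_on hsa
        (by apply Continuous.intervalIntegrable; fun_prop) (by simp)
      intro t ht
      refine poly1 s t hs ⟨by linarith [hs.1, ht.1], by linarith [ha.2, ht.2]⟩ ht.1 ?_
      rcases hc with hc | hc
      · left; linarith [ht.2]
      · right; exact hc
    refine this.trans ?_
    rw [intervalIntegral.integral_const, smul_eq_mul]
    have : a - s ≤ 2 * M := by linarith [hs.1, ha.2]
    gcongr
  set Ip := ∫ t in (0:ℝ)..M, g t with hIp
  have hIp0 : 0 ≤ Ip := intervalIntegral.integral_nonneg (by linarith) (fun s _ => by positivity)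
  have hIpB : Ip ≤ (1 + ε1) * √(Real.pi * h / 2) * Real.exp (-(2 * Rr ρ 1 / h)) := by
    have := conv2 (-M) 0
    rw [neg_neg, neg_zero] at this
    rw [hIp, hg, ← this]
    gcongr
    refine B1.trans (by gcongr; exact min_le_right _ _)
  have cgi : ∀ a b, IntervalIntegrable g volume a b := fun a b => cg.intervalIntegrable a b
  have cJ : Continuous (fun s => ∫ t in s..M, g t) := by
    have := intervalIntegral.continuous_primitive cgi M
    have e : (fun s => ∫ t in s..M, g t) = fun s => -∫ t in M..s, g t :=
      funext fun s => intervalIntegral.integral_symm _ _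
    rw [e]; exact this.neg
  have ci : ∀ a b, IntervalIntegrable (fun s => f s * ∫ t in s..M, g t) volume a b := fun a b =>
    (cf.mul cJ).intervalIntegrable a b
  rw [← intervalIntegral.integral_add_adjacent_intervals (ci _ 0) (ci 0 _)]
  have p1 : ∫ s in (-(M-2))..0, f s * ∫ t in s..M, g t ≤
      ∫ s in (-(M-2))..0, (f s * Ip + 2 * M * E) := by
    apply intervalIntegral.integral_mono_on (by linarith) (ci _ _)
      (by apply Continuous.intervalIntegrable; fun_prop)
    intro s hs
    rw [← intervalIntegral.integral_add_adjacent_intervals (cgi s 0) (cgi 0 M), mul_add, add_comm]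
    have := ss s 0 ⟨by linarith [hs.1], by linarith [hs.2]⟩ ⟨by linarith, by linarith⟩ hs.2
      (Or.inl le_rfl)
    linarith
  have p2 : ∫ s in (0:ℝ)..(M-2), f s * ∫ t in s..M, g t ≤ ∫ s in (0:ℝ)..(M-2), 2 * M * E := by
    apply intervalIntegral.integral_mono_on (by linarith) (ci _ _) (by simp)
    intro s hs
    exact ss s M ⟨by linarith [hs.1], by linarith [hs.2]⟩ ⟨by linarith, by linarith⟩
      (by linarith [hs.2]) (Or.inr hs.1)
  rw [intervalIntegral.integral_add (by apply Continuous.intervalIntegrable; fun_prop) (by simp),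
    intervalIntegral.integral_mul_const, intervalIntegral.integral_const, smul_eq_mul] at p1
  rw [intervalIntegral.integral_const, smul_eq_mul] at p2
  have Im : ∫ s in (-(M-2))..0, f s ≤ (1 + ε1) * √(Real.pi * h / 2) := by
    have : ∫ s in (-(M-2))..0, f s ≤ ∫ s in (-M)..0, f s :=
      intervalIntegral.integral_mono_interval (by linarith) (by linarith) le_rfl
        (Filter.Eventually.of_forall fun s => by show 0 ≤ Real.exp _; positivity)
        (cf.intervalIntegrable _ _)
    refine this.trans (A1.trans (by gcongr; exact min_le_right _ _))
  have hE2 : 4 * M ^ 2 * E ≤ ε / 2 * (Real.pi * h / 2) * Real.exp (-(2 * Rr ρ 1 / h)) := by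
    have e1 : E ≤ Real.exp (-(2 * Rr ρ 1 / h)) * Real.exp (-(9 / 10 / h)) := by
      rw [← Real.exp_add]; apply Real.exp_le_exp.2
      have : -(2 * Rr ρ 1 / h) + -(9 / 10 / h) = (-(2 * Rr ρ 1) - 9 / 10) / h := by ring
      rw [this]; gcongr; linarith [(abs_le.1 crude1).2]
    have e2 : Real.exp (-(9 / 10 / h)) ≤ 4 * h ^ 2 * 2 := by
      have : Real.exp (-(9 / 10 / h)) = Real.exp (-(9 / 20 / h)) ^ 2 := by
        rw [← Real.exp_nat_mul]; congr 1; ring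
      rw [this]
      have := exp_neg_le_inv (9 / 20 / h) (by positivity)
      calc Real.exp (-(9 / 20 / h)) ^ 2 ≤ (1 / (9 / 20 / h)) ^ 2 := by gcongr
        _ = (20 / 9) ^ 2 * h ^ 2 := by field_simp
        _ ≤ _ := by nlinarith [sq_nonneg h]
    calc 4 * M ^ 2 * E ≤ 4 * M ^ 2 * (Real.exp (-(2 * Rr ρ 1 / h)) * (4 * h ^ 2 * 2)) := by
          gcongr; exact e1.trans (by gcongr)
      _ = (32 * M ^ 2 * h) * h * Real.exp (-(2 * Rr ρ 1 / h)) := by ring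
      _ ≤ (ε / 2 * (Real.pi / 2)) * h * Real.exp (-(2 * Rr ρ 1 / h)) := by
          have : 32 * M ^ 2 * h ≤ ε / 2 * (Real.pi / 2) := by nlinarith [Real.pi_gt_three]
          exact mul_le_mul_of_nonneg_right (mul_le_mul_of_nonneg_right this hh.le) (by positivity)
      _ = _ := by ring
  have hmain : (∫ s in (-(M-2))..0, f s) * Ip ≤
      (1 + ε / 2) * (Real.pi * h / 2) * Real.exp (-(2 * Rr ρ 1 / h)) := by
    calc (∫ s in (-(M-2))..0, f s) * Ip ≤ ((1 + ε1) * √(Real.pi * h / 2)) *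
          ((1 + ε1) * √(Real.pi * h / 2) * Real.exp (-(2 * Rr ρ 1 / h))) :=
          mul_le_mul Im hIpB hIp0 (by positivity)
      _ = ((1 + ε1) * (1 + ε1)) * (√(Real.pi * h / 2) * √(Real.pi * h / 2)) *
          Real.exp (-(2 * Rr ρ 1 / h)) := by ring
      _ = ((1 + ε1) * (1 + ε1)) * (Real.pi * h / 2) * Real.exp (-(2 * Rr ρ 1 / h)) := by
          rw [Real.mul_self_sqrt (by positivity)]
      _ ≤ _ := by gcongr
  have hE0 : 0 < E := Real.exp_pos _
  have : (0 - -(M - 2)) * (2 * M * E) + (M - 2 - 0) * (2 * M * E) ≤ 4 * M ^ 2 * E := by nlinarith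
  linarith

open scoped FourierTransform SchwartzMap LineDeriv

/-- multiplication by the variable -/
noncomputable def XX : 𝓢(ℝ, ℂ) →L[ℂ] 𝓢(ℝ, ℂ) := SchwartzMap.smulLeftCLM ℂ (fun x : ℝ => (x : ℂ))

/-- derivative -/
noncomputable def DD : 𝓢(ℝ, ℂ) →L[ℂ] 𝓢(ℝ, ℂ) := SchwartzMap.derivCLM ℂ ℂ

/-- L2 norm -/
noncomputable def nrm (u : 𝓢(ℝ, ℂ)) : ℝ := ‖u.toLp 2 (volume : Measure ℝ)‖

/-- L2 inner product -/
noncomputable def ip (u v : 𝓢(ℝ, ℂ)) : ℂ :=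
  inner ℂ (u.toLp 2 (volume : Measure ℝ)) (v.toLp 2 (volume : Measure ℝ))

lemma tg_ofReal : Function.HasTemperateGrowth (fun x : ℝ => (x : ℂ)) :=
  Complex.ofRealCLM.hasTemperateGrowth

@[simp] lemma XX_apply (u : 𝓢(ℝ, ℂ)) (x : ℝ) : XX u x = (x : ℂ) * u x := by
  simp [XX, SchwartzMap.smulLeftCLM_apply_apply tg_ofReal]

@[simp] lemma DD_apply (u : 𝓢(ℝ, ℂ)) (x : ℝ) : DD u x = deriv u x := by
  simp [DD]

lemma DD_eq (u : 𝓢(ℝ, ℂ)) : DD u = ∂_{(1:ℝ)} u := by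
  ext x; simp [SchwartzMap.lineDerivOp_apply_eq_fderiv]

lemma XX_eq (u : 𝓢(ℝ, ℂ)) : SchwartzMap.smulLeftCLM ℂ (fun x : ℝ => inner ℝ x (1:ℝ)) u = XX u := by
  have : (fun x : ℝ => inner ℝ x (1:ℝ)).HasTemperateGrowth :=
    ((innerSL ℝ).flip (1:ℝ)).hasTemperateGrowth
  ext x
  rw [SchwartzMap.smulLeftCLM_apply_apply this]
  simp

lemma four_DD (u : 𝓢(ℝ, ℂ)) : 𝓕 (DD u) = (2 * Real.pi * I : ℂ) • XX (𝓕 u) := by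
  rw [DD_eq, SchwartzMap.fourier_lineDerivOp_eq, XX_eq]

lemma DD_four (u : 𝓢(ℝ, ℂ)) : DD (𝓕 u) = 𝓕 (-(2 * Real.pi * I : ℂ) • XX u) := by
  rw [DD_eq, SchwartzMap.lineDerivOp_fourier_eq, XX_eq]

lemma four_XX (u : 𝓢(ℝ, ℂ)) : 𝓕 (XX u) = (-(2 * Real.pi * I : ℂ))⁻¹ • DD (𝓕 u) := by
  have h : (-(2 * Real.pi * I : ℂ)) ≠ 0 := by simp [Real.pi_ne_zero]
  rw [DD_four, FourierTransform.fourier_smul, smul_smul, inv_mul_cancel₀ h, one_smul]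

lemma nrm_four (u : 𝓢(ℝ, ℂ)) : nrm (𝓕 u) = nrm u := SchwartzMap.norm_fourier_toL2_eq u

lemma ip_four (u v : 𝓢(ℝ, ℂ)) : ip (𝓕 u) (𝓕 v) = ip u v := SchwartzMap.inner_fourier_toL2_eq u v

lemma nrm_nonneg (u : 𝓢(ℝ, ℂ)) : 0 ≤ nrm u := norm_nonneg _

lemma nrm_add (u v : 𝓢(ℝ, ℂ)) : nrm (u + v) ≤ nrm u + nrm v := by
  unfold nrm
  have : (u + v).toLp 2 (volume : Measure ℝ) = u.toLp 2 volume + v.toLp 2 volume :=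
    map_add (SchwartzMap.toLpCLM ℂ ℂ 2 (volume : Measure ℝ)) u v
  rw [this]; exact norm_add_le _ _

lemma nrm_smul (c : ℂ) (u : 𝓢(ℝ, ℂ)) : nrm (c • u) = ‖c‖ * nrm u := by
  unfold nrm
  have : (c • u).toLp 2 (volume : Measure ℝ) = c • u.toLp 2 volume :=
    map_smul (SchwartzMap.toLpCLM ℂ ℂ 2 (volume : Measure ℝ)) c u
  rw [this]; exact norm_smul _ _

lemma ip_add_left (u v w : 𝓢(ℝ, ℂ)) : ip (u + v) w = ip u w + ip v w := by
  unfold ip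
  have : (u + v).toLp 2 (volume : Measure ℝ) = u.toLp 2 volume + v.toLp 2 volume :=
    map_add (SchwartzMap.toLpCLM ℂ ℂ 2 (volume : Measure ℝ)) u v
  rw [this]; exact inner_add_left _ _ _

lemma ip_add_right (u v w : 𝓢(ℝ, ℂ)) : ip w (u + v) = ip w u + ip w v := by
  unfold ip
  have : (u + v).toLp 2 (volume : Measure ℝ) = u.toLp 2 volume + v.toLp 2 volume :=
    map_add (SchwartzMap.toLpCLM ℂ ℂ 2 (volume : Measure ℝ)) u v
  rw [this]; exact inner_add_right _ _ _

lemma ip_smul_left (c : ℂ) (u w : 𝓢(ℝ, ℂ)) : ip (c • u) w = (starRingEnd ℂ) c * ip u w := by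
  unfold ip
  have : (c • u).toLp 2 (volume : Measure ℝ) = c • u.toLp 2 volume :=
    map_smul (SchwartzMap.toLpCLM ℂ ℂ 2 (volume : Measure ℝ)) c u
  rw [this]; exact inner_smul_left _ _ _

lemma ip_smul_right (c : ℂ) (u w : 𝓢(ℝ, ℂ)) : ip w (c • u) = c * ip w u := by
  unfold ip
  have : (c • u).toLp 2 (volume : Measure ℝ) = c • u.toLp 2 volume :=
    map_smul (SchwartzMap.toLpCLM ℂ ℂ 2 (volume : Measure ℝ)) c u
  rw [this]; exact inner_smul_right _ _ _

lemma ip_self (u : 𝓢(ℝ, ℂ)) : ip u u = (nrm u : ℂ) ^ 2 := by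
  unfold ip nrm
  exact inner_self_eq_norm_sq_to_K (𝕜 := ℂ) _

lemma ip_le (u v : 𝓢(ℝ, ℂ)) : ‖ip u v‖ ≤ nrm u * nrm v := norm_inner_le_norm _ _

lemma ip_conj (u v : 𝓢(ℝ, ℂ)) : (starRingEnd ℂ) (ip v u) = ip u v := inner_conj_symm _ _

lemma ip_XX (u v : 𝓢(ℝ, ℂ)) : ip (XX u) v = ip u (XX v) := by
  unfold ip
  rw [SchwartzMap.inner_toL2_toL2_eq _ _ volume, SchwartzMap.inner_toL2_toL2_eq _ _ volume]
  congr 1; ext x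
  simp; ring

lemma ip_DD (u v : 𝓢(ℝ, ℂ)) : ip (DD u) v = -ip u (DD v) := by
  rw [← ip_four, ← ip_four u, four_DD, four_DD, ip_smul_left, ip_smul_right, ip_XX]
  have : (starRingEnd ℂ) (2 * Real.pi * I) = -(2 * Real.pi * I) := by
    rw [show (2 * Real.pi * I : ℂ) = ((2 * Real.pi : ℝ) : ℂ) * I by push_cast; ring, map_mul,
      Complex.conj_ofReal, Complex.conj_I]; ring
  rw [this]; ring

lemma DD_XX (u : 𝓢(ℝ, ℂ)) : DD (XX u) = u + XX (DD u) := by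
  ext x
  have h1 : HasDerivAt (fun x : ℝ => (x:ℂ) * u x) (1 * u x + (x:ℂ) * deriv u x) x :=
    (Complex.ofRealCLM.hasDerivAt (x := x)).mul (u.hasDerivAt x)
  have e : (XX u : ℝ → ℂ) = fun x : ℝ => (x:ℂ) * u x := funext (XX_apply u)
  rw [DD_apply, e, h1.deriv]; simp

lemma nrm_eq (u : 𝓢(ℝ, ℂ)) : nrm u = (eLpNorm u 2 volume).toReal := SchwartzMap.norm_toLp

lemma nrm_sq (u : 𝓢(ℝ, ℂ)) : nrm u ^ 2 = ∫ x, ‖u x‖ ^ 2 := by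
  have h := ip_self u
  unfold ip at h
  rw [SchwartzMap.inner_toL2_toL2_eq _ _ volume] at h
  have e : ∀ x, inner ℂ (u x) (u x) = ((‖u x‖ ^ 2 : ℝ) : ℂ) := fun x => by
    rw [inner_self_eq_norm_sq_to_K]; simp
  simp_rw [e] at h
  rw [integral_complex_ofReal] at h
  exact_mod_cast h.symm

lemma sq_integrable (u : 𝓢(ℝ, ℂ)) : Integrable (fun x => ‖u x‖ ^ 2) := by
  have := u.memLp 2 (volume : Measure ℝ)
  exact (memLp_two_iff_integrable_sq_norm this.1).1 this

lemma nrm_mono {u v : 𝓢(ℝ, ℂ)} {c : ℝ} (hc : 0 ≤ c) (h : ∀ x, ‖u x‖ ≤ c * ‖v x‖) :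
    nrm u ≤ c * nrm v := by
  rw [← abs_of_nonneg (nrm_nonneg u), ← abs_of_nonneg (mul_nonneg hc (nrm_nonneg v)), ← sq_le_sq,
    mul_pow, nrm_sq, nrm_sq, ← integral_const_mul]
  refine integral_mono (sq_integrable u) ((sq_integrable v).const_mul _) fun x => ?_
  have := h x
  simp only
  rw [← mul_pow]
  gcongr

/-- scaled position -/
noncomputable def QQ (h : ℝ) (u : 𝓢(ℝ, ℂ)) : 𝓢(ℝ, ℂ) := ((2 * Real.pi * h : ℝ) : ℂ) • XX u

/-- cubic multiplication -/
noncomputable def Phi (h y : ℝ) (u : 𝓢(ℝ, ℂ)) : 𝓢(ℝ, ℂ) :=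
  QQ h u + ((y / 3 : ℝ) : ℂ) • QQ h (QQ h u) + ((y ^ 2 / 27 : ℝ) : ℂ) • QQ h (QQ h (QQ h u))

/-- the operator on the physical side -/
noncomputable def Sop (h y : ℝ) (u : 𝓢(ℝ, ℂ)) : 𝓢(ℝ, ℂ) :=
  (-I) • Phi h y u + ((1 / (4 * Real.pi ^ 2) : ℝ) : ℂ) • DD (DD u) + u

/-- the operator on the Fourier side -/
noncomputable def Tq (h y : ℝ) (v : 𝓢(ℝ, ℂ)) : 𝓢(ℝ, ℂ) :=
  (h : ℂ) • DD v + (I * (y / 3) * h ^ 2 : ℂ) • DD (DD v) + (-(y ^ 2 / 27 * h ^ 3) : ℂ) • DD (DD (DD v))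
    + (-1 : ℂ) • XX (XX v) + v

lemma four_QQ (h : ℝ) (u : 𝓢(ℝ, ℂ)) : 𝓕 (QQ h u) = (I * h : ℂ) • DD (𝓕 u) := by
  rw [QQ, FourierTransform.fourier_smul, four_XX, smul_smul]
  congr 1
  have : (Real.pi : ℂ) ≠ 0 := by simp [Real.pi_ne_zero]
  push_cast
  field_simp
  simp

lemma four_Sop (h y : ℝ) (u : 𝓢(ℝ, ℂ)) : 𝓕 (Sop h y u) = Tq h y (𝓕 u) := by
  unfold Sop Phi Tq
  simp only [FourierTransform.fourier_add, FourierTransform.fourier_smul, four_QQ, four_DD, map_smul, smul_smul, smul_add]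
  have h1 : (Real.pi : ℂ) ≠ 0 := by simp [Real.pi_ne_zero]
  ext x
  simp
  have hI := I_sq
  have hI3 : I ^ 3 = -I := by rw [pow_succ, I_sq]; ring
  field_simp
  ring_nf
  simp only [I_sq, show I ^ 3 = -I from hI3, show I ^ 4 = 1 by rw [show 4 = 2 * 2 from rfl, pow_mul, I_sq]; norm_num]
  ring


lemma QQ_apply (h : ℝ) (u : 𝓢(ℝ, ℂ)) (x : ℝ) :
    QQ h u x = ((2 * Real.pi * h * x : ℝ) : ℂ) * u x := by
  simp [QQ]; ring

lemma Phi_apply (h y : ℝ) (u : 𝓢(ℝ, ℂ)) (x : ℝ) :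
    Phi h y u x = (((2 * Real.pi * h * x) * (1 + y * (2 * Real.pi * h * x) / 3
      + (y * (2 * Real.pi * h * x)) ^ 2 / 27) : ℝ) : ℂ) * u x := by
  simp [Phi, QQ_apply]; ring

lemma ip_QQ (h : ℝ) (u v : 𝓢(ℝ, ℂ)) : ip (QQ h u) v = ip u (QQ h v) := by
  unfold QQ; rw [ip_smul_left, ip_smul_right, ip_XX, Complex.conj_ofReal]

lemma ip_Phi (h y : ℝ) (u v : 𝓢(ℝ, ℂ)) : ip (Phi h y u) v = ip u (Phi h y v) := by
  unfold Phi
  simp only [ip_add_left, ip_add_right, ip_smul_left, ip_smul_right, Complex.conj_ofReal, ip_QQ]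

lemma ip_Phi_im (h y : ℝ) (u : 𝓢(ℝ, ℂ)) : (ip u (Phi h y u)).im = 0 := by
  have := ip_conj u (Phi h y u)
  rw [ip_Phi] at this
  exact Complex.conj_eq_iff_im.1 this

/-- the square multiplier arising from the commutator -/
noncomputable def RQ (h y : ℝ) (u : 𝓢(ℝ, ℂ)) : 𝓢(ℝ, ℂ) :=
  u + ((2 * y / 3 : ℝ) : ℂ) • QQ h u + ((y ^ 2 / 9 : ℝ) : ℂ) • QQ h (QQ h u)

lemma DD_QQ (h : ℝ) (u : 𝓢(ℝ, ℂ)) :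
    DD (QQ h u) = ((2 * Real.pi * h : ℝ) : ℂ) • u + QQ h (DD u) := by
  unfold QQ; rw [map_smul, DD_XX, smul_add]

lemma QQ_add (h : ℝ) (u v : 𝓢(ℝ, ℂ)) : QQ h (u + v) = QQ h u + QQ h v := by
  unfold QQ; rw [map_add, smul_add]

lemma QQ_smul (h : ℝ) (c : ℂ) (u : 𝓢(ℝ, ℂ)) : QQ h (c • u) = c • QQ h u := by
  unfold QQ; rw [map_smul, smul_comm]

lemma DD_Phi (h y : ℝ) (u : 𝓢(ℝ, ℂ)) :
    DD (Phi h y u) = ((2 * Real.pi * h : ℝ) : ℂ) • RQ h y u + Phi h y (DD u) := by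
  unfold Phi RQ
  simp only [map_add, map_smul, DD_QQ, QQ_add, QQ_smul, smul_add, smul_smul]
  ext x
  simp
  ring

lemma ap_one (h y : ℝ) (u : 𝓢(ℝ, ℂ)) :
    nrm (XX (𝓕 u)) ^ 2 ≤ nrm u ^ 2 + nrm (Sop h y u) * nrm u := by
  have e1 : nrm (DD u) = 2 * Real.pi * nrm (XX (𝓕 u)) := by
    rw [← nrm_four, four_DD, nrm_smul]; simp [abs_of_pos Real.pi_pos]
  have h1 := ip_le u (Sop h y u)
  have h2 : ip u (Sop h y u) = -I * ip u (Phi h y u) -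
      ((1 / (4 * Real.pi ^ 2) : ℝ) : ℂ) * ((nrm (DD u) ^ 2 : ℝ) : ℂ) + ((nrm u ^ 2 : ℝ) : ℂ) := by
    unfold Sop
    rw [ip_add_right, ip_add_right, ip_smul_right, ip_smul_right, ip_self,
      ← neg_neg (ip u (DD (DD u))), ← ip_DD, ip_self]
    push_cast; ring
  have h3 : (ip u (Sop h y u)).re = - nrm (XX (𝓕 u)) ^ 2 + nrm u ^ 2 := by
    rw [h2, Complex.add_re, Complex.sub_re, ← Complex.ofReal_mul, Complex.ofReal_re,
      Complex.ofReal_re, e1]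
    have : (-I * ip u (Phi h y u)).re = 0 := by
      rw [Complex.mul_re]; simp [ip_Phi_im]
    rw [this]
    have := Real.pi_ne_zero
    field_simp
    ring
  have h4 := (Complex.abs_re_le_norm (ip u (Sop h y u))).trans h1
  rw [h3] at h4
  have := (abs_le.1 h4).1
  linarith

set_option maxHeartbeats 1000000 in
lemma ap_two (h y : ℝ) (hh : 0 < h) (hh1 : h ≤ 1) (hy : 0 < y) (hy1 : y ≤ 1) (u : 𝓢(ℝ, ℂ)) :
    nrm (Phi h y u) ≤ 3 * (nrm u + nrm (Sop h y u)) := by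
  set n := nrm u with hn
  set f := nrm (Sop h y u) with hf
  set p := nrm (Phi h y u) with hp
  have n0 : 0 ≤ n := nrm_nonneg _
  have f0 : 0 ≤ f := nrm_nonneg _
  have p0 : 0 ≤ p := nrm_nonneg _
  set d := nrm (XX (𝓕 u)) with hd
  have d0 : 0 ≤ d := nrm_nonneg _
  have e1 : nrm (DD u) = 2 * Real.pi * d := by
    rw [hd, ← nrm_four, four_DD, nrm_smul]; simp [abs_of_pos Real.pi_pos]
  have hdn : d ≤ n + f := by
    have := ap_one h y u
    rw [← hd, ← hn, ← hf] at this
    nlinarith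
  have hR : nrm (RQ h y u) ≤ 2 * n + y * p := by
    have hle : nrm (RQ h y u) ^ 2 ≤ (2 * n + y * p) ^ 2 := by
      -- pointwise
      have hpt : ∀ x, ‖RQ h y u x‖ ≤ 2 * ‖u x‖ + y * ‖Phi h y u x‖ := by
        intro x
        set t := 2 * Real.pi * h * x with ht
        set r := 1 + y * t / 3 with hr
        have a1 : RQ h y u x = ((r ^ 2 : ℝ) : ℂ) * u x := by
          simp [RQ, QQ_apply, hr, ht]; ring
        have a2 : (y : ℂ) * Phi h y u x = ((r ^ 3 - 1 : ℝ) : ℂ) * u x := by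
          rw [Phi_apply]; simp [hr, ht]; ring
        have a3 : y * ‖Phi h y u x‖ = |r ^ 3 - 1| * ‖u x‖ := by
          rw [← Real.norm_eq_abs, ← Complex.norm_real, ← norm_mul, ← a2, norm_mul, Complex.norm_real,
            Real.norm_of_nonneg hy.le]
        rw [a3, a1, norm_mul, Complex.norm_real, Real.norm_of_nonneg (sq_nonneg r), ← add_mul]
        apply mul_le_mul_of_nonneg_right _ (norm_nonneg _)
        rcases le_total r 1 with c | c
        · rcases le_total (-1) r with c2 | c2
          · have := abs_nonneg (r ^ 3 - 1); nlinarith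
          · rw [abs_of_nonpos (by nlinarith [sq_nonneg r])]
            nlinarith [sq_nonneg r]
        · have := le_abs_self (r ^ 3 - 1); nlinarith [sq_nonneg r]
      -- Minkowski through pointwise square
      rcases eq_or_lt_of_le (show 0 ≤ n by exact n0) with z | z
      · have hz : u = 0 := by
          have : nrm u = 0 := by rw [← hn]; exact z.symm
          exact SchwartzMap.injective_toLp 2 (volume : Measure ℝ) (by
            show u.toLp 2 volume = (0 : 𝓢(ℝ, ℂ)).toLp 2 volume
            rw [norm_eq_zero.1 this]
            exact (map_zero (SchwartzMap.toLpCLM ℂ ℂ 2 (volume : Measure ℝ))).symm)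
        have : RQ h y u = 0 := by ext x; rw [hz]; simp [RQ, QQ_apply]
        have h0 : nrm (RQ h y u) = 0 := by
          rw [this]
          have := nrm_smul 0 (0 : 𝓢(ℝ, ℂ)); simpa using this
        rw [h0, zero_pow two_ne_zero]; positivity
      · by_cases zp : y * p = 0
        · have hyp : p = 0 := by
            rcases mul_eq_zero.1 zp with z1 | z1
            · exact absurd z1 hy.ne'
            · exact z1
          have hz : Phi h y u = 0 := by
            have : nrm (Phi h y u) = 0 := by rw [← hp]; exact hyp
            exact SchwartzMap.injective_toLp 2 (volume : Measure ℝ) (by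
              show (Phi h y u).toLp 2 volume = (0 : 𝓢(ℝ, ℂ)).toLp 2 volume
              rw [norm_eq_zero.1 this]
              exact (map_zero (SchwartzMap.toLpCLM ℂ ℂ 2 (volume : Measure ℝ))).symm)
          have : nrm (RQ h y u) ≤ 2 * nrm u := nrm_mono (by norm_num) fun x => by
            have := hpt x; rw [hz] at this; simpa using this
          rw [zp, add_zero]
          exact pow_le_pow_left₀ (nrm_nonneg _) this 2
        · have hyp : 0 < y * p := lt_of_le_of_ne (by positivity) (Ne.symm zp)
          have hp0 : p ≠ 0 := fun hh0 => zp (by rw [hh0, mul_zero])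
          have e : (2 * n + y * p) ^ 2 = (1 + y * p / (2 * n)) * (2 * n) ^ 2
              + (1 + (2 * n) / (y * p)) * (y * p) ^ 2 := by field_simp; ring
          rw [e, nrm_sq, mul_pow, mul_pow, hn, nrm_sq u, hp, nrm_sq (Phi h y u), ← hn, ← hp,
            ← mul_assoc, ← mul_assoc, ← integral_const_mul, ← integral_const_mul,
            ← integral_add ((sq_integrable _).const_mul _) ((sq_integrable _).const_mul _)]
          refine integral_mono (sq_integrable _)
            (((sq_integrable _).const_mul _).add ((sq_integrable _).const_mul _)) fun x => ?_
          show ‖RQ h y u x‖ ^ 2 ≤ (1 + y * p / (2 * n)) * 2 ^ 2 * ‖u x‖ ^ 2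
              + (1 + (2 * n) / (y * p)) * y ^ 2 * ‖Phi h y u x‖ ^ 2
          refine (pow_le_pow_left₀ (norm_nonneg _) (hpt x) 2).trans ?_
          set a := 2 * ‖u x‖
          set b := y * ‖Phi h y u x‖
          set q := y * p / (2 * n) with hq
          have hq0 : 0 < q := by positivity
          have e2 : (2 * n) / (y * p) = q⁻¹ := by rw [hq, inv_div]
          rw [e2]
          have : 0 ≤ q * (a - q⁻¹ * b) ^ 2 := by positivity
          have e3 : q * (a - q⁻¹ * b) ^ 2 = q * a ^ 2 - 2 * a * b + q⁻¹ * b ^ 2 := by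
            field_simp; ring
          have e4 : (1 + q) * 2 ^ 2 * ‖u x‖ ^ 2 = (1 + q) * a ^ 2 := by ring
          have e5 : (1 + q⁻¹) * y ^ 2 * ‖Phi h y u x‖ ^ 2 = (1 + q⁻¹) * b ^ 2 := by ring
          rw [e4, e5]; nlinarith
    exact le_of_sq_le_sq hle (by positivity)
  have h1 := ip_le (Phi h y u) (Sop h y u)
  have h2 : ip (Phi h y u) (Sop h y u) = -I * ((p ^ 2 : ℝ) : ℂ) -
      ((1 / (4 * Real.pi ^ 2) : ℝ) : ℂ) * (((2 * Real.pi * h : ℝ) : ℂ) * ip (RQ h y u) (DD u)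
        + ip (DD u) (Phi h y (DD u)))
        + ip u (Phi h y u) := by
    have e3 : Sop h y u = (-I) • Phi h y u + ((1 / (4 * Real.pi ^ 2) : ℝ) : ℂ) • DD (DD u) + u := rfl
    rw [e3, ip_add_right, ip_add_right, ip_smul_right, ip_smul_right, ip_self, ip_Phi _ _ _ u,
      ← neg_neg (ip (Phi h y u) (DD (DD u))), ← ip_DD, DD_Phi, ip_add_left, ip_smul_left,
      Complex.conj_ofReal, ip_Phi _ _ (DD u)]
    push_cast; ring
  have h3 : (ip (Phi h y u) (Sop h y u)).im = -p ^ 2 -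
      h / (2 * Real.pi) * (ip (RQ h y u) (DD u)).im := by
    rw [h2, Complex.add_im, Complex.sub_im, ip_Phi_im, Complex.im_ofReal_mul, Complex.add_im,
      Complex.im_ofReal_mul, ip_Phi_im]
    have : (-I * ((p ^ 2 : ℝ) : ℂ)).im = - p ^ 2 := by
      rw [mul_comm, Complex.im_ofReal_mul]; simp
    rw [this]
    have := Real.pi_ne_zero
    field_simp
    ring
  have h4 := (Complex.abs_im_le_norm (ip (Phi h y u) (Sop h y u))).trans h1
  have h5 := (Complex.abs_im_le_norm (ip (RQ h y u) (DD u))).trans (ip_le _ _)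
  rw [e1] at h5
  have h6 : h / (2 * Real.pi) * |(ip (RQ h y u) (DD u)).im| ≤ h * (nrm (RQ h y u) * d) := by
    calc h / (2 * Real.pi) * |(ip (RQ h y u) (DD u)).im| ≤
        h / (2 * Real.pi) * (nrm (RQ h y u) * (2 * Real.pi * d)) := by gcongr
      _ = _ := by field_simp
  have h7 : h * (nrm (RQ h y u) * d) ≤ (2 * n + p) * (n + f) := by
    have q1 : nrm (RQ h y u) * d ≤ (2 * n + p) * (n + f) := by
      have : y * p ≤ p := by nlinarith
      exact mul_le_mul (by linarith) hdn d0 (by positivity)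
    have q2 : 0 ≤ nrm (RQ h y u) * d := mul_nonneg (nrm_nonneg _) d0
    nlinarith
  have h8 : p ^ 2 ≤ p * f + (2 * n + p) * (n + f) := by
    have a1 := (abs_le.1 h4).1
    rw [h3] at a1
    have a2 : -(h / (2 * Real.pi) * (ip (RQ h y u) (DD u)).im) ≤
        h / (2 * Real.pi) * |(ip (RQ h y u) (DD u)).im| := by
      rw [← mul_neg]; gcongr; exact neg_le_abs _
    linarith
  by_contra hc
  push Not at hc
  nlinarith [mul_nonneg n0 f0, mul_nonneg n0 p0, mul_nonneg f0 p0]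

lemma ap_three (h y : ℝ) (hh : 0 < h) (hh1 : h ≤ 1) (hy : 0 < y) (hy1 : y ≤ 1) (u : 𝓢(ℝ, ℂ)) :
    h * nrm (DD (𝓕 u)) ≤ 12 * (nrm u + nrm (Sop h y u)) ∧
    y / 3 * h ^ 2 * nrm (DD (DD (𝓕 u))) ≤ 24 * (nrm u + nrm (Sop h y u)) := by
  have hP := ap_two h y hh hh1 hy hy1 u
  have e1 : nrm (QQ h u) = h * nrm (DD (𝓕 u)) := by
    rw [← nrm_four, four_QQ, nrm_smul]; simp [abs_of_pos hh]
  have e2 : nrm (QQ h (QQ h u)) = h ^ 2 * nrm (DD (DD (𝓕 u))) := by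
    rw [← nrm_four, four_QQ, four_QQ, map_smul, nrm_smul, nrm_smul]; simp [abs_of_pos hh]; ring
  have q1 : nrm (QQ h u) ≤ 4 * nrm (Phi h y u) := by
    refine nrm_mono (by norm_num) fun x => ?_
    rw [QQ_apply, Phi_apply, norm_mul, norm_mul, Complex.norm_real, Complex.norm_real]
    obtain ⟨t, ht⟩ : ∃ t, t = 2 * Real.pi * h * x := ⟨_, rfl⟩
    rw [← ht, ← mul_assoc]
    apply mul_le_mul_of_nonneg_right _ (norm_nonneg _)
    rw [Real.norm_eq_abs, Real.norm_eq_abs, abs_mul t]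
    have : 1 / 4 ≤ |1 + y * t / 3 + (y * t) ^ 2 / 27| := by
      refine le_trans ?_ (le_abs_self _)
      nlinarith [sq_nonneg (y * t / 3 + 3 / 2)]
    nlinarith [abs_nonneg t]
  have q2 : nrm (QQ h (QQ h u)) ≤ (24 / y) * nrm (Phi h y u) := by
    refine nrm_mono (by positivity) fun x => ?_
    rw [QQ_apply, QQ_apply, Phi_apply, norm_mul, norm_mul, norm_mul, Complex.norm_real,
      Complex.norm_real]
    obtain ⟨t, ht⟩ : ∃ t, t = 2 * Real.pi * h * x := ⟨_, rfl⟩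
    rw [← ht, ← mul_assoc, ← mul_assoc]
    apply mul_le_mul_of_nonneg_right _ (norm_nonneg _)
    rw [Real.norm_eq_abs, Real.norm_eq_abs, abs_mul t]
    have : |y * t / 3| ≤ 8 * |1 + y * t / 3 + (y * t) ^ 2 / 27| := by
      have h1 := le_abs_self (1 + y * t / 3 + (y * t) ^ 2 / 27)
      rw [abs_le]; constructor <;> nlinarith [sq_nonneg (y * t / 3 + 3 / 2), sq_nonneg (y * t / 3 + 27 / 16)]
    have e : |y * t / 3| = y / 3 * |t| := by
      rw [show y * t / 3 = (y / 3) * t by ring, abs_mul, abs_of_pos (by positivity)]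
    rw [e] at this
    have : |t| ≤ 24 / y * |1 + y * t / 3 + (y * t) ^ 2 / 27| := by
      rw [div_mul_eq_mul_div, le_div_iff₀ hy]; linarith
    calc |t| * |t| ≤ |t| * (24 / y * |1 + y * t / 3 + (y * t) ^ 2 / 27|) := by gcongr
      _ = _ := by ring
  constructor
  · rw [← e1]; linarith
  · rw [mul_assoc, ← e2]
    calc y / 3 * nrm (QQ h (QQ h u)) ≤ y / 3 * ((24 / y) * nrm (Phi h y u)) := by gcongr
      _ = 8 * nrm (Phi h y u) := by field_simp; ring
      _ ≤ _ := by linarith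


/-- a priori estimates for `Tq` -/
lemma ap_T (h y : ℝ) (hh : 0 < h) (hh1 : h ≤ 1) (hy : 0 < y) (hy1 : y ≤ 1) (v : 𝓢(ℝ, ℂ)) :
    nrm (XX v) ^ 2 ≤ nrm v ^ 2 + nrm (Tq h y v) * nrm v ∧
    h * nrm (DD v) ≤ 12 * (nrm v + nrm (Tq h y v)) ∧
    y / 3 * h ^ 2 * nrm (DD (DD v)) ≤ 24 * (nrm v + nrm (Tq h y v)) := by
  have e : 𝓕 (𝓕⁻ v) = v := FourierTransform.fourier_fourierInv_eq v
  have h1 := ap_one h y (𝓕⁻ v)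
  have h2 := ap_three h y hh hh1 hy hy1 (𝓕⁻ v)
  have h3 : nrm (𝓕⁻ v) = nrm v := by rw [← nrm_four, e]
  have h4 : nrm (Sop h y (𝓕⁻ v)) = nrm (Tq h y v) := by rw [← nrm_four, four_Sop, e]
  rw [h3, h4, e] at h1 h2
  exact ⟨h1, h2.1, h2.2⟩

lemma DD_fun (v : 𝓢(ℝ, ℂ)) : ⇑(DD v) = deriv v := by ext x; exact DD_apply v x

lemma sch_hasDeriv (v : 𝓢(ℝ, ℂ)) (s : ℝ) : HasDerivAt v (DD v s) s := by
  rw [DD_apply]; exact v.differentiableAt.hasDerivAt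

/-- the right factor applied to `v` -/
noncomputable def wR (h y : ℝ) (ω : ℝ → ℂ) (v : 𝓢(ℝ, ℂ)) (s : ℝ) : ℂ :=
  ((v s + 2 * I * ((y * h / 3 : ℝ) : ℂ) * DD v s - ((y * h / 3 : ℝ) : ℂ) ^ 2 * DD (DD v) s)
    + ω s * (v s + I * ((y * h / 3 : ℝ) : ℂ) * DD v s)
    + (ω s ^ 2 - I * ((y * h / 3 : ℝ) : ℂ) * deriv ω s) * v s) / 3

lemma Tq_apply (h y : ℝ) (v : 𝓢(ℝ, ℂ)) (s : ℝ) : Tq h y v s = h * DD v s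
    + (I * (y / 3) * h ^ 2) * DD (DD v) s + (-(y ^ 2 / 27 * h ^ 3)) * DD (DD (DD v)) s
    - s ^ 2 * v s + v s := by
  simp [Tq]; ring

lemma wR_deriv (h y : ℝ) (hy : 0 < y) (ω : ℝ → ℂ) (hω : ContDiff ℝ (⊤ : ℕ∞) ω) (v : 𝓢(ℝ, ℂ)) (s : ℝ)
    (hr : ω s ^ 3 - 3 * I * ((y * h / 3 : ℝ) : ℂ) * ω s * deriv ω s
      - ((y * h / 3 : ℝ) : ℂ) ^ 2 * deriv (deriv ω) s = 1 + I * ((y * (s ^ 2 - 1) : ℝ) : ℂ)) :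
    ∃ d, HasDerivAt (wR h y ω v) d s ∧
      h * d - (3 / (I * y) * (ω s - 1)) * wR h y ω v s = Tq h y v s := by
  have d1 : HasDerivAt ω (deriv ω s) s :=
    (hω.differentiable (by simp)).differentiableAt.hasDerivAt
  have d2 : HasDerivAt (deriv ω) (deriv (deriv ω) s) s := by
    have : ContDiff ℝ (⊤ : ℕ∞) (deriv ω) := (contDiff_infty_iff_deriv.1 hω).2
    exact (this.differentiable (by simp)).differentiableAt.hasDerivAt
  have v0 := sch_hasDeriv v s
  have v1 := sch_hasDeriv (DD v) s
  have v2 := sch_hasDeriv (DD (DD v)) s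
  set σ : ℂ := ((y * h / 3 : ℝ) : ℂ) with hσ
  have key := ((((v0.add (v1.const_mul (2 * I * σ))).sub (v2.const_mul (σ ^ 2))).add
    (d1.mul (v0.add (v1.const_mul (I * σ))))).add
    (((d1.pow 2).sub (d2.const_mul (I * σ))).mul v0)).div_const 3
  refine ⟨_, key, ?_⟩
  rw [Tq_apply]
  unfold wR
  have hy' : (y : ℂ) ≠ 0 := by exact_mod_cast hy.ne'
  have hσ' : (h : ℂ) = 3 * σ / y := by rw [hσ]; push_cast; field_simp
  have hr' : deriv (deriv ω) s * σ ^ 2 = ω s ^ 3 - 3 * I * σ * ω s * deriv ω s -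
     (1 + I * ((y * (s ^ 2 - 1) : ℝ) : ℂ)) := by rw [← hr]; ring
  rw [← hσ, hσ']
  have e3 : 3 / (I * (y : ℂ)) = -3 * I / y := by
    have := I_sq
    field_simp; linear_combination this
  rw [e3]
  push_cast at hr' ⊢
  simp only [Pi.add_apply, Pi.sub_apply, Pi.mul_apply, Pi.pow_apply]
  generalize DD (DD (DD v)) s = V3
  generalize DD (DD v) s = V2
  generalize DD v s = V1
  generalize v s = V0
  generalize deriv (deriv ω) s = W2 at *
  generalize deriv ω s = W1 at *
  generalize ω s = W at *
  have hY : (y : ℂ) * (y : ℂ)⁻¹ = 1 := mul_inv_cancel₀ hy'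
  field_simp at hr' ⊢
  push_cast
  linear_combination (-27 * I * V0) * hr' + 27 * (σ * (W - 1) * (2 * V1 + W * V1 - W1 * V0)
    + 3 * V0 * σ * W * W1 + y * V0 * (s ^ 2 - 1)) * I_sq


lemma int_le_nrm (v : 𝓢(ℝ, ℂ)) {a b : ℝ} (hab : a ≤ b) :
    ∫ s in a..b, ‖v s‖ ^ 2 ≤ nrm v ^ 2 := by
  rw [nrm_sq, intervalIntegral.integral_of_le hab]
  exact setIntegral_le_integral (sq_integrable v) (Filter.Eventually.of_forall fun x => by positivity)

lemma wR_close {h y C : ℝ} (hh : 0 < h) (hh1 : h ≤ 1) (hy : 0 < y) (hC : 0 < C)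
    (hCy : C * y ≤ 1) (hy1 : y ≤ 1) {ω : ℝ → ℂ} (v : 𝓢(ℝ, ℂ)) (s : ℝ)
    (h1 : ‖ω s - 1‖ ≤ C * y) (h2 : ‖deriv ω s‖ ≤ C * y) :
    ‖wR h y ω v s - v s‖ ≤ (2 * C + 2) * y *
      (‖v s‖ + h * ‖DD v s‖ + y / 3 * h ^ 2 * ‖DD (DD v) s‖) := by
  set σ : ℝ := y * h / 3 with hσ
  have σ0 : 0 < σ := by positivity
  have σ1 : σ ≤ 1 := by rw [hσ]; nlinarith
  have e : wR h y ω v s - v s = (2 * I * (σ : ℂ) * DD v s - (σ : ℂ) ^ 2 * DD (DD v) s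
      + (ω s - 1) * v s + (ω s - 1 + 1) * (I * σ * DD v s)
      + ((ω s - 1) * ((ω s - 1) + 2) - I * σ * deriv ω s) * v s) / 3 := by
    unfold wR; rw [← hσ]; ring
  have b1 : ‖2 * I * (σ : ℂ) * DD v s‖ = 2 * σ * ‖DD v s‖ := by
    simp [abs_of_pos σ0]
  have b2 : ‖(σ : ℂ) ^ 2 * DD (DD v) s‖ = σ ^ 2 * ‖DD (DD v) s‖ := by
    simp
  have b3 : ‖(ω s - 1) * v s‖ ≤ C * y * ‖v s‖ := by rw [norm_mul]; gcongr
  have b4 : ‖(ω s - 1 + 1) * (I * σ * DD v s)‖ ≤ 2 * (σ * ‖DD v s‖) := by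
    rw [norm_mul]
    have : ‖I * σ * DD v s‖ = σ * ‖DD v s‖ := by simp [abs_of_pos σ0]
    rw [this]; gcongr
    have := norm_add_le (ω s - 1) 1
    rw [norm_one] at this; linarith
  have b5 : ‖((ω s - 1) * ((ω s - 1) + 2) - I * σ * deriv ω s) * v s‖ ≤ (4 * (C * y)) * ‖v s‖ := by
    rw [norm_mul]; gcongr
    have c1 : ‖(ω s - 1) * ((ω s - 1) + 2)‖ ≤ C * y * 3 := by
      rw [norm_mul]; gcongr
      have := norm_add_le (ω s - 1) 2
      simp only [Complex.norm_ofNat] at this; linarith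
    have c2 : ‖I * σ * deriv ω s‖ ≤ 1 * (C * y) := by
      rw [norm_mul]
      have : ‖I * (σ : ℂ)‖ = σ := by simp [abs_of_pos σ0]
      rw [this]; gcongr
    have := norm_sub_le ((ω s - 1) * ((ω s - 1) + 2)) (I * σ * deriv ω s)
    linarith
  rw [e, norm_div, Complex.norm_ofNat, div_le_iff₀ (by norm_num)]
  have t1 := norm_add_le (2 * I * (σ : ℂ) * DD v s - (σ : ℂ) ^ 2 * DD (DD v) s
      + (ω s - 1) * v s + (ω s - 1 + 1) * (I * σ * DD v s))
      (((ω s - 1) * ((ω s - 1) + 2) - I * σ * deriv ω s) * v s)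
  have t2 := norm_add_le (2 * I * (σ : ℂ) * DD v s - (σ : ℂ) ^ 2 * DD (DD v) s
      + (ω s - 1) * v s) ((ω s - 1 + 1) * (I * σ * DD v s))
  have t3 := norm_add_le (2 * I * (σ : ℂ) * DD v s - (σ : ℂ) ^ 2 * DD (DD v) s) ((ω s - 1) * v s)
  have t4 := norm_sub_le (2 * I * (σ : ℂ) * DD v s) ((σ : ℂ) ^ 2 * DD (DD v) s)
  have n0 := norm_nonneg (v s)
  have n1 := norm_nonneg (DD v s)
  have n2 := norm_nonneg (DD (DD v) s)
  have p0 : 0 ≤ C * y := by positivity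
  have q0 : 5 * (C * y) * ‖v s‖ ≤ 3 * ((2 * C + 2) * y) * ‖v s‖ := by
    apply mul_le_mul_of_nonneg_right _ n0; nlinarith
  have q1 : 4 * σ * ‖DD v s‖ ≤ 3 * ((2 * C + 2) * y) * (h * ‖DD v s‖) := by
    have : 4 * σ ≤ 3 * ((2 * C + 2) * y) * h := by
      rw [hσ]; nlinarith [mul_pos hy hh, mul_pos hC (mul_pos hy hh)]
    nlinarith
  have q2 : σ ^ 2 * ‖DD (DD v) s‖ ≤ 3 * ((2 * C + 2) * y) * (y / 3 * h ^ 2 * ‖DD (DD v) s‖) := by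
    have : σ ^ 2 ≤ 3 * ((2 * C + 2) * y) * (y / 3 * h ^ 2) := by
      rw [hσ]; nlinarith [mul_pos (mul_pos hy hh) (mul_pos hy hh), mul_pos hC (mul_pos (mul_pos hy hh) (mul_pos hy hh))]
    nlinarith
  linarith

lemma wR_cont {h y : ℝ} {ω : ℝ → ℂ} (hω : ContDiff ℝ (⊤ : ℕ∞) ω) (v : 𝓢(ℝ, ℂ)) :
    Continuous (wR h y ω v) := by
  have h1 := hω.continuous
  have h2 := (contDiff_infty_iff_deriv.1 hω).2.continuous
  have h3 := v.continuous
  have h4 := (DD v).continuous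
  have h5 := (DD (DD v)).continuous
  unfold wR
  fun_prop

lemma wR_L2 {h y C : ℝ} (hh : 0 < h) (hh1 : h ≤ 1) (hy : 0 < y) (hC : 0 < C)
    (hCy : C * y ≤ 1) (hy1 : y ≤ 1) {ω : ℝ → ℂ} (hω : ContDiff ℝ (⊤ : ℕ∞) ω) (v : 𝓢(ℝ, ℂ))
    (h1 : ∀ s, ‖ω s - 1‖ ≤ C * y) (h2 : ∀ s, ‖deriv ω s‖ ≤ C * y) {a b : ℝ} (hab : a ≤ b) :
    ∫ s in a..b, ‖wR h y ω v s - v s‖ ^ 2 ≤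
      2163 * (2 * C + 2) ^ 2 * y ^ 2 * (nrm v + nrm (Tq h y v)) ^ 2 := by
  obtain ⟨-, a1, a2⟩ := ap_T h y hh hh1 hy hy1 v
  set n := nrm v + nrm (Tq h y v)
  have hn : nrm v ≤ n := by have := nrm_nonneg (Tq h y v); simp only [n]; linarith
  have cw := wR_cont (h := h) (y := y) hω v
  have c0 := v.continuous
  have c1 := (DD v).continuous
  have c2 := (DD (DD v)).continuous
  have i1 : ∫ s in a..b, ‖wR h y ω v s - v s‖ ^ 2 ≤ ∫ s in a..b,
      (3 * ((2 * C + 2) * y) ^ 2) * (‖v s‖ ^ 2 + h ^ 2 * ‖DD v s‖ ^ 2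
        + (y / 3 * h ^ 2) ^ 2 * ‖DD (DD v) s‖ ^ 2) := by
    refine intervalIntegral.integral_mono_on hab (Continuous.intervalIntegrable (by fun_prop) _ _)
      (Continuous.intervalIntegrable (by fun_prop) _ _) fun s _ => ?_
    refine (pow_le_pow_left₀ (norm_nonneg _)
      (wR_close hh hh1 hy hC hCy hy1 v s (h1 s) (h2 s)) 2).trans ?_
    have : ∀ p q r : ℝ, (p + q + r) ^ 2 ≤ 3 * (p ^ 2 + q ^ 2 + r ^ 2) := fun p q r => by
      nlinarith [sq_nonneg (p - q), sq_nonneg (q - r), sq_nonneg (p - r)]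
    rw [mul_pow]
    have t := this ‖v s‖ (h * ‖DD v s‖) (y / 3 * h ^ 2 * ‖DD (DD v) s‖)
    have := mul_le_mul_of_nonneg_left t (sq_nonneg ((2 * C + 2) * y))
    refine this.trans (le_of_eq (by ring))
  rw [intervalIntegral.integral_const_mul, intervalIntegral.integral_add
    (Continuous.intervalIntegrable (by fun_prop) _ _) (Continuous.intervalIntegrable (by fun_prop) _ _),
    intervalIntegral.integral_add
    (Continuous.intervalIntegrable (by fun_prop) _ _) (Continuous.intervalIntegrable (by fun_prop) _ _),
    intervalIntegral.integral_const_mul, intervalIntegral.integral_const_mul] at i1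
  have j0 := int_le_nrm v hab
  have j1 := int_le_nrm (DD v) hab
  have j2 := int_le_nrm (DD (DD v)) hab
  have k0 : nrm v ^ 2 ≤ n ^ 2 := pow_le_pow_left₀ (nrm_nonneg _) hn 2
  have k1 : h ^ 2 * nrm (DD v) ^ 2 ≤ 144 * n ^ 2 := by
    have := pow_le_pow_left₀ (mul_nonneg hh.le (nrm_nonneg (DD v))) a1 2
    nlinarith
  have k2 : (y / 3 * h ^ 2) ^ 2 * nrm (DD (DD v)) ^ 2 ≤ 576 * n ^ 2 := by
    have := pow_le_pow_left₀ (mul_nonneg (by positivity) (nrm_nonneg (DD (DD v)))) a2 2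
    nlinarith
  refine i1.trans ?_
  calc _ ≤ 3 * ((2 * C + 2) * y) ^ 2 * (nrm v ^ 2 + h ^ 2 * nrm (DD v) ^ 2
      + (y / 3 * h ^ 2) ^ 2 * nrm (DD (DD v)) ^ 2) := by gcongr
    _ ≤ 3 * ((2 * C + 2) * y) ^ 2 * (n ^ 2 + 144 * n ^ 2 + 576 * n ^ 2) := by gcongr
    _ = _ := by ring

/-- Cauchy-Schwarz on an interval for continuous functions -/
lemma cs_int {f g : ℝ → ℝ} (hf : Continuous f) (hg : Continuous g) {a b : ℝ} (hab : a ≤ b) :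
    (∫ s in a..b, f s * g s) ^ 2 ≤ (∫ s in a..b, f s ^ 2) * ∫ s in a..b, g s ^ 2 := by
  have key : ∀ t : ℝ, 0 ≤ (∫ s in a..b, f s ^ 2) * (t * t) + (2 * ∫ s in a..b, f s * g s) * t
      + ∫ s in a..b, g s ^ 2 := by
    intro t
    have h0 : 0 ≤ ∫ s in a..b, (f s * t + g s) ^ 2 :=
      intervalIntegral.integral_nonneg hab fun s _ => sq_nonneg _
    have e : (fun s => (f s * t + g s) ^ 2) = fun s => f s ^ 2 * (t * t) + (f s * g s) * (2 * t)
        + g s ^ 2 := by ext s; ring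
    rw [e, intervalIntegral.integral_add (Continuous.intervalIntegrable (by fun_prop) _ _)
      (Continuous.intervalIntegrable (by fun_prop) _ _), intervalIntegral.integral_add
      (Continuous.intervalIntegrable (by fun_prop) _ _) (Continuous.intervalIntegrable (by fun_prop) _ _),
      intervalIntegral.integral_mul_const, intervalIntegral.integral_mul_const] at h0
    linarith
  have := discrim_le_zero key
  unfold discrim at this
  linarith

lemma core_step {M h : ℝ} (hh : 0 < h) {q : ℝ → ℂ} {ρ : ℝ → ℝ} (hq : Continuous q)
    (hρ : Continuous ρ) (hqρ : ∀ s, (q s).re = ρ s) {w g : ℝ → ℂ} (hg : Continuous g)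
    (hw : ∀ s ∈ Set.Icc (-M) M, ∃ d, HasDerivAt w d s ∧ h * d - q s * w s = g s)
    {s m : ℝ} (hs : -M ≤ s) (hsm : s ≤ m) (hm : m ≤ M) :
    ∃ X Y : ℂ, w s = X - Y ∧ ‖X‖ = Real.exp ((Rr ρ s - Rr ρ m) / h) * ‖w m‖ ∧
      ‖Y‖ ^ 2 ≤ 1 / h ^ 2 * (Real.exp (2 * Rr ρ s / h) * ∫ t in s..M, Real.exp (-(2 * Rr ρ t / h)))
        * ∫ t in (-M)..M, ‖g t‖ ^ 2 := by
  set G : ℝ → ℂ := fun s => ∫ t in (-1:ℝ)..s, q t with hG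
  have Gd : ∀ s, HasDerivAt G (q s) s := fun s =>
    intervalIntegral.integral_hasDerivAt_right (hq.intervalIntegrable _ _)
      (hq.stronglyMeasurableAtFilter _ _) hq.continuousAt
  have Gc : Continuous G := continuous_iff_continuousAt.2 fun s => (Gd s).continuousAt
  have Gre : ∀ s, (G s).re = Rr ρ s := by
    intro s
    have := (Complex.reCLM.intervalIntegral_comp_comm (hq.intervalIntegrable (-1) s) (μ := volume))
    simp only [Complex.reCLM_apply] at this
    rw [hG]; simp only; rw [← this]; unfold Rr
    exact intervalIntegral.integral_congr fun t _ => hqρ t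
  have Rc := Rr_cont hρ
  have h0 : (h : ℂ) ≠ 0 := by exact_mod_cast hh.ne'
  have ftc : ∫ t in s..m, exp (-(G t) / h) * g t / h = exp (-(G m) / h) * w m - exp (-(G s) / h) * w s := by
    refine intervalIntegral.integral_eq_sub_of_hasDerivAt (f := fun t => exp (-(G t) / h) * w t)
      (fun t ht => ?_) (Continuous.intervalIntegrable (by fun_prop) _ _)
    rw [Set.uIcc_of_le hsm] at ht
    obtain ⟨d, hd, he⟩ := hw t ⟨hs.trans ht.1, ht.2.trans hm⟩
    have k := (((Gd t).neg.div_const (h : ℂ)).cexp).mul hd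
    refine k.congr_deriv ?_
    rw [← he]; simp only [Pi.neg_apply]; field_simp; ring
  refine ⟨exp ((G s - G m) / h) * w m, exp (G s / h) * ∫ t in s..m, exp (-(G t) / h) * g t / h, ?_, ?_, ?_⟩
  · rw [ftc, mul_sub, ← mul_assoc, ← mul_assoc, ← Complex.exp_add, ← Complex.exp_add]
    rw [show G s / h + -(G m) / h = (G s - G m) / h by ring, show G s / h + -(G s) / h = 0 by ring]
    simp
  · rw [norm_mul, Complex.norm_exp]
    congr 2
    rw [← Gre, ← Gre, Complex.div_ofReal_re, Complex.sub_re]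
  · rw [norm_mul, Complex.norm_exp, Complex.div_ofReal_re, Gre, mul_pow]
    have n1 : ‖∫ t in s..m, exp (-(G t) / h) * g t / h‖ ≤
        ∫ t in s..m, (Real.exp (-(Rr ρ t / h))) * (‖g t‖ / h) := by
      refine (intervalIntegral.norm_integral_le_integral_norm hsm).trans (le_of_eq ?_)
      refine intervalIntegral.integral_congr fun t _ => ?_
      rw [norm_div, norm_mul, Complex.norm_exp, Complex.div_ofReal_re, Complex.neg_re, Gre,
        Complex.norm_real, Real.norm_of_nonneg hh.le, neg_div]
      ring
    have n2 := cs_int (f := fun t => Real.exp (-(Rr ρ t / h))) (g := fun t => ‖g t‖ / h)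
      (by fun_prop) (by fun_prop) hsm
    have n3 := (pow_le_pow_left₀ (norm_nonneg _) n1 2).trans n2
    have e1 : ∫ t in s..m, Real.exp (-(Rr ρ t / h)) ^ 2 ≤ ∫ t in s..M, Real.exp (-(2 * Rr ρ t / h)) := by
      have : ∀ t, Real.exp (-(Rr ρ t / h)) ^ 2 = Real.exp (-(2 * Rr ρ t / h)) := fun t => by
        rw [← Real.exp_nat_mul]; congr 1; push_cast; ring
      simp only [this]
      exact intervalIntegral.integral_mono_interval le_rfl hsm hm
        (Filter.Eventually.of_forall fun t => (Real.exp_pos _).le)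
        (Continuous.intervalIntegrable (by fun_prop) _ _)
    have e2 : ∫ t in s..m, (‖g t‖ / h) ^ 2 ≤ (∫ t in (-M)..M, ‖g t‖ ^ 2) / h ^ 2 := by
      simp only [div_pow]
      rw [intervalIntegral.integral_div]
      gcongr
      exact intervalIntegral.integral_mono_interval hs hsm hm
        (Filter.Eventually.of_forall fun t => by positivity)
        (Continuous.intervalIntegrable (by fun_prop) _ _)
    have e0 : 0 ≤ ∫ t in s..m, (‖g t‖ / h) ^ 2 :=
      intervalIntegral.integral_nonneg hsm fun t _ => by positivity
    have e3 : 0 ≤ ∫ t in s..M, Real.exp (-(2 * Rr ρ t / h)) :=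
      intervalIntegral.integral_nonneg (hsm.trans hm) fun t _ => (Real.exp_pos _).le
    have e4 : Real.exp (Rr ρ s / h) ^ 2 = Real.exp (2 * Rr ρ s / h) := by
      rw [← Real.exp_nat_mul]; congr 1; push_cast; ring
    rw [e4]
    calc _ ≤ Real.exp (2 * Rr ρ s / h) * ((∫ t in s..M, Real.exp (-(2 * Rr ρ t / h))) *
        ((∫ t in (-M)..M, ‖g t‖ ^ 2) / h ^ 2)) := by
          gcongr
          exact n3.trans (mul_le_mul e1 e2 e0 e3)
      _ = _ := by ring


/-- the exponent -/
noncomputable def Ph (y : ℝ) : ℝ := -∫ s in (-1:ℝ)..1, 3 / y * (cr (y * (s ^ 2 - 1))).im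

/-- the target resolvent norm -/
noncomputable def Aa (h y : ℝ) : ℝ := √(Real.pi / (2 * h)) * Real.exp (Ph y / h)

lemma tail_bd (v : 𝓢(ℝ, ℂ)) {L : ℝ} (hL : 0 < L) :
    nrm v ^ 2 ≤ (∫ s in (-L)..L, ‖v s‖ ^ 2) + nrm (XX v) ^ 2 / L ^ 2 := by
  rw [nrm_sq, nrm_sq, intervalIntegral.integral_of_le (by linarith), ← integral_indicator measurableSet_Ioc,
    ← integral_div, ← integral_add ((sq_integrable v).indicator measurableSet_Ioc)
      ((sq_integrable _).div_const _)]
  refine integral_mono (sq_integrable v) (((sq_integrable v).indicator measurableSet_Ioc).add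
      ((sq_integrable _).div_const _)) fun x => ?_
  simp only [XX_apply, norm_mul, Complex.norm_real, Real.norm_eq_abs, mul_pow, sq_abs]
  by_cases hx : x ∈ Set.Ioc (-L) L
  · rw [Set.indicator_of_mem hx]
    have : 0 ≤ x ^ 2 * ‖v x‖ ^ 2 / L ^ 2 := by positivity
    linarith
  · rw [Set.indicator_of_notMem hx, zero_add, le_div_iff₀ (by positivity), mul_comm]
    gcongr ?_ * _
    rw [Set.mem_Ioc, not_and_or, not_lt, not_le] at hx
    rcases hx with hx | hx <;> nlinarith

/-- package of the Riccati solution in the form used below -/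
lemma setup (M : ℝ) (hM : 1 ≤ M) : ∃ C : ℝ, 0 < C ∧ ∃ y0 : ℝ, 0 < y0 ∧ y0 ≤ 1 ∧ C * y0 ≤ 1 ∧
    ∀ h y : ℝ, 0 < h → h ≤ 1 → 0 < y → y ≤ y0 → ∃ ω : ℝ → ℂ, ContDiff ℝ (⊤ : ℕ∞) ω ∧
      (∀ s, ‖ω s - 1‖ ≤ C * y) ∧ (∀ s, ‖deriv ω s‖ ≤ C * y) ∧
      (∀ s ∈ Set.Icc (-M) M, ω s ^ 3 - 3 * I * ((y * h / 3 : ℝ) : ℂ) * ω s * deriv ω s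
        - ((y * h / 3 : ℝ) : ℂ) ^ 2 * deriv (deriv ω) s = 1 + I * ((y * (s ^ 2 - 1) : ℝ) : ℂ)) ∧
      RhoHyp M h (C * y) (fun s => 3 / y * (ω s).im) ∧
      |Rr (fun s => 3 / y * (ω s).im) 1 + Ph y| ≤ 2 * C * y * h ∧ 0 ≤ Ph y := by
  obtain ⟨C, hC, y0, hy0, hy1, H⟩ := pack M hM
  refine ⟨C, hC, min y0 (1 / C), by positivity, (min_le_left _ _).trans hy1, ?_, ?_⟩
  · calc C * min y0 (1 / C) ≤ C * (1 / C) := by gcongr; exact min_le_right _ _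
      _ = 1 := by field_simp
  intro h y hh hh1 hy hyy
  obtain ⟨ω, w1, w2, w3, w4, w5, w6⟩ := H h y hh hh1 hy (hyy.trans (min_le_left _ _))
  have hCy : C * y ≤ 1 := by
    calc C * y ≤ C * (1 / C) := by gcongr; exact hyy.trans (min_le_right _ _)
      _ = 1 := by field_simp
  have cω := w1.continuous
  have ccr : Continuous fun s : ℝ => cr (y * (s ^ 2 - 1)) :=
    (cr_contDiff (g := fun s : ℝ => y * (s ^ 2 - 1)) (by fun_prop)).continuous
  have cim : Continuous fun s : ℝ => 3 / y * (cr (y * (s ^ 2 - 1))).im :=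
    (Complex.continuous_im.comp ccr).const_mul _ |>.congr fun _ => rfl
  have cρ : Continuous fun s : ℝ => 3 / y * (ω s).im := by fun_prop
  have sub : ∀ s ∈ Set.Icc (-1:ℝ) 1, s ∈ Set.Icc (-M) M := fun s hs =>
    ⟨by linarith [hs.1], by linarith [hs.2]⟩
  refine ⟨ω, w1, w2, w3, w4, ⟨cρ, fun s hs => ?_⟩, ?_, ?_⟩
  · have a1 := w5 s hs
    have a2 := w6 s hs
    have := abs_add_le (3 / y * (ω s).im - 3 / y * (cr (y * (s ^ 2 - 1))).im)
      (3 / y * (cr (y * (s ^ 2 - 1))).im - (s ^ 2 - 1))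
    rw [sub_add_sub_cancel] at this
    linarith
  · unfold Rr Ph
    rw [← sub_eq_add_neg, ← intervalIntegral.integral_sub (cρ.intervalIntegrable _ _)
      (cim.intervalIntegrable _ _)]
    have := intervalIntegral.norm_integral_le_of_norm_le_const (a := (-1:ℝ)) (b := 1)
      (f := fun s : ℝ => 3 / y * (ω s).im - 3 / y * (cr (y * (s ^ 2 - 1))).im) (C := C * y * h)
      (fun s hs => by
        rw [Set.uIoc_of_le (by norm_num)] at hs
        exact w5 s (sub s ⟨hs.1.le, hs.2⟩))
    rw [Real.norm_eq_abs] at this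
    refine this.trans (le_of_eq ?_)
    norm_num; ring
  · unfold Ph
    rw [← intervalIntegral.integral_neg]
    refine intervalIntegral.integral_nonneg (by norm_num) fun s hs => ?_
    have a2 := (abs_le.1 (w6 s (sub s hs))).2
    have : s ^ 2 - 1 ≤ 0 := by nlinarith [hs.1, hs.2]
    rw [abs_of_nonpos this] at a2
    nlinarith

lemma q_re (y : ℝ) (z : ℂ) : (3 / (I * (y : ℂ)) * (z - 1)).re = 3 / y * z.im := by
  have e3 : 3 / (I * (y : ℂ)) = -((3 / y : ℝ) : ℂ) * I := by
    rw [div_mul_eq_div_div_swap, div_I]; push_cast; ring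
  rw [e3, neg_mul, neg_mul, Complex.neg_re, mul_assoc, Complex.re_ofReal_mul]; simp

lemma Aa_ge_one {h y : ℝ} (hh : 0 < h) (hh1 : h ≤ 1) (hP : 0 ≤ Ph y) : 1 ≤ Aa h y := by
  unfold Aa
  have h1 : 1 ≤ √(Real.pi / (2 * h)) := by
    rw [Real.one_le_sqrt, le_div_iff₀ (by positivity)]
    linarith [Real.pi_gt_three]
  have h2 : 1 ≤ Real.exp (Ph y / h) := Real.one_le_exp (by positivity)
  nlinarith

lemma R_gap {M : ℝ} (hM : 4 ≤ M) {R : ℝ → ℝ}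
    (hR : ∀ s ∈ Set.Icc (-M) M, |R s + (s + 1) ^ 2 * (2 - s) / 3| ≤ 1 / 20) {s m : ℝ}
    (hs : s ∈ Set.Icc (-(M - 2)) (M - 2)) (hm : m ∈ Set.Icc (M - 1) M) : R s - R m ≤ -1 := by
  have a1 := (abs_le.1 (hR s ⟨by linarith [hs.1], by linarith [hs.2]⟩)).2
  have a2 := (abs_le.1 (hR m ⟨by linarith [hm.1], by linarith [hm.2]⟩)).1
  have m3 : 3 ≤ m := by linarith [hm.1]
  have sm : s + 1 ≤ m := by linarith [hm.1, hs.2]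
  rcases le_total s 2 with h | h
  · have b1 : 0 ≤ (s + 1) ^ 2 * (2 - s) := mul_nonneg (sq_nonneg _) (by linarith)
    have b2 : (m + 1) ^ 2 * (m - 2) ≥ 16 := by nlinarith [sq_nonneg (m - 3)]
    linarith
  · obtain ⟨d, hd⟩ : ∃ d, m = s + 1 + d := ⟨m - s - 1, by ring⟩
    have d0 : 0 ≤ d := by linarith
    have e : (m + 1) ^ 2 * (m - 2) - (s + 1) ^ 2 * (s - 2) ≥ 6 := by
      rw [hd]
      have : (s + 1 + d + 1) ^ 2 * (s + 1 + d - 2) ≥ (s + 2) ^ 2 * (s - 1) := by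
        apply mul_le_mul <;> nlinarith
      nlinarith
    linarith


lemma young3 {e : ℝ} (he : 0 < e) {a b c d : ℝ} (h0 : 0 ≤ d) (h : d ≤ a + (b + c)) :
    d ^ 2 ≤ (1 + e) * a ^ 2 + 2 * (1 + 1 / e) * (b ^ 2 + c ^ 2) := by
  have h1 : d ^ 2 ≤ (a + (b + c)) ^ 2 := pow_le_pow_left₀ h0 h 2
  have h2 : (a + (b + c)) ^ 2 ≤ (1 + e) * a ^ 2 + (1 + 1 / e) * (b + c) ^ 2 := by
    have e1 : (1 + e) * a ^ 2 + (1 + 1 / e) * (b + c) ^ 2 - (a + (b + c)) ^ 2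
      = (e * a - (b + c)) ^ 2 / e := by field_simp; ring
    have : 0 ≤ (e * a - (b + c)) ^ 2 / e := by positivity
    linarith
  have h3 : (1 + 1 / e) * (b + c) ^ 2 ≤ (1 + 1 / e) * (2 * (b ^ 2 + c ^ 2)) := by
    gcongr; nlinarith [sq_nonneg (b - c)]
  linarith

lemma exists_small {w : ℝ → ℂ} (hw : Continuous w) (a : ℝ) :
    ∃ m ∈ Set.Icc a (a + 1), ‖w m‖ ^ 2 ≤ ∫ s in a..(a + 1), ‖w s‖ ^ 2 := by
  obtain ⟨m, hm, H⟩ := isCompact_Icc.exists_isMinOn (Set.nonempty_Icc.2 (by linarith : a ≤ a + 1))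
    (f := fun s => ‖w s‖ ^ 2) (by fun_prop)
  refine ⟨m, hm, ?_⟩
  have := intervalIntegral.integral_mono_on (μ := volume) (a := a) (b := a + 1) (f := fun _ => ‖w m‖ ^ 2)
    (g := fun s => ‖w s‖ ^ 2) (by linarith) intervalIntegrable_const
    (Continuous.intervalIntegrable (by fun_prop) _ _) fun s hs => H hs
  simpa using this

set_option maxHeartbeats 4000000 in
lemma upper (ε : ℝ) (hε : 0 < ε) : ∃ δ : ℝ, 0 < δ ∧ ∀ h y : ℝ, 0 < h → h ≤ δ → 0 < y → y ≤ δ →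
    ∀ v : 𝓢(ℝ, ℂ), nrm v ≤ (1 + ε) * Aa h y * nrm (Tq h y v) := by
  obtain ⟨e, he⟩ : ∃ e, e = min ε 1 / 20 := ⟨_, rfl⟩
  have e0 : 0 < e := by rw [he]; positivity
  have e1 : 20 * e ≤ ε := by rw [he]; linarith [min_le_left ε 1]
  have e2 : e ≤ 1 / 20 := by rw [he]; linarith [min_le_right ε 1]
  obtain ⟨M, hMdef⟩ : ∃ M, M = 4 + 2 / e := ⟨_, rfl⟩
  have hM : 4 ≤ M := by rw [hMdef]; have : 0 < 2 / e := by positivity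
                        linarith
  have hM2 : 2 / (M - 2) ^ 2 ≤ e := by
    have : M - 2 = 2 + 2 / e := by rw [hMdef]; ring
    rw [this, div_le_iff₀ (by positivity)]
    have : e * (2 + 2 / e) ^ 2 = 4 * e + 8 + 4 / e := by field_simp; ring
    rw [this]
    have : 0 < 4 / e := by positivity
    linarith
  obtain ⟨C, hC, y0, hy0, hy01, hCy0, S⟩ := setup M (by linarith)
  obtain ⟨η, hη, hη1, Lp⟩ := laplace M e hM e0
  obtain ⟨B, hB⟩ : ∃ B, B = 2163 * (2 * C + 2) ^ 2 := ⟨_, rfl⟩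
  have B0 : 0 < B := by rw [hB]; positivity
  obtain ⟨D, hD⟩ : ∃ D, D = 2 * (1 + 1 / e) * ((M - 2) * (2 + 8 * B) + 4 * B) := ⟨_, rfl⟩
  have hM0 : 0 < M - 2 := by linarith
  have D0 : 0 < D := by rw [hD]; positivity
  have l0 : 0 < Real.log (1 + e) := Real.log_pos (by linarith)
  refine ⟨min (min (min y0 η) (η / C)) (min (Real.log (1 + e) / (4 * C)) (e / D)), by positivity, ?_⟩
  intro h y hh hhd hy hyd v
  simp only [le_min_iff] at hhd hyd
  obtain ⟨⟨⟨hd1, hd2⟩, hd3⟩, hd4, hd5⟩ := hhd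
  obtain ⟨⟨⟨yd1, yd2⟩, yd3⟩, yd4, yd5⟩ := hyd
  have hh1 : h ≤ 1 := by linarith
  have hy1 : y ≤ 1 := by linarith
  have hCy : C * y ≤ 1 := (mul_le_mul_of_nonneg_left yd1 hC.le).trans hCy0
  obtain ⟨ω, w1, w2, w3, w4, w5, w6, hP⟩ := S h y hh hh1 hy yd1
  have hA := Aa_ge_one hh hh1 hP
  have n0 := nrm_nonneg v
  have f0 := nrm_nonneg (Tq h y v)
  by_cases hfn : nrm v ≤ nrm (Tq h y v)
  · have : 1 ≤ (1 + ε) * Aa h y := by clear * - hA hε; nlinarith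
    clear * - this hfn f0; nlinarith
  push Not at hfn
  obtain ⟨l1, -, -, l4⟩ := Lp h (C * y) _ hh hd2 (by positivity)
    (by rw [le_div_iff₀ hC] at yd3; linarith) w5
  obtain ⟨ax, -, -⟩ := ap_T h y hh hh1 hy hy1 v
  have L2 : ∀ {a b : ℝ}, a ≤ b → ∫ s in a..b, ‖wR h y ω v s - v s‖ ^ 2 ≤ 4 * B * y * nrm v ^ 2 := by
    intro a b hab
    refine (wR_L2 hh hh1 hy hC hCy hy1 w1 v w2 w3 hab).trans ?_
    rw [← hB]
    have : (nrm v + nrm (Tq h y v)) ^ 2 ≤ 4 * nrm v ^ 2 := by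
      have := pow_le_pow_left₀ (by linarith) (show nrm v + nrm (Tq h y v) ≤ 2 * nrm v by linarith) 2
      rw [mul_pow] at this; linarith
    have y2 : y ^ 2 ≤ y := by rw [sq]; exact mul_le_of_le_one_left hy.le hy1
    calc B * y ^ 2 * (nrm v + nrm (Tq h y v)) ^ 2 ≤ B * y * (4 * nrm v ^ 2) := by gcongr
      _ = _ := by ring
  set ρ : ℝ → ℝ := fun s => 3 / y * (ω s).im with hρ
  have cρ : Continuous ρ := w5.1
  have Rc := Rr_cont cρ
  have cw := wR_cont (h := h) (y := y) w1 v
  have cv := v.continuous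
  -- control point
  obtain ⟨m, hm, hmw⟩ := exists_small cw (M - 1)
  rw [sub_add_cancel] at hm hmw
  have hwm : ‖wR h y ω v m‖ ^ 2 ≤ (2 + 8 * B) * nrm v ^ 2 := by
    refine hmw.trans ?_
    have i1 : ∫ s in (M - 1)..M, ‖wR h y ω v s‖ ^ 2 ≤ ∫ s in (M - 1)..M,
        (2 * ‖v s‖ ^ 2 + 2 * ‖wR h y ω v s - v s‖ ^ 2) := by
      refine intervalIntegral.integral_mono_on (by linarith)
        (Continuous.intervalIntegrable (by fun_prop) _ _)
        (Continuous.intervalIntegrable (by fun_prop) _ _) fun s _ => ?_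
      have t := norm_add_le (v s) (wR h y ω v s - v s)
      rw [add_sub_cancel] at t
      have := pow_le_pow_left₀ (norm_nonneg _) t 2
      clear * - this; nlinarith [sq_nonneg (‖v s‖ - ‖wR h y ω v s - v s‖)]
    rw [intervalIntegral.integral_add (Continuous.intervalIntegrable (by fun_prop) _ _)
      (Continuous.intervalIntegrable (by fun_prop) _ _), intervalIntegral.integral_const_mul,
      intervalIntegral.integral_const_mul] at i1
    have i2 := int_le_nrm v (show M - 1 ≤ M by linarith)
    have i3 := L2 (show M - 1 ≤ M by linarith)
    have i4 : 4 * B * y * nrm v ^ 2 ≤ 4 * B * nrm v ^ 2 := by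
      exact mul_le_mul_of_nonneg_right (mul_le_of_le_one_right (by positivity) hy1) (sq_nonneg _)
    linarith
  -- pointwise bound
  have F2 := int_le_nrm (Tq h y v) (show -M ≤ M by linarith)
  set f := nrm (Tq h y v) with hf
  set n := nrm v with hn
  set J : ℝ → ℝ := fun s => Real.exp (2 * Rr ρ s / h) * ∫ t in s..M, Real.exp (-(2 * Rr ρ t / h)) with hJ
  have cJ : Continuous J := by
    have : Continuous fun s => ∫ t in s..M, Real.exp (-(2 * Rr ρ t / h)) := by
      have c : Continuous fun t => Real.exp (-(2 * Rr ρ t / h)) := by fun_prop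
      have : (fun s => ∫ t in s..M, Real.exp (-(2 * Rr ρ t / h)))
        = fun s => -∫ t in M..s, Real.exp (-(2 * Rr ρ t / h)) :=
          funext fun s => intervalIntegral.integral_symm _ _
      rw [this]
      exact (intervalIntegral.continuous_primitive (fun a b => c.intervalIntegrable a b) M).neg
    rw [hJ]; fun_prop
  have pt : ∀ s ∈ Set.Icc (-(M - 2)) (M - 2), ‖v s‖ ^ 2 ≤ (1 + e) * (f ^ 2 / h ^ 2 * J s)
      + 2 * (1 + 1 / e) * (h / 2 * ((2 + 8 * B) * n ^ 2) + ‖wR h y ω v s - v s‖ ^ 2) := by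
    intro s hs
    obtain ⟨X, Y, x1, x2, x3⟩ := core_step (M := M) (h := h) hh
      (q := fun s => 3 / (I * (y : ℂ)) * (ω s - 1)) (ρ := ρ)
      (by have := w1.continuous; fun_prop) cρ (fun s => q_re y (ω s))
      (w := wR h y ω v) (g := Tq h y v) (Tq h y v).continuous
      (fun s hs => wR_deriv h y hy ω w1 v s (w4 s hs))
      (s := s) (m := m) (by linarith [hs.1]) (by linarith [hs.2, hm.1]) hm.2
    have t : ‖v s‖ ≤ ‖Y‖ + (‖X‖ + ‖wR h y ω v s - v s‖) := by
      have : v s = -Y + (X - (wR h y ω v s - v s)) := by rw [x1]; ring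
      calc ‖v s‖ = ‖-Y + (X - (wR h y ω v s - v s))‖ := by rw [← this]
        _ ≤ ‖-Y‖ + ‖X - (wR h y ω v s - v s)‖ := norm_add_le _ _
        _ ≤ _ := by rw [norm_neg]; gcongr; exact norm_sub_le _ _
    refine (young3 e0 (norm_nonneg _) t).trans ?_
    have jn : 0 ≤ J s := by
      apply mul_nonneg (Real.exp_pos _).le
      exact intervalIntegral.integral_nonneg (by linarith [hs.2]) fun t _ => (Real.exp_pos _).le
    have y2 : ‖Y‖ ^ 2 ≤ f ^ 2 / h ^ 2 * J s := by
      refine x3.trans ?_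
      calc _ ≤ 1 / h ^ 2 * J s * f ^ 2 := mul_le_mul_of_nonneg_left F2 (by positivity)
        _ = _ := by ring
    have x4 : ‖X‖ ^ 2 ≤ h / 2 * ((2 + 8 * B) * n ^ 2) := by
      rw [x2, mul_pow]
      have g := R_gap hM l4 hs hm
      have : Real.exp ((Rr ρ s - Rr ρ m) / h) ^ 2 ≤ h / 2 := by
        rw [← Real.exp_nat_mul]
        calc Real.exp (((2 : ℕ) : ℝ) * ((Rr ρ s - Rr ρ m) / h)) ≤ Real.exp (-(2 / h)) := by
              rw [Real.exp_le_exp]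
              push_cast
              rw [← neg_div, ← mul_div_assoc]
              gcongr; linarith
          _ ≤ 1 / (2 / h) := exp_neg_le_inv _ (by positivity)
          _ = h / 2 := by rw [one_div_div]
      exact mul_le_mul this hwm (by positivity) (by positivity)
    gcongr
  have I1 : ∫ s in (-(M - 2))..(M - 2), ‖v s‖ ^ 2 ≤ (1 + e) * (f ^ 2 / h ^ 2 *
        ∫ s in (-(M - 2))..(M - 2), J s)
      + 2 * (1 + 1 / e) * (2 * (M - 2) * (h / 2 * ((2 + 8 * B) * n ^ 2)) + 4 * B * y * n ^ 2) := by
    have i1 := intervalIntegral.integral_mono_on (μ := volume) (show -(M - 2) ≤ M - 2 by linarith)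
        (Continuous.intervalIntegrable (by fun_prop) _ _)
        (Continuous.intervalIntegrable (by fun_prop) _ _) pt
    refine i1.trans ?_
    rw [intervalIntegral.integral_add (Continuous.intervalIntegrable (by fun_prop) _ _)
      (Continuous.intervalIntegrable (by fun_prop) _ _), intervalIntegral.integral_const_mul,
      intervalIntegral.integral_const_mul, intervalIntegral.integral_const_mul,
      intervalIntegral.integral_add (Continuous.intervalIntegrable (by fun_prop) _ _)
      (Continuous.intervalIntegrable (by fun_prop) _ _), intervalIntegral.integral_const, smul_eq_mul]
    have := L2 (show -(M - 2) ≤ M - 2 by linarith)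
    gcongr
    linarith
  have tl := tail_bd v hM0
  have tl2 : nrm (XX v) ^ 2 / (M - 2) ^ 2 ≤ e * n ^ 2 := by
    have : nrm (XX v) ^ 2 ≤ 2 * n ^ 2 := by nlinarith
    calc nrm (XX v) ^ 2 / (M - 2) ^ 2 ≤ 2 * n ^ 2 / (M - 2) ^ 2 := by gcongr
      _ = 2 / (M - 2) ^ 2 * n ^ 2 := by ring
      _ ≤ _ := by gcongr
  have sm : 2 * (1 + 1 / e) * (2 * (M - 2) * (h / 2 * ((2 + 8 * B) * n ^ 2)) + 4 * B * y * n ^ 2)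
      ≤ e * n ^ 2 := by
    calc _ = 2 * (1 + 1 / e) * ((M - 2) * (2 + 8 * B) * h + 4 * B * y) * n ^ 2 := by ring
      _ ≤ 2 * (1 + 1 / e) * ((M - 2) * (2 + 8 * B) * (e / D) + 4 * B * (e / D)) * n ^ 2 := by
          gcongr
      _ = D * (e / D) * n ^ 2 := by rw [hD]; ring
      _ = e * n ^ 2 := by field_simp
  have A2 : Aa h y ^ 2 = Real.pi / (2 * h) * Real.exp (2 * Ph y / h) := by
    unfold Aa
    rw [mul_pow, Real.sq_sqrt (by positivity), ← Real.exp_nat_mul]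
    congr 2; push_cast; ring
  have main : f ^ 2 / h ^ 2 * ∫ s in (-(M - 2))..(M - 2), J s ≤ (1 + e) ^ 2 * Aa h y ^ 2 * f ^ 2 := by
    have ex : Real.exp (-(2 * Rr ρ 1 / h)) ≤ (1 + e) * Real.exp (2 * Ph y / h) := by
      rw [← Real.exp_log (show 0 < 1 + e by linarith), ← Real.exp_add, Real.exp_le_exp]
      have := (abs_le.1 w6).1
      rw [le_div_iff₀ (by positivity)] at yd4
      have : -(2 * Rr ρ 1 / h) ≤ 4 * C * y + 2 * Ph y / h := by
        rw [← neg_div, div_le_iff₀ hh, add_mul, div_mul_cancel₀ _ hh.ne']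
        linarith
      linarith
    calc f ^ 2 / h ^ 2 * ∫ s in (-(M - 2))..(M - 2), J s ≤
        f ^ 2 / h ^ 2 * ((1 + e) * (Real.pi * h / 2) * Real.exp (-(2 * Rr ρ 1 / h))) := by gcongr
      _ ≤ f ^ 2 / h ^ 2 * ((1 + e) * (Real.pi * h / 2) * ((1 + e) * Real.exp (2 * Ph y / h))) := by
          gcongr
      _ = _ := by rw [A2]; field_simp
  have fin : (1 - 2 * e) * n ^ 2 ≤ (1 + e) ^ 3 * (Aa h y * f) ^ 2 := by
    have : (1 + e) * (f ^ 2 / h ^ 2 * ∫ s in (-(M - 2))..(M - 2), J s) ≤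
      (1 + e) * ((1 + e) ^ 2 * Aa h y ^ 2 * f ^ 2) := by gcongr
    have e3 : (1 + e) * ((1 + e) ^ 2 * Aa h y ^ 2 * f ^ 2) = (1 + e) ^ 3 * (Aa h y * f) ^ 2 := by ring
    linarith
  have pol : (1 + e) ^ 3 ≤ (1 - 2 * e) * (1 + 20 * e) ^ 2 := by
    clear * - e0 e2; nlinarith [mul_pos e0 e0, mul_pos e0 (mul_pos e0 e0)]
  have sq : n ^ 2 ≤ ((1 + ε) * Aa h y * f) ^ 2 := by
    have q1 : (1 - 2 * e) * n ^ 2 ≤ (1 - 2 * e) * ((1 + 20 * e) ^ 2 * (Aa h y * f) ^ 2) := by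
      calc _ ≤ _ := fin
        _ ≤ (1 - 2 * e) * (1 + 20 * e) ^ 2 * (Aa h y * f) ^ 2 := by gcongr
        _ = _ := by ring
    have q2 := le_of_mul_le_mul_left q1 (by linarith)
    calc n ^ 2 ≤ _ := q2
      _ ≤ (1 + ε) ^ 2 * (Aa h y * f) ^ 2 := by gcongr
      _ = _ := by ring
  exact le_of_sq_le_sq sq (by positivity)


lemma left_fac {h y : ℝ} (hy : 0 < y) {p p1 p2 : ℝ → ℂ} (hp : ∀ s, HasDerivAt p (p1 s) s)
    (hp1 : ∀ s, HasDerivAt p1 (p2 s) s) (v : 𝓢(ℝ, ℂ)) {g g1 g2 : ℝ → ℂ}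
    (hg : ∀ s, h * DD v s - 3 / (I * y) * (p s - 1) * v s = g s)
    (hg1 : ∀ s, HasDerivAt g (g1 s) s) (hg2 : ∀ s, HasDerivAt g1 (g2 s) s) (s : ℝ)
    (hr : p s ^ 3 + 3 * I * ((y * h / 3 : ℝ) : ℂ) * p s * p1 s
      - ((y * h / 3 : ℝ) : ℂ) ^ 2 * p2 s = 1 + I * ((y * (s ^ 2 - 1) : ℝ) : ℂ)) :
    Tq h y v s = (g s + 2 * I * ((y * h / 3 : ℝ) : ℂ) * g1 s - ((y * h / 3 : ℝ) : ℂ) ^ 2 * g2 s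
      + p s * (g s + I * ((y * h / 3 : ℝ) : ℂ) * g1 s)
      + (p s ^ 2 + 2 * I * ((y * h / 3 : ℝ) : ℂ) * p1 s) * g s) / 3 := by
  set κ : ℂ := 3 / (I * y) with hκ
  have eg : g = fun s => h * DD v s - κ * (p s - 1) * v s := funext fun s => (hg s).symm
  have e1 : ∀ s, g1 s = h * DD (DD v) s - (κ * p1 s * v s + κ * (p s - 1) * DD v s) := by
    intro s
    have := ((sch_hasDeriv (DD v) s).const_mul (h : ℂ)).sub
      ((((hp s).sub_const 1).const_mul κ).mul (sch_hasDeriv v s))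
    refine (hg1 s).unique ?_
    rw [eg]; exact this
  have eg1 : g1 = fun s => h * DD (DD v) s - (κ * p1 s * v s + κ * (p s - 1) * DD v s) := funext e1
  have e2 : g2 s = h * DD (DD (DD v)) s - ((κ * p2 s * v s + κ * p1 s * DD v s)
      + (κ * p1 s * DD v s + κ * (p s - 1) * DD (DD v) s)) := by
    have := ((sch_hasDeriv (DD (DD v)) s).const_mul (h : ℂ)).sub
      ((((hp1 s).const_mul κ).mul (sch_hasDeriv v s)).add
      ((((hp s).sub_const 1).const_mul κ).mul (sch_hasDeriv (DD v) s)))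
    refine (hg2 s).unique ?_
    rw [eg1]; exact this
  rw [Tq_apply, e2, e1, ← hg s]
  have hy' : (y : ℂ) ≠ 0 := by exact_mod_cast hy.ne'
  set σ : ℂ := ((y * h / 3 : ℝ) : ℂ) with hσ
  have hσ' : (h : ℂ) = 3 * σ / y := by rw [hσ]; push_cast; field_simp
  have e3 : κ = -3 * I / y := by
    have := I_sq
    rw [hκ]
    field_simp; linear_combination this
  rw [hσ', e3]
  push_cast at hr
  generalize DD (DD (DD v)) s = V3
  generalize DD (DD v) s = V2
  generalize DD v s = V1
  generalize v s = V0
  generalize p2 s = W2 at *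
  generalize p1 s = W1 at *
  generalize p s = W at *
  field_simp
  linear_combination (-27 * I * V0) * hr + 27 * (-σ * ((2 + W) * (W1 * V0 + (W - 1) * V1)
    + 2 * W1 * (W - 1) * V0) + 3 * V0 * σ * W * W1 - y * V0 * (s ^ 2 - 1)) * I_sq

lemma left_close {h y C : ℝ} (hh : 0 < h) (hh1 : h ≤ 1) (hy : 0 < y) (hC : 0 < C)
    (hCy : C * y ≤ 1) (hy1 : y ≤ 1) {p p1 g g1 g2 : ℂ}
    (h1 : ‖p - 1‖ ≤ C * y) (h2 : ‖p1‖ ≤ C * y) :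
    ‖(g + 2 * I * ((y * h / 3 : ℝ) : ℂ) * g1 - ((y * h / 3 : ℝ) : ℂ) ^ 2 * g2
      + p * (g + I * ((y * h / 3 : ℝ) : ℂ) * g1)
      + (p ^ 2 + 2 * I * ((y * h / 3 : ℝ) : ℂ) * p1) * g) / 3 - g‖ ≤ (2 * C + 2) * y *
      (‖g‖ + h * ‖g1‖ + h ^ 2 * ‖g2‖) := by
  set σ : ℝ := y * h / 3 with hσ
  have σ0 : 0 < σ := by positivity
  have σ1 : σ ≤ 1 / 3 := by rw [hσ]; nlinarith
  have e : (g + 2 * I * (σ : ℂ) * g1 - (σ : ℂ) ^ 2 * g2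
      + p * (g + I * (σ : ℂ) * g1) + (p ^ 2 + 2 * I * (σ : ℂ) * p1) * g) / 3 - g
      = (2 * I * (σ : ℂ) * g1 - (σ : ℂ) ^ 2 * g2
      + (p - 1) * g + (p - 1 + 1) * (I * σ * g1)
      + ((p - 1) * ((p - 1) + 2) + 2 * (I * σ * p1)) * g) / 3 := by
    ring
  have b1 : ‖2 * I * (σ : ℂ) * g1‖ = 2 * σ * ‖g1‖ := by
    simp [abs_of_pos σ0]
  have b2 : ‖(σ : ℂ) ^ 2 * g2‖ = σ ^ 2 * ‖g2‖ := by
    simp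
  have b3 : ‖(p - 1) * g‖ ≤ C * y * ‖g‖ := by rw [norm_mul]; gcongr
  have b4 : ‖(p - 1 + 1) * (I * σ * g1)‖ ≤ 2 * (σ * ‖g1‖) := by
    rw [norm_mul]
    have : ‖I * σ * g1‖ = σ * ‖g1‖ := by simp [abs_of_pos σ0]
    rw [this]; gcongr
    have := norm_add_le (p - 1) 1
    rw [norm_one] at this; linarith
  have b5 : ‖((p - 1) * ((p - 1) + 2) + 2 * (I * σ * p1)) * g‖ ≤ (4 * (C * y)) * ‖g‖ := by
    rw [norm_mul]; gcongr
    have c1 : ‖(p - 1) * ((p - 1) + 2)‖ ≤ C * y * 3 := by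
      rw [norm_mul]; gcongr
      have := norm_add_le (p - 1) 2
      simp only [Complex.norm_ofNat] at this; linarith
    have c2 : ‖I * σ * p1‖ ≤ 1 / 3 * (C * y) := by
      rw [norm_mul]
      have : ‖I * (σ : ℂ)‖ = σ := by simp [abs_of_pos σ0]
      rw [this]; gcongr
    have c3 : ‖2 * (I * σ * p1)‖ = 2 * ‖I * σ * p1‖ := by
      rw [norm_mul, Complex.norm_ofNat]
    have := norm_add_le ((p - 1) * ((p - 1) + 2)) (2 * (I * σ * p1))
    have : 0 ≤ C * y := by positivity
    linarith
  rw [e, norm_div, Complex.norm_ofNat, div_le_iff₀ (by norm_num)]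
  have t1 := norm_add_le (2 * I * (σ : ℂ) * g1 - (σ : ℂ) ^ 2 * g2
      + (p - 1) * g + (p - 1 + 1) * (I * σ * g1))
      (((p - 1) * ((p - 1) + 2) + 2 * (I * σ * p1)) * g)
  have t2 := norm_add_le (2 * I * (σ : ℂ) * g1 - (σ : ℂ) ^ 2 * g2
      + (p - 1) * g) ((p - 1 + 1) * (I * σ * g1))
  have t3 := norm_add_le (2 * I * (σ : ℂ) * g1 - (σ : ℂ) ^ 2 * g2) ((p - 1) * g)
  have t4 := norm_sub_le (2 * I * (σ : ℂ) * g1) ((σ : ℂ) ^ 2 * g2)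
  have n0 := norm_nonneg g
  have n1 := norm_nonneg g1
  have n2 := norm_nonneg g2
  have p0 : 0 ≤ C * y := by positivity
  have q0 : 5 * (C * y) * ‖g‖ ≤ 3 * ((2 * C + 2) * y) * ‖g‖ := by
    apply mul_le_mul_of_nonneg_right _ n0; nlinarith
  have q1 : 4 * σ * ‖g1‖ ≤ 3 * ((2 * C + 2) * y) * (h * ‖g1‖) := by
    have : 4 * σ ≤ 3 * ((2 * C + 2) * y) * h := by
      rw [hσ]; nlinarith [mul_pos hy hh, mul_pos hC (mul_pos hy hh)]
    nlinarith
  have q2 : σ ^ 2 * ‖g2‖ ≤ 3 * ((2 * C + 2) * y) * (h ^ 2 * ‖g2‖) := by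
    have : σ ^ 2 ≤ 3 * ((2 * C + 2) * y) * h ^ 2 := by
      have y2 : y ^ 2 ≤ y := by rw [sq]; exact mul_le_of_le_one_left hy.le hy1
      have : y ^ 2 * h ^ 2 ≤ y * h ^ 2 := by gcongr
      have : 0 < y * h ^ 2 := by positivity
      have : 0 < C * (y * h ^ 2) := by positivity
      rw [hσ]; nlinarith
    nlinarith
  linarith

/-- derivative bounds for an amplitude times an exponential -/
lemma amp_bd {h K : ℝ} (hh : 0 < h) (hh1 : h ≤ 1) (hK : 1 ≤ K) {A0 A1 A2 c0 c1 X : ℂ}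
    (a0 : ‖A0‖ ≤ K) (a1 : ‖A1‖ ≤ K) (a2 : ‖A2‖ ≤ K) (b0 : ‖c0‖ ≤ K) (b1 : ‖c1‖ ≤ K) :
    ‖h * A0 * X‖ + h * ‖(h * A1 + A0 * c0) * X‖
      + h ^ 2 * ‖(h * A2 + 2 * A1 * c0 + A0 * c1 + A0 * c0 ^ 2 / h) * X‖ ≤ 8 * K ^ 3 * (h * ‖X‖) := by
  have hn : ‖(h : ℂ)‖ = h := by simp [abs_of_pos hh]
  have K1 : K ≤ K ^ 2 := by nlinarith
  have K2 : K ^ 2 ≤ K ^ 3 := by nlinarith [sq_nonneg K]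
  have m00 : ‖A0 * c0‖ ≤ K ^ 2 := by rw [norm_mul, sq]; gcongr
  have m10 : ‖A1 * c0‖ ≤ K ^ 2 := by rw [norm_mul, sq]; gcongr
  have m01 : ‖A0 * c1‖ ≤ K ^ 2 := by rw [norm_mul, sq]; gcongr
  have m000 : ‖A0 * c0 ^ 2‖ ≤ K ^ 3 := by
    rw [norm_mul, norm_pow, pow_succ' K 2]; gcongr
  have s1 : ‖h * A1 + A0 * c0‖ ≤ 2 * K ^ 3 := by
    refine (norm_add_le _ _).trans ?_
    rw [norm_mul, hn]
    nlinarith [norm_nonneg A1]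
  have s2 : h ^ 2 * ‖h * A2 + 2 * A1 * c0 + A0 * c1 + A0 * c0 ^ 2 / h‖ ≤ h * (5 * K ^ 3) := by
    have e : h ^ 2 * ‖h * A2 + 2 * A1 * c0 + A0 * c1 + A0 * c0 ^ 2 / h‖ =
      h * ‖h * (h * A2 + 2 * (A1 * c0) + A0 * c1) + A0 * c0 ^ 2‖ := by
      rw [show (h:ℂ) * (h * A2 + 2 * (A1 * c0) + A0 * c1) + A0 * c0 ^ 2 =
        h * (h * A2 + 2 * A1 * c0 + A0 * c1 + A0 * c0 ^ 2 / h) by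
          have : (h : ℂ) ≠ 0 := by exact_mod_cast hh.ne'
          field_simp, norm_mul, hn]
      ring
    rw [e]
    gcongr
    refine (norm_add_le _ _).trans ?_
    rw [norm_mul, hn]
    have u1 : ‖h * A2 + 2 * (A1 * c0) + A0 * c1‖ ≤ 4 * K ^ 3 := by
      refine (norm_add_le _ _).trans ?_
      have u2 := norm_add_le ((h : ℂ) * A2) (2 * (A1 * c0))
      rw [norm_mul, hn, norm_mul (2:ℂ), Complex.norm_ofNat] at u2
      have : h * ‖A2‖ ≤ K := by nlinarith [norm_nonneg A2]
      linarith
    have : h * ‖h * A2 + 2 * (A1 * c0) + A0 * c1‖ ≤ 4 * K ^ 3 := by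
      nlinarith [norm_nonneg ((h:ℂ) * A2 + 2 * (A1 * c0) + A0 * c1)]
    linarith
  rw [norm_mul, norm_mul, norm_mul, norm_mul, hn, ← mul_assoc (h ^ 2)]
  have x0 := norm_nonneg X
  calc h * ‖A0‖ * ‖X‖ + h * (‖h * A1 + A0 * c0‖ * ‖X‖)
      + h ^ 2 * ‖h * A2 + 2 * A1 * c0 + A0 * c1 + A0 * c0 ^ 2 / h‖ * ‖X‖
      ≤ h * K ^ 3 * ‖X‖ + h * (2 * K ^ 3 * ‖X‖) + h * (5 * K ^ 3) * ‖X‖ := by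
        gcongr; linarith
    _ = _ := by ring


lemma int_smooth {E : Type*} [NormedAddCommGroup E] [NormedSpace ℝ E] [CompleteSpace E]
    {f : ℝ → E} (hf : ContDiff ℝ (⊤ : ℕ∞) f) (a : ℝ) :
    ContDiff ℝ (⊤ : ℕ∞) (fun s => ∫ t in a..s, f t) := by
  have hd : ∀ s, HasDerivAt (fun s => ∫ t in a..s, f t) (f s) s := fun s =>
    intervalIntegral.integral_hasDerivAt_right (hf.continuous.intervalIntegrable _ _)
      (hf.continuous.stronglyMeasurableAtFilter _ _) hf.continuous.continuousAt
  rw [contDiff_infty_iff_deriv]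
  refine ⟨fun s => (hd s).differentiableAt, ?_⟩
  rw [show deriv (fun s => ∫ t in a..s, f t) = f from funext fun s => (hd s).deriv]
  exact hf

lemma smooth_deriv {E : Type*} [NormedAddCommGroup E] [NormedSpace ℝ E]
    {f : ℝ → E} (hf : ContDiff ℝ (⊤ : ℕ∞) f) :
    ContDiff ℝ (⊤ : ℕ∞) (deriv f) ∧ ∀ s, HasDerivAt f (deriv f s) s := by
  rw [contDiff_infty_iff_deriv] at hf
  exact ⟨hf.2, fun s => (hf.1 s).hasDerivAt⟩

lemma zero_deriv {f : ℝ → ℝ} {a b : ℝ} (h0 : ∀ s, s ∉ Set.Icc a b → f s = 0) :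
    ∀ s, s ∉ Set.Icc a b → deriv f s = 0 := by
  intro s hs
  have : f =ᶠ[nhds s] fun _ => 0 := by
    filter_upwards [isClosed_Icc.isOpen_compl.mem_nhds (show s ∈ (Set.Icc a b)ᶜ from hs)] with t ht
    exact h0 t ht
  rw [this.deriv_eq]; simp

lemma bdd_of_zero {f : ℝ → ℝ} {a b : ℝ} (hf : Continuous f)
    (h0 : ∀ s, s ∉ Set.Icc a b → f s = 0) : ∃ K : ℝ, 1 ≤ K ∧ ∀ s, |f s| ≤ K := by
  obtain ⟨K, hK⟩ := isCompact_Icc.exists_bound_of_continuousOn (s := Set.Icc a b) hf.continuousOn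
  refine ⟨max K 1, le_max_right _ _, fun s => ?_⟩
  by_cases hs : s ∈ Set.Icc a b
  · exact (hK s hs).trans (le_max_left _ _)
  · rw [h0 s hs, abs_zero]; exact zero_le_one.trans (le_max_right _ _)

lemma bdd3 {f : ℝ → ℝ} {a b : ℝ} (hf : ContDiff ℝ (⊤ : ℕ∞) f)
    (h0 : ∀ s, s ∉ Set.Icc a b → f s = 0) : ∃ K : ℝ, 1 ≤ K ∧ ∀ s, |f s| ≤ K ∧ |deriv f s| ≤ K ∧
      |deriv (deriv f) s| ≤ K := by
  have h1 := zero_deriv h0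
  have h2 := zero_deriv h1
  have s1 := (smooth_deriv hf).1
  have s2 := (smooth_deriv s1).1
  obtain ⟨K0, k0, b0⟩ := bdd_of_zero hf.continuous h0
  obtain ⟨K1, k1, b1⟩ := bdd_of_zero s1.continuous h1
  obtain ⟨K2, k2, b2⟩ := bdd_of_zero s2.continuous h2
  refine ⟨K0 + K1 + K2, by linarith, fun s => ⟨?_, ?_, ?_⟩⟩
  · linarith [b0 s]
  · linarith [b1 s]
  · linarith [b2 s]

lemma bump_one : ∃ χ : ℝ → ℝ, ContDiff ℝ (⊤ : ℕ∞) χ ∧ (∀ s, 0 ≤ χ s) ∧ (∀ s, χ s ≤ 1) ∧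
    (∀ s ∈ Set.Icc (1/2:ℝ) (3/2), χ s = 1) ∧ (∀ s, s ∉ Set.Icc (1/4:ℝ) (7/4) → χ s = 0) := by
  let f : ContDiffBump (1:ℝ) := ⟨1/2, 3/4, by norm_num, by norm_num⟩
  refine ⟨f, f.contDiff, fun s => f.nonneg, fun s => f.le_one, fun s hs => ?_, fun s hs => ?_⟩
  · apply f.one_of_mem_closedBall
    rw [Real.closedBall_eq_Icc]
    constructor <;> simp only [f] <;> linarith [hs.1, hs.2]
  · apply f.zero_of_le_dist
    simp only [f, Real.dist_eq]
    by_contra! hc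
    rw [abs_lt] at hc
    exact hs ⟨by linarith [hc.1], by linarith [hc.2]⟩

lemma bump_two : ∃ χ : ℝ → ℝ, ContDiff ℝ (⊤ : ℕ∞) χ ∧ 
    (∀ s, s ≤ -3 → χ s = 0) ∧ (∀ s, -5/2 ≤ s → χ s = 1) := by
  refine ⟨fun s => Real.smoothTransition (2 * s + 6), ?_, fun s hs => ?_, fun s hs => ?_⟩
  · exact Real.smoothTransition.contDiff.comp (by fun_prop)
  · exact Real.smoothTransition.zero_of_nonpos (by linarith)
  · exact Real.smoothTransition.one_of_one_le (by linarith)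

lemma amp_deriv {h : ℝ} (hh : 0 < h) {X c0 c1 A0 A1 A2 : ℝ → ℂ}
    (hX : ∀ s, HasDerivAt X (c0 s / h * X s) s) (hc : ∀ s, HasDerivAt c0 (c1 s) s)
    (h0 : ∀ s, HasDerivAt A0 (A1 s) s) (h1 : ∀ s, HasDerivAt A1 (A2 s) s) :
    (∀ s, HasDerivAt (fun s => h * A0 s * X s) ((h * A1 s + A0 s * c0 s) * X s) s) ∧
    (∀ s, HasDerivAt (fun s => (h * A1 s + A0 s * c0 s) * X s)
      ((h * A2 s + 2 * A1 s * c0 s + A0 s * c1 s + A0 s * c0 s ^ 2 / h) * X s) s) := by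
  have hh' : (h : ℂ) ≠ 0 := by exact_mod_cast hh.ne'
  constructor <;> intro s
  · refine HasDerivAt.congr_deriv (((h0 s).const_mul (h : ℂ)).mul (hX s)) ?_
    field_simp
  · refine HasDerivAt.congr_deriv
      ((((h1 s).const_mul (h : ℂ)).add ((h0 s).mul (hc s))).mul (hX s)) ?_
    simp only [Pi.add_apply, Pi.mul_apply]
    field_simp; ring

lemma quasi {C K h y : ℝ} (hC : 0 < C) (hK : 1 ≤ K) (hKC : 3 * C ≤ K) (hh : 0 < h) (hh1 : h ≤ 1)
    (hy : 0 < y) (hy1 : y ≤ 1) (hCy : C * y ≤ 1)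
    {p p1 p2 : ℝ → ℂ} (sp : ContDiff ℝ (⊤ : ℕ∞) p) (hp : ∀ s, HasDerivAt p (p1 s) s)
    (hp1 : ∀ s, HasDerivAt p1 (p2 s) s)
    (b0 : ∀ s, ‖p s - 1‖ ≤ C * y) (b1 : ∀ s, ‖p1 s‖ ≤ C * y)
    (hr : ∀ s ∈ Set.Icc (-4:ℝ) 4, p s ^ 3 + 3 * I * ((y * h / 3 : ℝ) : ℂ) * p s * p1 s
      - ((y * h / 3 : ℝ) : ℂ) ^ 2 * p2 s = 1 + I * ((y * (s ^ 2 - 1) : ℝ) : ℂ))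
    {χ χ2 : ℝ → ℝ} (s1 : ContDiff ℝ (⊤ : ℕ∞) χ) (s2 : ContDiff ℝ (⊤ : ℕ∞) χ2)
    (χ0 : ∀ s, 0 ≤ χ s) (χz : ∀ s, s ∉ Set.Icc (1/4:ℝ) (7/4) → χ s = 0)
    (χ2a : ∀ s, s ≤ -3 → χ2 s = 0) (χ2b : ∀ s, -5/2 ≤ s → χ2 s = 1)
    (k1 : ∀ s, |χ s| ≤ K ∧ |deriv χ s| ≤ K ∧ |deriv (deriv χ) s| ≤ K)
    (k2 : ∀ s, |deriv χ2 s| ≤ K ∧ |deriv (deriv χ2) s| ≤ K ∧ |deriv (deriv (deriv χ2)) s| ≤ K)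
    {R : ℝ → ℝ} (hR : R = Rr (fun s => 3 / y * (p s).im)) {J : ℝ} 
    (hJ : J = ∫ s in (1/4:ℝ)..(7/4), χ s * Real.exp (-(2 * R s / h))) (J0 : 0 ≤ J) :
    ∃ v : 𝓢(ℝ, ℂ), (∀ s ∈ Set.Icc (-5/4:ℝ) (-3/4), ‖v s‖ ^ 2 = J ^ 2 * Real.exp (2 * R s / h)) ∧
      ∀ s, ‖Tq h y v s‖ ≤ h * χ s * Real.exp (-(R s / h)) +
        ((Set.Icc (1/4:ℝ) (7/4)).indicator
          (fun s => (8 * K ^ 3 * (2 * C + 2) + K) * (y * h) * Real.exp (-(R s / h))) s +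
        (Set.Icc (-3:ℝ) (-5/2)).indicator
          (fun s => (8 * K ^ 3 * (2 * C + 2) + K) * (h * J) * Real.exp (R s / h)) s) := by
  have hhC : (h : ℂ) ≠ 0 := by exact_mod_cast hh.ne'
  set κ : ℂ := 3 / (I * y) with hκ
  have nκ : ‖κ‖ = 3 / y := by rw [hκ]; simp [abs_of_pos hy]
  set q : ℝ → ℂ := fun s => κ * (p s - 1) with hq
  have sq : ContDiff ℝ (⊤ : ℕ∞) q := contDiff_const.mul (sp.sub contDiff_const)
  have dq : ∀ s, HasDerivAt q (κ * p1 s) s := fun s => ((hp s).sub_const 1).const_mul κ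
  have nq : ∀ s, ‖q s‖ ≤ K := by
    intro s
    rw [hq]; simp only; rw [norm_mul, nκ]
    calc 3 / y * ‖p s - 1‖ ≤ 3 / y * (C * y) := by gcongr; exact b0 s
      _ = 3 * C := by field_simp
      _ ≤ K := hKC
  have nq1 : ∀ s, ‖κ * p1 s‖ ≤ K := by
    intro s
    rw [norm_mul, nκ]
    calc 3 / y * ‖p1 s‖ ≤ 3 / y * (C * y) := by gcongr; exact b1 s
      _ = 3 * C := by field_simp
      _ ≤ K := hKC
  set G : ℝ → ℂ := fun s => ∫ t in (-1:ℝ)..s, q t with hG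
  have sG : ContDiff ℝ (⊤ : ℕ∞) G := int_smooth sq (-1)
  have dG : ∀ s, HasDerivAt G (q s) s := fun s =>
    intervalIntegral.integral_hasDerivAt_right (sq.continuous.intervalIntegrable _ _)
      (sq.continuous.stronglyMeasurableAtFilter _ _) sq.continuous.continuousAt
  have reG : ∀ s, (G s).re = R s := by
    intro s
    rw [hR, hG]
    simp only [Rr]
    have := Complex.reCLM.intervalIntegral_comp_comm (sq.continuous.intervalIntegrable (-1) s) (μ := volume)
    simp only [Complex.reCLM_apply] at this
    rw [← this]
    apply intervalIntegral.integral_congr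
    intro t _
    exact q_re y (p t)
  have cR : R = fun s => (G s).re := funext fun s => (reG s).symm
  have sR : ContDiff ℝ (⊤ : ℕ∞) R := by
    rw [cR]; exact Complex.reCLM.contDiff.comp sG
  set X1 : ℝ → ℂ := fun s => Complex.exp (-(starRingEnd ℂ) (G s) / h) with hX1
  set X2 : ℝ → ℂ := fun s => Complex.exp (G s / h) * J with hX2
  have dX1 : ∀ s, HasDerivAt X1 (-(starRingEnd ℂ) (q s) / h * X1 s) s := by
    intro s
    have := (((dG s).star.neg).div_const (h : ℂ)).cexp
    refine this.congr_deriv ?_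
    rw [mul_comm]; rfl
  have dX2 : ∀ s, HasDerivAt X2 (q s / h * X2 s) s := by
    intro s
    have := (((dG s).div_const (h : ℂ)).cexp).mul_const (J : ℂ)
    refine this.congr_deriv ?_
    rw [hX2]; simp only; ring
  have nX1 : ∀ s, ‖X1 s‖ = Real.exp (-(R s / h)) := by
    intro s
    rw [hX1]; simp only
    rw [Complex.norm_exp, ← reG s]
    congr 1
    rw [Complex.div_ofReal_re]
    simp; ring
  have nE : ∀ s, ‖Complex.exp (G s / h)‖ = Real.exp (R s / h) := by
    intro s
    rw [Complex.norm_exp, ← reG s, Complex.div_ofReal_re]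
  have nX2 : ∀ s, ‖X2 s‖ = J * Real.exp (R s / h) := by
    intro s
    rw [hX2]; simp only
    rw [norm_mul, nE, Complex.norm_real, Real.norm_eq_abs, abs_of_nonneg J0, mul_comm]
  -- the cut off integral
  set F : ℝ → ℝ := fun s => χ s * Real.exp (-(2 * R s / h)) with hF
  have sF : ContDiff ℝ (⊤ : ℕ∞) F := by
    apply s1.mul
    apply Real.contDiff_exp.comp
    fun_prop
  set Z : ℝ → ℝ := fun s => -(∫ t in (7/4:ℝ)..s, F t) - J * (1 - χ2 s) with hZ
  have sZ : ContDiff ℝ (⊤ : ℕ∞) Z :=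
    (int_smooth sF (7/4)).neg.sub (contDiff_const.mul (contDiff_const.sub s2))
  have dχ2 := (smooth_deriv s2).2
  have dZ : ∀ s, HasDerivAt Z (-F s + J * deriv χ2 s) s := by
    intro s
    have := ((intervalIntegral.integral_hasDerivAt_right
      (sF.continuous.intervalIntegrable (7/4) s)
      (sF.continuous.stronglyMeasurableAtFilter _ _) sF.continuous.continuousAt).neg).sub
      (((dχ2 s).const_sub 1).const_mul J)
    refine this.congr_deriv ?_
    ring
  have cF := sF.continuous
  have Zl : ∀ s, s ≤ 1/4 → Z s = J * χ2 s := by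
    intro s hs
    have e1 : ∫ t in (7/4:ℝ)..s, F t = (∫ t in (7/4:ℝ)..(1/4), F t) + ∫ t in (1/4:ℝ)..s, F t :=
      (intervalIntegral.integral_add_adjacent_intervals (cF.intervalIntegrable _ _)
        (cF.intervalIntegrable _ _)).symm
    have e2 : ∫ t in (1/4:ℝ)..s, F t = 0 := by
      rw [intervalIntegral.integral_symm, neg_eq_zero]
      rw [intervalIntegral.integral_of_le hs, integral_Ioc_eq_integral_Ioo]
      apply setIntegral_eq_zero_of_forall_eq_zero
      intro t ht
      rw [hF]; simp only; rw [χz t (fun h => by linarith [h.1, ht.2]), zero_mul]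
    have e3 : ∫ t in (7/4:ℝ)..(1/4), F t = -J := by
      rw [intervalIntegral.integral_symm, hJ]
    rw [hZ]; simp only; rw [e1, e2, e3]; ring
  have Zr : ∀ s, 7/4 ≤ s → Z s = 0 := by
    intro s hs
    have e2 : ∫ t in (7/4:ℝ)..s, F t = 0 := by
      rw [intervalIntegral.integral_of_le hs]
      apply setIntegral_eq_zero_of_forall_eq_zero
      intro t ht
      rw [hF]; simp only; rw [χz t (fun h => by linarith [h.2, ht.1]), zero_mul]
    rw [hZ]; simp only; rw [e2, χ2b s (by linarith)]; ring
  set vf : ℝ → ℂ := fun s => Complex.exp (G s / h) * (Z s : ℂ) with hvf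
  have svf : ContDiff ℝ (⊤ : ℕ∞) vf := by
    apply ContDiff.mul
    · exact (sG.div_const _).cexp
    · exact Complex.ofRealCLM.contDiff.comp sZ
  have v0 : ∀ s, s ∉ Set.Icc (-3:ℝ) (7/4) → vf s = 0 := by
    intro s hs
    have : Z s = 0 := by
      by_cases h1 : s ≤ -3
      · rw [Zl s (by linarith), χ2a s h1, mul_zero]
      · exact Zr s (by by_contra! h2; exact hs ⟨by linarith, by linarith⟩)
    rw [hvf]; simp only; rw [this]; simp
  have cs : HasCompactSupport vf :=
    HasCompactSupport.intro isCompact_Icc (fun s hs => v0 s hs)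
  set v : 𝓢(ℝ, ℂ) := cs.toSchwartzMap svf with hv
  have va : ∀ s, v s = vf s := fun s => rfl
  have dv : ∀ s, DD v s = q s / h * vf s + Complex.exp (G s / h) * ((-F s + J * deriv χ2 s : ℝ) : ℂ) := by
    intro s
    refine (sch_hasDeriv v s).unique ?_
    have := (((dG s).div_const (h : ℂ)).cexp).mul (dZ s).ofReal_comp
    refine HasDerivAt.congr_deriv this ?_
    rw [hvf]; simp only; ring
  have XX1 : ∀ s, Complex.exp (G s / h) * ((Real.exp (-(2 * R s / h)) : ℝ) : ℂ) = X1 s := by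
    intro s
    rw [hX1]; simp only
    rw [Complex.ofReal_exp, ← Complex.exp_add]
    congr 1
    push_cast
    rw [← reG s, Complex.re_eq_add_conj]
    field_simp; ring
  have dχ := (smooth_deriv s1).2
  have dχ' := (smooth_deriv (smooth_deriv s1).1).2
  have dχ2' := (smooth_deriv (smooth_deriv s2).1).2
  have dχ2'' := (smooth_deriv (smooth_deriv (smooth_deriv s2).1).1).2
  obtain ⟨D1, D1'⟩ := amp_deriv hh dX1 (fun s => (dq s).star.neg) (fun s => ((dχ s).ofReal_comp).neg)
    (fun s => ((dχ' s).ofReal_comp).neg)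
  obtain ⟨D2, D2'⟩ := amp_deriv hh dX2 dq (fun s => (dχ2' s).ofReal_comp)
    (fun s => (dχ2'' s).ofReal_comp)
  have gg : ∀ s, h * DD v s - 3 / (I * y) * (p s - 1) * v s
      = h * (-(χ s : ℂ)) * X1 s + h * ((deriv χ2 s : ℝ) : ℂ) * X2 s := by
    intro s
    rw [dv s, va s, ← XX1 s]
    have e : 3 / (I * (y:ℂ)) * (p s - 1) = q s := rfl
    rw [e, hX2, hF]
    push_cast
    field_simp
    ring
  have A := left_fac hy hp hp1 v gg (fun s => (D1 s).add (D2 s)) (fun s => (D1' s).add (D2' s))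
  have z1 : ∀ s, s ∉ Set.Icc (1/4:ℝ) (7/4) → deriv χ s = 0 := zero_deriv χz
  have z1' : ∀ s, s ∉ Set.Icc (1/4:ℝ) (7/4) → deriv (deriv χ) s = 0 := zero_deriv z1
  have z2 : ∀ s, s ∉ Set.Icc (-3:ℝ) (-5/2) → deriv χ2 s = 0 := by
    intro s hs
    by_cases h1 : s < -3
    · have : χ2 =ᶠ[nhds s] fun _ => 0 := by
        filter_upwards [isOpen_Iio.mem_nhds (show s ∈ Set.Iio (-3:ℝ) from h1)] with t ht
        exact χ2a t (le_of_lt ht)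
      rw [this.deriv_eq]; simp
    · have h2 : -5/2 < s := by
        by_contra! h2; exact hs ⟨by linarith, by linarith⟩
      have : χ2 =ᶠ[nhds s] fun _ => 1 := by
        filter_upwards [isOpen_Ioi.mem_nhds (show s ∈ Set.Ioi (-5/2:ℝ) from h2)] with t ht
        exact χ2b t (le_of_lt ht)
      rw [this.deriv_eq]; simp
  have z2' : ∀ s, s ∉ Set.Icc (-3:ℝ) (-5/2) → deriv (deriv χ2) s = 0 := zero_deriv z2
  have z2'' : ∀ s, s ∉ Set.Icc (-3:ℝ) (-5/2) → deriv (deriv (deriv χ2)) s = 0 := zero_deriv z2'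
  refine ⟨v, ?_, ?_⟩
  · intro s hs
    rw [va s, hvf]; simp only
    rw [norm_mul, nE, Zl s (by linarith [hs.2]), χ2b s (by linarith [hs.1]), mul_one,
      Complex.norm_real, Real.norm_eq_abs, abs_of_nonneg J0, mul_pow, ← Real.exp_nat_mul]
    rw [mul_comm]; congr 2; push_cast; ring
  intro s
  set D := 8 * K ^ 3 * (2 * C + 2) + K with hD
  have D0 : 0 ≤ D := by positivity
  have i1 : 0 ≤ (Set.Icc (1/4:ℝ) (7/4)).indicator
          (fun s => D * (y * h) * Real.exp (-(R s / h))) s :=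
    Set.indicator_nonneg (fun _ _ => by positivity) _
  have i2 : 0 ≤ (Set.Icc (-3:ℝ) (-5/2)).indicator
          (fun s => D * (h * J) * Real.exp (R s / h)) s :=
    Set.indicator_nonneg (fun _ _ => by positivity) _
  have i0 : 0 ≤ h * χ s * Real.exp (-(R s / h)) := by have := χ0 s; positivity
  by_cases hs : s ∈ Set.Icc (-4:ℝ) 4
  swap
  · have ev : (v : ℝ → ℂ) =ᶠ[nhds s] fun _ => 0 := by
      filter_upwards [isClosed_Icc.isOpen_compl.mem_nhds (show s ∈ (Set.Icc (-3:ℝ) (7/4))ᶜ from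
        fun h => hs ⟨by linarith [h.1], by linarith [h.2]⟩)] with t ht
      exact v0 t ht
    have ev1 : (DD v : ℝ → ℂ) =ᶠ[nhds s] fun _ => 0 := by
      have := ev.deriv
      simp only [deriv_const'] at this
      exact (Filter.EventuallyEq.of_eq (funext fun t => DD_apply v t)).trans this
    have ev2 : (DD (DD v) : ℝ → ℂ) =ᶠ[nhds s] fun _ => 0 := by
      have := ev1.deriv
      simp only [deriv_const'] at this
      exact (Filter.EventuallyEq.of_eq (funext fun t => DD_apply _ t)).trans this
    have ev3 : (DD (DD (DD v)) : ℝ → ℂ) =ᶠ[nhds s] fun _ => 0 := by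
      have := ev2.deriv
      simp only [deriv_const'] at this
      exact (Filter.EventuallyEq.of_eq (funext fun t => DD_apply _ t)).trans this
    rw [Tq_apply, ev.eq_of_nhds, ev1.eq_of_nhds, ev2.eq_of_nhds, ev3.eq_of_nhds]
    simp only [mul_zero, add_zero, sub_zero, norm_zero]
    linarith
  have A := A s (hr s hs)
  have B := left_close hh hh1 hy hC hCy hy1 (b0 s) (b1 s)
    (g := h * (-(χ s : ℂ)) * X1 s + h * ((deriv χ2 s : ℝ) : ℂ) * X2 s)
    (g1 := (h * (-((deriv χ s : ℝ) : ℂ)) + -((χ s : ℝ) : ℂ) * -(star (q s))) * X1 s +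
      (h * ((deriv (deriv χ2) s : ℝ) : ℂ) + ((deriv χ2 s : ℝ) : ℂ) * q s) * X2 s)
    (g2 := (h * (-((deriv (deriv χ) s : ℝ) : ℂ)) + 2 * (-((deriv χ s : ℝ) : ℂ)) * -(star (q s))
      + -((χ s : ℝ) : ℂ) * -(star (κ * p1 s)) + -((χ s : ℝ) : ℂ) * (-(star (q s))) ^ 2 / h) * X1 s
      + (h * ((deriv (deriv (deriv χ2)) s : ℝ) : ℂ) + 2 * ((deriv (deriv χ2) s : ℝ) : ℂ) * q s
      + ((deriv χ2 s : ℝ) : ℂ) * (κ * p1 s) + ((deriv χ2 s : ℝ) : ℂ) * (q s) ^ 2 / h) * X2 s)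
  have nstar : ∀ w : ℂ, ‖-(star w)‖ = ‖w‖ := fun w => by rw [norm_neg, norm_star]
  have E1 := amp_bd (X := X1 s) (A0 := -((χ s : ℝ) : ℂ)) (A1 := -((deriv χ s : ℝ) : ℂ))
    (A2 := -((deriv (deriv χ) s : ℝ) : ℂ)) (c0 := -(star (q s))) (c1 := -(star (κ * p1 s))) hh hh1 hK
    (by simpa using (k1 s).1) (by simpa using (k1 s).2.1) (by simpa using (k1 s).2.2)
    (by rw [nstar]; exact nq s) (by rw [nstar]; exact nq1 s)
  have E2 := amp_bd (X := X2 s) (A0 := ((deriv χ2 s : ℝ) : ℂ)) (A1 := ((deriv (deriv χ2) s : ℝ) : ℂ))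
    (A2 := ((deriv (deriv (deriv χ2)) s : ℝ) : ℂ)) (c0 := q s) (c1 := κ * p1 s) hh hh1 hK
    (by simpa using (k2 s).1) (by simpa using (k2 s).2.1) (by simpa using (k2 s).2.2)
    (nq s) (nq1 s)
  have B := (show ‖Tq h y v s - (h * (-(χ s : ℂ)) * X1 s + h * ((deriv χ2 s : ℝ) : ℂ) * X2 s)‖ ≤ _ from
    (congrArg (fun w => ‖w - (h * (-(χ s : ℂ)) * X1 s + h * ((deriv χ2 s : ℝ) : ℂ) * X2 s)‖) A).trans_le B)
  -- names
  have w1 : ‖(h : ℂ) * -((χ s : ℝ) : ℂ) * X1 s‖ = h * χ s * Real.exp (-(R s / h)) := by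
    rw [norm_mul, norm_mul, nX1, norm_neg, Complex.norm_real, Complex.norm_real, Real.norm_eq_abs,
      Real.norm_eq_abs, abs_of_pos hh, abs_of_nonneg (χ0 s)]
  have w2 : ‖(h : ℂ) * ((deriv χ2 s : ℝ) : ℂ) * X2 s‖ = h * |deriv χ2 s| * (J * Real.exp (R s / h)) := by
    rw [norm_mul, norm_mul, nX2, Complex.norm_real, Complex.norm_real, Real.norm_eq_abs,
      Real.norm_eq_abs, abs_of_pos hh]
  rw [nX1] at E1
  rw [nX2] at E2
  have L2 : (2 * C + 2) * y * (8 * K ^ 3 * (h * (J * Real.exp (R s / h)))) +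
      h * K * (J * Real.exp (R s / h)) ≤ D * (h * J) * Real.exp (R s / h) := by
    have e : D * (h * J) * Real.exp (R s / h) = (2 * C + 2) * 1 * (8 * K ^ 3 * (h * (J * Real.exp (R s / h)))) +
      h * K * (J * Real.exp (R s / h)) := by rw [hD]; ring
    rw [e]; gcongr
  have L1 : (2 * C + 2) * y * (8 * K ^ 3 * (h * Real.exp (-(R s / h)))) ≤
      D * (y * h) * Real.exp (-(R s / h)) := by
    have e : (2 * C + 2) * y * (8 * K ^ 3 * (h * Real.exp (-(R s / h)))) =
      (8 * K ^ 3 * (2 * C + 2)) * (y * h) * Real.exp (-(R s / h)) := by ring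
    rw [e, hD]; gcongr; linarith
  have M1 : (2 * C + 2) * y * (‖(h : ℂ) * -((χ s : ℝ) : ℂ) * X1 s‖
      + h * ‖(h * (-((deriv χ s : ℝ) : ℂ)) + -((χ s : ℝ) : ℂ) * -(star (q s))) * X1 s‖
      + h ^ 2 * ‖(h * (-((deriv (deriv χ) s : ℝ) : ℂ)) + 2 * (-((deriv χ s : ℝ) : ℂ)) * -(star (q s))
      + -((χ s : ℝ) : ℂ) * -(star (κ * p1 s)) + -((χ s : ℝ) : ℂ) * (-(star (q s))) ^ 2 / h) * X1 s‖)
      ≤ (Set.Icc (1/4:ℝ) (7/4)).indicator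
          (fun s => D * (y * h) * Real.exp (-(R s / h))) s := by
    by_cases m : s ∈ Set.Icc (1/4:ℝ) (7/4)
    · rw [Set.indicator_of_mem m]
      refine le_trans ?_ L1
      gcongr
    · rw [Set.indicator_of_notMem m, χz s m, z1 s m, z1' s m]
      simp
  have M2 : (2 * C + 2) * y * (‖(h : ℂ) * ((deriv χ2 s : ℝ) : ℂ) * X2 s‖
      + h * ‖(h * ((deriv (deriv χ2) s : ℝ) : ℂ) + ((deriv χ2 s : ℝ) : ℂ) * q s) * X2 s‖
      + h ^ 2 * ‖(h * ((deriv (deriv (deriv χ2)) s : ℝ) : ℂ) + 2 * ((deriv (deriv χ2) s : ℝ) : ℂ) * q s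
      + ((deriv χ2 s : ℝ) : ℂ) * (κ * p1 s) + ((deriv χ2 s : ℝ) : ℂ) * (q s) ^ 2 / h) * X2 s‖)
      + ‖(h : ℂ) * ((deriv χ2 s : ℝ) : ℂ) * X2 s‖
      ≤ (Set.Icc (-3:ℝ) (-5/2)).indicator
          (fun s => D * (h * J) * Real.exp (R s / h)) s := by
    by_cases m : s ∈ Set.Icc (-3:ℝ) (-5/2)
    · rw [Set.indicator_of_mem m]
      refine le_trans ?_ L2
      apply add_le_add
      · gcongr
      · rw [w2]; gcongr; exact (k2 s).1
    · rw [Set.indicator_of_notMem m, z2 s m, z2' s m, z2'' s m]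
      simp
  rw [← w1]
  refine (norm_le_norm_add_norm_sub' _ _).trans ((add_le_add (norm_add_le _ _) B).trans ?_)
  refine le_trans ?_ (add_le_add_right (add_le_add M1 M2) _)
  set g0a := (h : ℂ) * -((χ s : ℝ) : ℂ) * X1 s
  set g1a := (h * (-((deriv χ s : ℝ) : ℂ)) + -((χ s : ℝ) : ℂ) * -(star (q s))) * X1 s
  set g2a := (h * (-((deriv (deriv χ) s : ℝ) : ℂ)) + 2 * (-((deriv χ s : ℝ) : ℂ)) * -(star (q s))
      + -((χ s : ℝ) : ℂ) * -(star (κ * p1 s)) + -((χ s : ℝ) : ℂ) * (-(star (q s))) ^ 2 / h) * X1 s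
  set g0b := (h : ℂ) * ((deriv χ2 s : ℝ) : ℂ) * X2 s
  set g1b := (h * ((deriv (deriv χ2) s : ℝ) : ℂ) + ((deriv χ2 s : ℝ) : ℂ) * q s) * X2 s
  set g2b := (h * ((deriv (deriv (deriv χ2)) s : ℝ) : ℂ) + 2 * ((deriv (deriv χ2) s : ℝ) : ℂ) * q s
      + ((deriv χ2 s : ℝ) : ℂ) * (κ * p1 s) + ((deriv χ2 s : ℝ) : ℂ) * (q s) ^ 2 / h) * X2 s
  have t : (2 * C + 2) * y * (‖g0a + g0b‖ + h * ‖g1a + g1b‖ + h ^ 2 * ‖g2a + g2b‖)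
    ≤ (2 * C + 2) * y * ((‖g0a‖ + ‖g0b‖) + h * (‖g1a‖ + ‖g1b‖) + h ^ 2 * (‖g2a‖ + ‖g2b‖)) := by
    gcongr <;> exact norm_add_le _ _
  linarith


lemma ind_int {f : ℝ → ℝ} (hf : Continuous f) {a b : ℝ} (hab : a ≤ b) :
    Integrable ((Set.Icc a b).indicator f) ∧ ∫ s, (Set.Icc a b).indicator f s = ∫ s in a..b, f s := by
  constructor
  · exact (integrable_indicator_iff measurableSet_Icc).2 hf.continuousOn.integrableOn_Icc
  · rw [integral_indicator measurableSet_Icc, integral_Icc_eq_integral_Ioc,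
      intervalIntegral.integral_of_le hab]

/-- integrated form of the pointwise bound on `Tq v` -/
lemma T_bound {h y D J e : ℝ} (he : 0 < e) (hh : 0 < h) {v : 𝓢(ℝ, ℂ)} {R χ : ℝ → ℝ}
    (cR : Continuous R) (cχ : Continuous χ) (χ0 : ∀ s, 0 ≤ χ s) (χ1 : ∀ s, χ s ≤ 1)
    (χz : ∀ s, s ∉ Set.Icc (1/4:ℝ) (7/4) → χ s = 0)
    (H : ∀ s, ‖Tq h y v s‖ ≤ h * χ s * Real.exp (-(R s / h)) +
        ((Set.Icc (1/4:ℝ) (7/4)).indicator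
          (fun s => D * (y * h) * Real.exp (-(R s / h))) s +
        (Set.Icc (-3:ℝ) (-5/2)).indicator
          (fun s => D * (h * J) * Real.exp (R s / h)) s)) :
    nrm (Tq h y v) ^ 2 ≤ (1 + e) * h ^ 2 * (∫ s in (1/4:ℝ)..(7/4), χ s * Real.exp (-(2 * R s / h)))
      + 2 * (1 + 1 / e) * (D ^ 2 * y ^ 2 * h ^ 2 * (∫ s in (1/4:ℝ)..(7/4), Real.exp (-(2 * R s / h)))
      + D ^ 2 * h ^ 2 * J ^ 2 * ∫ s in (-3:ℝ)..(-5/2), Real.exp (2 * R s / h)) := by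
  have c1 : Continuous fun s => (1 + e) * h ^ 2 * (χ s * Real.exp (-(2 * R s / h))) := by fun_prop
  have c2 : Continuous fun s => 2 * (1 + 1 / e) * (D ^ 2 * y ^ 2 * h ^ 2 * Real.exp (-(2 * R s / h))) := by
    fun_prop
  have c3 : Continuous fun s => 2 * (1 + 1 / e) * (D ^ 2 * h ^ 2 * J ^ 2 * Real.exp (2 * R s / h)) := by
    fun_prop
  obtain ⟨a1, i1⟩ := ind_int c1 (show (1/4:ℝ) ≤ 7/4 by norm_num)
  obtain ⟨a2, i2⟩ := ind_int c2 (show (1/4:ℝ) ≤ 7/4 by norm_num)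
  obtain ⟨a3, i3⟩ := ind_int c3 (show (-3:ℝ) ≤ -5/2 by norm_num)
  rw [intervalIntegral.integral_const_mul] at i1 i2 i3
  rw [intervalIntegral.integral_const_mul] at i2 i3
  have sq1 : ∀ s, Real.exp (-(R s / h)) ^ 2 = Real.exp (-(2 * R s / h)) := fun s => by
    rw [← Real.exp_nat_mul]; congr 1; push_cast; ring
  have sq2 : ∀ s, Real.exp (R s / h) ^ 2 = Real.exp (2 * R s / h) := fun s => by
    rw [← Real.exp_nat_mul]; congr 1; push_cast; ring
  rw [nrm_sq]
  calc ∫ s, ‖Tq h y v s‖ ^ 2 ≤ ∫ s, ((Set.Icc (1/4:ℝ) (7/4)).indicator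
          (fun s => (1 + e) * h ^ 2 * (χ s * Real.exp (-(2 * R s / h)))) s
        + ((Set.Icc (1/4:ℝ) (7/4)).indicator
          (fun s => 2 * (1 + 1 / e) * (D ^ 2 * y ^ 2 * h ^ 2 * Real.exp (-(2 * R s / h)))) s
        + (Set.Icc (-3:ℝ) (-5/2)).indicator
          (fun s => 2 * (1 + 1 / e) * (D ^ 2 * h ^ 2 * J ^ 2 * Real.exp (2 * R s / h))) s)) := by
        apply integral_mono (sq_integrable _) (a1.add (a2.add a3))
        intro s
        simp only [Pi.add_apply]
        have Y := young3 he (norm_nonneg _) (H s)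
        refine Y.trans ?_
        rw [mul_add (2 * (1 + 1 / e))]
        apply add_le_add
        · by_cases m : s ∈ Set.Icc (1/4:ℝ) (7/4)
          · rw [Set.indicator_of_mem m, mul_pow, mul_pow, sq1]
            have : χ s ^ 2 ≤ χ s := by nlinarith [χ0 s, χ1 s]
            calc (1 + e) * (h ^ 2 * χ s ^ 2 * Real.exp (-(2 * R s / h)))
              ≤ (1 + e) * (h ^ 2 * χ s * Real.exp (-(2 * R s / h))) := by gcongr
              _ = _ := by ring
          · rw [Set.indicator_of_notMem m, χz s m]; simp
        apply add_le_add
        · by_cases m : s ∈ Set.Icc (1/4:ℝ) (7/4)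
          · rw [Set.indicator_of_mem m, Set.indicator_of_mem m, mul_pow, sq1]
            apply le_of_eq; ring
          · rw [Set.indicator_of_notMem m, Set.indicator_of_notMem m]; simp
        · by_cases m : s ∈ Set.Icc (-3:ℝ) (-5/2)
          · rw [Set.indicator_of_mem m, Set.indicator_of_mem m, mul_pow, sq2]
            apply le_of_eq; ring
          · rw [Set.indicator_of_notMem m, Set.indicator_of_notMem m]; simp
    _ = _ := by
        have j1 := integral_add a1 (a2.add a3)
        have j2 := integral_add a2 a3
        simp only [Pi.add_apply] at j1
        rw [j1, j2, i1, i2, i3]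
        ring

/-- exponential estimates away from the critical points -/
lemma exp_ests {h e : ℝ} (hh : 0 < h) (hh1 : h ≤ 1 / 225) (he : e ≤ 1 / 2) {R χ : ℝ → ℝ}
    (cR : Continuous R) (cχ : Continuous χ) (χ0 : ∀ s, 0 ≤ χ s) (χ1 : ∀ s, χ s ≤ 1)
    (χo : ∀ s ∈ Set.Icc (1/2:ℝ) (3/2), χ s = 1)
    (cr : ∀ s ∈ Set.Icc (-4:ℝ) 4, |R s + (s + 1) ^ 2 * (2 - s) / 3| ≤ 1 / 20) {J : ℝ}
    (hJ : J = ∫ s in (1/4:ℝ)..(7/4), χ s * Real.exp (-(2 * R s / h)))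
    (lo : (1 - e) * √(Real.pi * h / 2) * Real.exp (-(2 * R 1 / h)) ≤
        ∫ s in (3/4:ℝ)..(5/4), Real.exp (-(2 * R s / h))) :
    (1 - e) * √(Real.pi * h / 2) * Real.exp (-(2 * R 1 / h)) ≤ J ∧
    (∫ s in (1/4:ℝ)..(7/4), Real.exp (-(2 * R s / h))) ≤ 2 * J ∧
    J * (∫ s in (-3:ℝ)..(-5/2), Real.exp (2 * R s / h)) ≤ h := by
  have cE : Continuous fun s => Real.exp (-(2 * R s / h)) := by fun_prop
  have cE2 : Continuous fun s => Real.exp (2 * R s / h) := by fun_prop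
  have cF : Continuous fun s => χ s * Real.exp (-(2 * R s / h)) := by fun_prop
  have cQ : Continuous fun s => (1 - χ s) * Real.exp (-(2 * R s / h)) := by fun_prop
  have p1 : (1 - e) * √(Real.pi * h / 2) * Real.exp (-(2 * R 1 / h)) ≤ J := by
    refine lo.trans ?_
    rw [hJ]
    calc ∫ s in (3/4:ℝ)..(5/4), Real.exp (-(2 * R s / h)) =
        ∫ s in (3/4:ℝ)..(5/4), χ s * Real.exp (-(2 * R s / h)) := by
          apply intervalIntegral.integral_congr
          intro s hs
          rw [Set.uIcc_of_le (by norm_num)] at hs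
          simp only
          rw [χo s ⟨by linarith [hs.1], by linarith [hs.2]⟩, one_mul]
      _ ≤ _ := by
          apply intervalIntegral.integral_mono_interval (by norm_num) (by norm_num) (by norm_num) _
            (cF.intervalIntegrable _ _)
          exact Filter.Eventually.of_forall fun s => mul_nonneg (χ0 s) (Real.exp_pos _).le
  have R1 : R 1 ≤ -1.28 := by
    have := abs_le.1 (cr 1 ⟨by norm_num, by norm_num⟩)
    linarith [this.2]
  have big : 3 / 2 * Real.exp (2.36 / h) ≤ J := by
    refine le_trans ?_ p1
    have sq : h * 15 ≤ √(Real.pi * h / 2) := by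
      apply Real.le_sqrt_of_sq_le
      nlinarith [Real.pi_gt_three]
    have x1 : Real.exp (2.36 / h) = Real.exp (-(0.2 / h)) * Real.exp (2.56 / h) := by
      rw [← Real.exp_add]; congr 1; field_simp; norm_num
    have x2 := exp_neg_le_inv (0.2 / h) (by positivity)
    have x3 : Real.exp (2.56 / h) ≤ Real.exp (-(2 * R 1 / h)) := by
      apply Real.exp_le_exp.2
      rw [← neg_div]; gcongr; linarith
    rw [x1]
    have x4 : 3 / 2 * Real.exp (-(0.2 / h)) ≤ (1 - e) * √(Real.pi * h / 2) := by
      have : (1:ℝ) / (0.2 / h) = 5 * h := by field_simp; norm_num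
      rw [this] at x2
      nlinarith
    calc 3 / 2 * (Real.exp (-(0.2 / h)) * Real.exp (2.56 / h)) =
       (3 / 2 * Real.exp (-(0.2 / h))) * Real.exp (2.56 / h) := by ring
      _ ≤ _ := mul_le_mul x4 x3 (Real.exp_pos _).le
          (mul_nonneg (by linarith) (Real.sqrt_nonneg _))
  have p2 : (∫ s in (1/4:ℝ)..(7/4), Real.exp (-(2 * R s / h))) ≤ 2 * J := by
    have e1 : ∫ s in (1/4:ℝ)..(7/4), Real.exp (-(2 * R s / h)) =
       J + ∫ s in (1/4:ℝ)..(7/4), (1 - χ s) * Real.exp (-(2 * R s / h)) := by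
      rw [hJ, ← intervalIntegral.integral_add (cF.intervalIntegrable _ _) (cQ.intervalIntegrable _ _)]
      apply intervalIntegral.integral_congr
      intro s _
      simp only; ring
    have e2 : ∫ s in (1/4:ℝ)..(7/4), (1 - χ s) * Real.exp (-(2 * R s / h)) ≤
        ∫ s in (1/4:ℝ)..(7/4), Real.exp (2.36 / h) := by
      apply intervalIntegral.integral_mono_on (by norm_num) (cQ.intervalIntegrable _ _)
        (by simp)
      intro s hs
      by_cases m : s ∈ Set.Icc (1/2:ℝ) (3/2)
      · rw [χo s m, sub_self, zero_mul]; positivity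
      · have rb : -R s ≤ 1.18 := by
          have := abs_le.1 (cr s ⟨by linarith [hs.1], by linarith [hs.2]⟩)
          have t : (s + 1) ^ 2 * (2 - s) / 3 ≤ 1.125 := by
            by_cases h1 : s < 1/2
            · nlinarith [hs.1, mul_nonneg (sub_nonneg.2 hs.1) (sub_nonneg.2 h1.le), sq_nonneg (s-1/2), sq_nonneg (s+1)]
            · have h2 : 3/2 < s := by
                by_contra! h2; exact m ⟨by linarith, h2⟩
              nlinarith [hs.2, mul_nonneg (sub_nonneg.2 hs.2) (sub_nonneg.2 h2.le), sq_nonneg (s-3/2), sq_nonneg (s+1)]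
          linarith [this.1]
        calc (1 - χ s) * Real.exp (-(2 * R s / h)) ≤ 1 * Real.exp (-(2 * R s / h)) := by
              gcongr; linarith [χ0 s]
          _ ≤ Real.exp (2.36 / h) := by
              rw [one_mul]
              apply Real.exp_le_exp.2
              rw [← neg_div]; gcongr; linarith
    rw [intervalIntegral.integral_const, smul_eq_mul] at e2
    norm_num at e2 big
    linarith
  refine ⟨p1, p2, ?_⟩
  have J0 : 0 ≤ J := le_trans (by positivity) big
  have p3 : J ≤ 3 / 2 * Real.exp (2.8 / h) := by
    rw [hJ]
    calc ∫ s in (1/4:ℝ)..(7/4), χ s * Real.exp (-(2 * R s / h)) ≤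
        ∫ s in (1/4:ℝ)..(7/4), Real.exp (2.8 / h) := by
          apply intervalIntegral.integral_mono_on (by norm_num) (cF.intervalIntegrable _ _)
            (by simp)
          intro s hs
          have rb : -R s ≤ 1.4 := by
            have := abs_le.1 (cr s ⟨by linarith [hs.1], by linarith [hs.2]⟩)
            have t : (s + 1) ^ 2 * (2 - s) / 3 ≤ 4/3 := by
              nlinarith [hs.1, mul_nonneg (sq_nonneg (s-1)) (show (0:ℝ) ≤ s + 2 by linarith [hs.1])]
            linarith [this.1]
          calc χ s * Real.exp (-(2 * R s / h)) ≤ 1 * Real.exp (-(2 * R s / h)) := by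
                gcongr; exact χ1 s
            _ ≤ Real.exp (2.8 / h) := by
                rw [one_mul]
                apply Real.exp_le_exp.2
                rw [← neg_div]; gcongr; linarith
      _ = 3 / 2 * Real.exp (2.8 / h) := by
          rw [intervalIntegral.integral_const, smul_eq_mul]; norm_num
  have p4 : ∫ s in (-3:ℝ)..(-5/2), Real.exp (2 * R s / h) ≤ 1 / 2 * Real.exp (-(6 / h)) := by
    calc ∫ s in (-3:ℝ)..(-5/2), Real.exp (2 * R s / h) ≤
        ∫ s in (-3:ℝ)..(-5/2), Real.exp (-(6 / h)) := by
          apply intervalIntegral.integral_mono_on (by norm_num) (cE2.intervalIntegrable _ _)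
            (by simp)
          intro s hs
          have rb : R s ≤ -3 := by
            have := abs_le.1 (cr s ⟨by linarith [hs.1], by linarith [hs.2]⟩)
            have t : 3.3 ≤ (s + 1) ^ 2 * (2 - s) / 3 := by
              have u1 : 2.25 ≤ (s + 1) ^ 2 := by nlinarith [hs.2]
              have u2 : 4.5 ≤ 2 - s := by linarith [hs.2]
              nlinarith
            linarith [this.2]
          apply Real.exp_le_exp.2
          rw [← neg_div]; gcongr; linarith
      _ = _ := by
          rw [intervalIntegral.integral_const, smul_eq_mul]; norm_num
  calc J * (∫ s in (-3:ℝ)..(-5/2), Real.exp (2 * R s / h))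
      ≤ (3 / 2 * Real.exp (2.8 / h)) * (1 / 2 * Real.exp (-(6 / h))) := by
        gcongr
        exact intervalIntegral.integral_nonneg (by norm_num) (fun s _ => (Real.exp_pos _).le)
    _ = 3 / 4 * Real.exp (-(3.2 / h)) := by
        rw [show -(3.2 / h) = 2.8 / h + -(6 / h) by field_simp; norm_num, Real.exp_add]; ring
    _ ≤ 3 / 4 * (1 / (3.2 / h)) := by
        gcongr; exact exp_neg_le_inv _ (by positivity)
    _ ≤ h := by
        rw [one_div_div]; norm_num; linarith


lemma eps_ineq {e : ℝ} (e0 : 0 < e) (h : 20 * e < 1) :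
    (1 - 20 * e) ^ 2 * (1 + 2 * e) ≤ (1 - e) ^ 3 := by
  nlinarith [mul_pos e0 e0, mul_pos (mul_pos e0 e0) e0]

set_option maxHeartbeats 1000000 in
lemma lower (ε : ℝ) (hε : 0 < ε) (hε1 : ε < 1) : ∃ δ : ℝ, 0 < δ ∧ ∀ h y : ℝ, 0 < h → h ≤ δ →
    0 < y → y ≤ δ → ∃ v : 𝓢(ℝ, ℂ), 0 < nrm v ∧ (1 - ε) * Aa h y * nrm (Tq h y v) ≤ nrm v := by
  obtain ⟨χ, s1, χ0, χ1, χo, χz⟩ := bump_one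
  obtain ⟨χ2, s2, χ2a, χ2b⟩ := bump_two
  obtain ⟨C, hC, y0, hy0, hy01, hCy0, HS⟩ := setup 4 (by norm_num)
  set e := ε / 20 with he
  have e0 : 0 < e := by positivity
  have e1 : e ≤ 1 / 20 := by rw [he]; linarith
  obtain ⟨η, η0, η1, HL⟩ := laplace 4 e le_rfl e0
  obtain ⟨K1, K1one, k1⟩ := bdd3 s1 χz
  have z2 : ∀ s, s ∉ Set.Icc (-3:ℝ) (-5/2) → deriv χ2 s = 0 := by
    intro s hs
    by_cases h1 : s < -3
    · have : χ2 =ᶠ[nhds s] fun _ => 0 := by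
        filter_upwards [isOpen_Iio.mem_nhds (show s ∈ Set.Iio (-3:ℝ) from h1)] with t ht
        exact χ2a t (le_of_lt ht)
      rw [this.deriv_eq]; simp
    · have h2 : -5/2 < s := by
        by_contra! h2; exact hs ⟨by linarith, by linarith⟩
      have : χ2 =ᶠ[nhds s] fun _ => 1 := by
        filter_upwards [isOpen_Ioi.mem_nhds (show s ∈ Set.Ioi (-5/2:ℝ) from h2)] with t ht
        exact χ2b t (le_of_lt ht)
      rw [this.deriv_eq]; simp
  obtain ⟨K2, K2one, k2⟩ := bdd3 (smooth_deriv s2).1 z2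
  set K := K1 + K2 + 3 * C with hK
  have K0 : 1 ≤ K := by rw [hK]; linarith
  have k1' : ∀ s, |χ s| ≤ K ∧ |deriv χ s| ≤ K ∧ |deriv (deriv χ) s| ≤ K := fun s =>
    ⟨by linarith [(k1 s).1], by linarith [(k1 s).2.1], by linarith [(k1 s).2.2]⟩
  have k2' : ∀ s, |deriv χ2 s| ≤ K ∧ |deriv (deriv χ2) s| ≤ K ∧ |deriv (deriv (deriv χ2)) s| ≤ K :=
    fun s => ⟨by linarith [(k2 s).1], by linarith [(k2 s).2.1], by linarith [(k2 s).2.2]⟩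
  set D := 8 * K ^ 3 * (2 * C + 2) + K with hD
  have D0 : 0 < D := by positivity
  set δ := min (min η (min (η / C) y0)) (min (min (1 / 225) (e / (4 * C)))
    (e / (6 * (1 + 1 / e) * D ^ 2))) with hδ
  have d1 : δ ≤ η := (min_le_left _ _).trans (min_le_left _ _)
  have d2 : δ ≤ η / C := (min_le_left _ _).trans ((min_le_right _ _).trans (min_le_left _ _))
  have d3 : δ ≤ y0 := (min_le_left _ _).trans ((min_le_right _ _).trans (min_le_right _ _))
  have d4 : δ ≤ 1 / 225 := (min_le_right _ _).trans ((min_le_left _ _).trans (min_le_left _ _))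
  have d5 : δ ≤ e / (4 * C) := (min_le_right _ _).trans ((min_le_left _ _).trans (min_le_right _ _))
  have d6 : δ ≤ e / (6 * (1 + 1 / e) * D ^ 2) := (min_le_right _ _).trans (min_le_right _ _)
  refine ⟨δ, by positivity, ?_⟩
  intro h y hh hhδ hy hyδ
  have hh1 : h ≤ 1 := by linarith
  have hy1 : y ≤ 1 := by linarith
  obtain ⟨ω, w1, w2, w3, w4, w5, w6, w7⟩ := HS h y hh hh1 hy (hyδ.trans d3)
  have hCy : C * y ≤ 1 := by
    calc C * y ≤ C * y0 := by gcongr; exact hyδ.trans d3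
      _ ≤ 1 := hCy0
  have hCyη : C * y ≤ η := by
    calc C * y ≤ C * (η / C) := by gcongr; exact hyδ.trans d2
      _ = η := by field_simp
  have cω := w1.continuous
  have dω := (smooth_deriv w1).2
  have dω' := (smooth_deriv (smooth_deriv w1).1).2
  have cρ : Continuous fun s : ℝ => 3 / y * (ω s).im := by fun_prop
  have H' := w5.neg
  obtain ⟨_, L1, L2, L3⟩ := HL h (C * y) _ hh (hhδ.trans d1) (by positivity) hCyη H'
  set R := Rr (fun s => 3 / y * (ω (-s)).im) with hR
  have R1 : R 1 = Rr (fun s => 3 / y * (ω s).im) 1 := by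
    have := Rr_neg cρ (-1)
    rw [neg_neg] at this
    have z : Rr (fun s => 3 / y * (ω s).im) (-1) = 0 := by simp [Rr]
    rw [z, sub_zero] at this
    exact this
  have cR : Continuous R := Rr_cont (by fun_prop)
  set J := ∫ s in (1/4:ℝ)..(7/4), χ s * Real.exp (-(2 * R s / h)) with hJ
  obtain ⟨E1, E2, E3⟩ := exp_ests hh (hhδ.trans d4) (by linarith : e ≤ 1 / 2) cR s1.continuous χ0 χ1 χo L3 hJ L2
  have S0 : 0 < √(Real.pi * h / 2) := by
    apply Real.sqrt_pos.2; have := Real.pi_pos; positivity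
  have J0 : 0 < J := lt_of_lt_of_le (mul_pos (mul_pos (by linarith) S0) (Real.exp_pos _)) E1
  obtain ⟨v, V1, V2⟩ := quasi (p := fun s => ω (-s)) (p1 := fun s => -deriv ω (-s))
    (p2 := fun s => deriv (deriv ω) (-s)) hC K0 (by rw [hK]; linarith) hh hh1 hy hy1 hCy
    (w1.comp contDiff_neg)
    (fun s => ((dω (-s)).scomp s (hasDerivAt_neg s)).congr_deriv (by simp))
    (fun s => (((dω' (-s)).scomp s (hasDerivAt_neg s)).neg).congr_deriv (by simp))
    (fun s => w2 (-s)) (fun s => by rw [norm_neg]; exact w3 (-s))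
    (fun s hs => by
      have := w4 (-s) ⟨by linarith [hs.2], by linarith [hs.1]⟩
      rw [neg_sq] at this
      rw [← this]; ring)
    s1 s2 χ0 χz χ2a χ2b k1' k2' hR hJ J0.le
  have T := T_bound e0 hh cR s1.continuous χ0 χ1 χz V2
  rw [← hJ, ← hD] at T
  clear_value R J D K δ e
  clear V2 hR hJ hD hK hδ k1 k2 k1' k2' χz L2 L3 HL HS dω dω' z2
  -- lower bound for v
  have N : J ^ 2 * ((1 - e) * √(Real.pi * h / 2)) ≤ nrm v ^ 2 := by
    refine le_trans ?_ (int_le_nrm v (show (-5/4:ℝ) ≤ -3/4 by norm_num))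
    have : ∫ s in (-5/4:ℝ)..(-3/4), ‖v s‖ ^ 2 = J ^ 2 * ∫ s in (-5/4:ℝ)..(-3/4), Real.exp (2 * R s / h) := by
      rw [← intervalIntegral.integral_const_mul]
      apply intervalIntegral.integral_congr
      intro s hs
      rw [Set.uIcc_of_le (by norm_num)] at hs
      exact V1 s hs
    rw [this]; gcongr
  have T2 : nrm (Tq h y v) ^ 2 ≤ (1 + 2 * e) * h ^ 2 * J := by
    refine T.trans ?_
    have a1 : D ^ 2 * y ^ 2 * h ^ 2 * (∫ s in (1/4:ℝ)..(7/4), Real.exp (-(2 * R s / h))) ≤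
        D ^ 2 * y * h ^ 2 * (2 * J) := by
      have : y ^ 2 ≤ y := pow_le_of_le_one hy.le hy1 (by norm_num)
      gcongr
      exact intervalIntegral.integral_nonneg (by norm_num) (fun s _ => (Real.exp_pos _).le)
    have a2 : D ^ 2 * h ^ 2 * J ^ 2 * (∫ s in (-3:ℝ)..(-5/2), Real.exp (2 * R s / h)) ≤
        D ^ 2 * h ^ 2 * J * h := by
      calc _ = D ^ 2 * h ^ 2 * J * (J * (∫ s in (-3:ℝ)..(-5/2), Real.exp (2 * R s / h))) := by ring
        _ ≤ _ := by gcongr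
    have a3 : 2 * (1 + 1 / e) * (D ^ 2 * (2 * y + h)) ≤ e := by
      calc 2 * (1 + 1 / e) * (D ^ 2 * (2 * y + h)) ≤ 2 * (1 + 1 / e) * (D ^ 2 * (2 * δ + δ)) := by gcongr
        _ = (6 * (1 + 1 / e) * D ^ 2) * δ := by ring
        _ ≤ (6 * (1 + 1 / e) * D ^ 2) * (e / (6 * (1 + 1 / e) * D ^ 2)) := by gcongr
        _ = e := by field_simp
    calc _ ≤ (1 + e) * h ^ 2 * J + 2 * (1 + 1 / e) * (D ^ 2 * y * h ^ 2 * (2 * J) + D ^ 2 * h ^ 2 * J * h) := by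
          gcongr
      _ = (1 + e) * h ^ 2 * J + 2 * (1 + 1 / e) * (D ^ 2 * (2 * y + h)) * (h ^ 2 * J) := by ring
      _ ≤ (1 + e) * h ^ 2 * J + e * (h ^ 2 * J) := by gcongr
      _ = _ := by ring
  have EE : (1 - e) * Real.exp (2 * Ph y / h) ≤ Real.exp (-(2 * R 1 / h)) := by
    have b := (abs_le.1 w6).2
    rw [← R1] at b
    have b2 : 2 * Ph y / h - e ≤ -(2 * R 1 / h) := by
      have : 4 * C * y ≤ e := by
        calc 4 * C * y ≤ 4 * C * (e / (4 * C)) := by gcongr; exact hyδ.trans d5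
          _ = e := by field_simp
      have m := mul_le_mul_of_nonneg_right this hh.le
      rw [← neg_div, ← sub_nonneg]
      have : -(2 * R 1) / h - (2 * Ph y / h - e) = (e * h - 2 * (R 1 + Ph y)) / h := by
        field_simp; ring
      rw [this]
      apply div_nonneg _ hh.le
      clear * - m b
      linarith
    calc (1 - e) * Real.exp (2 * Ph y / h) ≤ Real.exp (-e) * Real.exp (2 * Ph y / h) := by
          gcongr; linarith [Real.add_one_le_exp (-e)]
      _ = Real.exp (2 * Ph y / h - e) := by rw [← Real.exp_add]; congr 1; ring
      _ ≤ _ := Real.exp_le_exp.2 b2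
  have SS : √(Real.pi * h / 2) ^ 2 * Real.exp (2 * Ph y / h) = h ^ 2 * Aa h y ^ 2 := by
    have := Real.pi_pos
    unfold Aa
    rw [Real.sq_sqrt (by positivity), mul_pow, Real.sq_sqrt (by positivity), ← Real.exp_nat_mul]
    rw [show ((2:ℕ):ℝ) * (Ph y / h) = 2 * Ph y / h by push_cast; ring]
    field_simp
  have NN : J * ((1 - e) ^ 3 * (h ^ 2 * Aa h y ^ 2)) ≤ nrm v ^ 2 := by
    refine le_trans ?_ N
    rw [← SS]
    have e1' : 0 ≤ 1 - e := by linarith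
    calc J * ((1 - e) ^ 3 * (√(Real.pi * h / 2) ^ 2 * Real.exp (2 * Ph y / h)))
        = J * (1 - e) * √(Real.pi * h / 2) * ((1 - e) * √(Real.pi * h / 2) *
          ((1 - e) * Real.exp (2 * Ph y / h))) := by ring
      _ ≤ J * (1 - e) * √(Real.pi * h / 2) * ((1 - e) * √(Real.pi * h / 2) *
          Real.exp (-(2 * R 1 / h))) := by gcongr
      _ ≤ J * (1 - e) * √(Real.pi * h / 2) * J := by gcongr
      _ = _ := by ring
  have A1 : 1 ≤ Aa h y := Aa_ge_one hh hh1 w7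
  have fin : ((1 - ε) * Aa h y * nrm (Tq h y v)) ^ 2 ≤ nrm v ^ 2 := by
    refine le_trans ?_ NN
    have c1 : (1 - ε) ^ 2 * (1 + 2 * e) ≤ (1 - e) ^ 3 := by
      have : ε = 20 * e := by rw [he]; ring
      rw [this]
      exact eps_ineq e0 (by linarith)
    calc ((1 - ε) * Aa h y * nrm (Tq h y v)) ^ 2 = ((1 - ε) ^ 2 * Aa h y ^ 2) * nrm (Tq h y v) ^ 2 := by ring
      _ ≤ ((1 - ε) ^ 2 * Aa h y ^ 2) * ((1 + 2 * e) * h ^ 2 * J) := by gcongr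
      _ = ((1 - ε) ^ 2 * (1 + 2 * e)) * (J * (h ^ 2 * Aa h y ^ 2)) := by ring
      _ ≤ (1 - e) ^ 3 * (J * (h ^ 2 * Aa h y ^ 2)) := by gcongr
      _ = _ := by ring
  refine ⟨v, ?_, ?_⟩
  · have : 0 < nrm v ^ 2 := lt_of_lt_of_le (by
      have : 0 < 1 - e := by linarith
      positivity) N
    rcases (nrm_nonneg v).lt_or_eq with h | h
    · exact h
    · rw [← h] at this; norm_num at this
  · exact (abs_le_of_sq_le_sq' fin (nrm_nonneg v)).2


lemma aff_exists (c β : ℝ) (hc : 0 < c) (u : 𝓢(ℝ, ℂ)) : ∃ w : 𝓢(ℝ, ℂ), ∀ x, w x = u (β + c * x) := by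
  have hg : Function.HasTemperateGrowth (fun x : ℝ => β + c * x) := by fun_prop
  refine ⟨SchwartzMap.compCLM ℂ hg ⟨1, (1 + |β|) / c, fun x => ?_⟩ u, fun x => rfl⟩
  rw [pow_one, div_mul_eq_mul_div, le_div_iff₀ hc]
  have h1 : ‖x‖ * c = |(β + c * x) - β| := by
    rw [add_sub_cancel_left, abs_mul, abs_of_pos hc, Real.norm_eq_abs, mul_comm]
  rw [h1]
  have h2 := abs_sub (β + c * x) β
  rw [Real.norm_eq_abs]
  nlinarith [abs_nonneg (β + c * x), abs_nonneg β, mul_nonneg (abs_nonneg (β + c * x)) (abs_nonneg β)]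

lemma nrm_aff {c β : ℝ} (hc : 0 < c) {u w : 𝓢(ℝ, ℂ)} (h : ∀ x, w x = u (β + c * x)) :
    nrm w = nrm u * √(1 / c) := by
  have h1 : nrm w ^ 2 = (nrm u * √(1 / c)) ^ 2 := by
    rw [mul_pow, Real.sq_sqrt (by positivity), nrm_sq, nrm_sq]
    simp_rw [h]
    have := Measure.integral_comp_mul_left (fun x => ‖u (β + x)‖ ^ 2) c
    rw [this, integral_add_left_eq_self (fun x => ‖u x‖ ^ 2) β, abs_of_pos (by positivity), smul_eq_mul]
    field_simp
  have h2 := nrm_nonneg w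
  have h3 : 0 ≤ nrm u * √(1 / c) := mul_nonneg (nrm_nonneg u) (Real.sqrt_nonneg _)
  nlinarith [sq_nonneg (nrm w - nrm u * √(1 / c)), (abs_eq_abs.mp ((sq_eq_sq_iff_abs_eq_abs _ _).mp h1)),
    (pow_left_inj₀ h2 h3 two_ne_zero).mp h1]

/-- shifted operator -/
noncomputable def PP (z : ℂ) (u : 𝓢(ℝ, ℂ)) : 𝓢(ℝ, ℂ) :=
  -(DD (DD u)) + I • XX (XX (XX u)) - z • u

lemma PP_fun (z : ℂ) (u : 𝓢(ℝ, ℂ)) : (fun x : ℝ =>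
    -(deriv (deriv ⇑u) x) + Complex.I * (x:ℂ) ^ 3 * u x - z * u x) = ⇑(PP z u) := by
  funext x
  have : deriv ⇑u = ⇑(DD u) := by funext t; simp
  rw [this]
  simp only [PP, _root_.sub_apply, _root_.add_apply, _root_.neg_apply,
    _root_.smul_apply, XX_apply, DD_apply, smul_eq_mul]
  ring

lemma DD_aff {c β : ℝ} {u w : 𝓢(ℝ, ℂ)} (h : ∀ x, w x = u (β + c * x)) (x : ℝ) :
    DD w x = c * DD u (β + c * x) := by
  rw [DD_apply]
  have h1 : HasDerivAt (fun x : ℝ => β + c * x) c x := by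
    simpa using ((hasDerivAt_id x).const_mul c).const_add β
  have h2 := (sch_hasDeriv u (β + c * x)).scomp x h1
  have h3 : (u ∘ fun x : ℝ => β + c * x) = ⇑w := by funext t; simp [h]
  rw [h3] at h2
  rw [h2.deriv]
  simp

lemma PP_aff {p β : ℝ} (hp : 0 < p) (hβ : 0 < β) {u w : 𝓢(ℝ, ℂ)}
    (h : ∀ x, w x = u (β + 2 * Real.pi / p * x)) (x : ℝ) :
    ((-(p ^ 2) : ℝ) : ℂ) * Sop (3 * β ^ 2 / p ^ 3) (p ^ 2 / β ^ 3) w x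
      = PP (⟨p ^ 2, β ^ 3⟩ : ℂ) u (β + 2 * Real.pi / p * x) := by
  have hz : (⟨p ^ 2, β ^ 3⟩ : ℂ) = (p:ℂ) ^ 2 + I * (β : ℂ) ^ 3 := by
    apply Complex.ext <;> simp [← Complex.ofReal_pow]
  have h1 := DD_aff h
  obtain ⟨w1, hw1⟩ := aff_exists (2 * Real.pi / p) β (by positivity) (DD u)
  have h2 : DD w = ((2 * Real.pi / p : ℝ) : ℂ) • w1 := by
    ext t
    rw [h1, _root_.smul_apply, hw1, smul_eq_mul]
  have h3 : DD (DD w) x = ((2 * Real.pi / p : ℝ) : ℂ) * (((2 * Real.pi / p : ℝ) : ℂ) * DD (DD u) (β + 2 * Real.pi / p * x)) := by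
    rw [h2, map_smul, _root_.smul_apply, DD_aff hw1, smul_eq_mul]
  rw [hz]
  simp only [Sop, PP, _root_.sub_apply, _root_.add_apply, _root_.neg_apply,
    _root_.smul_apply, XX_apply, h3, Phi_apply, smul_eq_mul, h x]
  have hp' : (p : ℂ) ≠ 0 := by exact_mod_cast hp.ne'
  have hb' : (β : ℂ) ≠ 0 := by exact_mod_cast hβ.ne'
  have hpi : (Real.pi : ℂ) ≠ 0 := by exact_mod_cast Real.pi_ne_zero
  generalize u (β + 2 * Real.pi / p * x) = U
  generalize DD (DD u) (β + 2 * Real.pi / p * x) = V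
  push_cast
  field_simp
  ring

lemma nrm_eq_zero {u : 𝓢(ℝ, ℂ)} (h : nrm u = 0) : u = 0 := by
  have h1 : u.toLp 2 (volume : Measure ℝ) = 0 := norm_eq_zero.mp h
  apply SchwartzMap.injective_toLp 2 (volume : Measure ℝ)
  change u.toLp 2 (volume : Measure ℝ) = _
  rw [h1]
  exact ((SchwartzMap.toLpCLM ℂ ℂ 2 (volume : Measure ℝ)).map_zero).symm

lemma nrm_rel {p β : ℝ} (hp : 0 < p) (hβ : 0 < β) {u w : 𝓢(ℝ, ℂ)}
    (h : ∀ x, w x = u (β + 2 * Real.pi / p * x)) :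
    nrm (𝓕 w) = nrm u * √(1 / (2 * Real.pi / p)) ∧
    p ^ 2 * nrm (Tq (3 * β ^ 2 / p ^ 3) (p ^ 2 / β ^ 3) (𝓕 w))
      = nrm (PP (⟨p ^ 2, β ^ 3⟩ : ℂ) u) * √(1 / (2 * Real.pi / p)) := by
  have hc : 0 < 2 * Real.pi / p := by positivity
  constructor
  · rw [nrm_four, nrm_aff hc h]
  · rw [← four_Sop, nrm_four]
    have := nrm_aff hc (u := PP (⟨p ^ 2, β ^ 3⟩ : ℂ) u)
      (w := ((-(p ^ 2) : ℝ) : ℂ) • Sop (3 * β ^ 2 / p ^ 3) (p ^ 2 / β ^ 3) w) (β := β)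
      (fun x => by rw [_root_.smul_apply, smul_eq_mul, PP_aff hp hβ h])
    rw [← this, nrm_smul]
    congr 1
    rw [Complex.norm_real, norm_neg, Real.norm_eq_abs, abs_of_nonneg (by positivity)]

lemma mP_eq (z : ℂ) : mP z = sInf {r : ℝ | ∃ u : 𝓢(ℝ, ℂ), u ≠ 0 ∧ r = nrm (PP z u) / nrm u} := by
  unfold mP
  simp_rw [PP_fun, nrm_eq]

lemma mP_bounds (ε : ℝ) (hε : 0 < ε) (hε1 : ε < 1) : ∃ δ, 0 < δ ∧ ∀ p β : ℝ, 0 < p → 0 < β →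
    3 * β ^ 2 / p ^ 3 ≤ δ → p ^ 2 / β ^ 3 ≤ δ →
    0 < mP ⟨p ^ 2, β ^ 3⟩ ∧
    |1 / mP ⟨p ^ 2, β ^ 3⟩ - Aa (3 * β ^ 2 / p ^ 3) (p ^ 2 / β ^ 3) / p ^ 2|
      ≤ ε * (Aa (3 * β ^ 2 / p ^ 3) (p ^ 2 / β ^ 3) / p ^ 2) := by
  obtain ⟨δ1, hδ1, H1⟩ := upper ε hε
  obtain ⟨δ2, hδ2, H2⟩ := lower ε hε hε1
  refine ⟨min δ1 δ2, lt_min hδ1 hδ2, fun p β hp hβ hh hy => ?_⟩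
  have h1 : 0 < 3 * β ^ 2 / p ^ 3 := by positivity
  have h2 : 0 < p ^ 2 / β ^ 3 := by positivity
  have U := H1 _ _ h1 (hh.trans (min_le_left _ _)) h2 (hy.trans (min_le_left _ _))
  obtain ⟨v, hv, L⟩ := H2 _ _ h1 (hh.trans (min_le_right _ _)) h2 (hy.trans (min_le_right _ _))
  have hA : 0 < Aa (3 * β ^ 2 / p ^ 3) (p ^ 2 / β ^ 3) := by
    unfold Aa
    have : 0 < Real.pi / (2 * (3 * β ^ 2 / p ^ 3)) := by positivity
    exact mul_pos (Real.sqrt_pos.mpr this) (Real.exp_pos _)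
  set A := Aa (3 * β ^ 2 / p ^ 3) (p ^ 2 / β ^ 3) with hAdef
  set z : ℂ := ⟨p ^ 2, β ^ 3⟩ with hz
  set K := A / p ^ 2 with hK
  have hKpos : 0 < K := by positivity
  have hc : 0 < 2 * Real.pi / p := by positivity
  have hs : 0 < √(1 / (2 * Real.pi / p)) := Real.sqrt_pos.mpr (by positivity)
  have hAK : A = K * p ^ 2 := by rw [hK]; field_simp
  -- every element of the set is bounded below
  have LB : ∀ u : 𝓢(ℝ, ℂ), u ≠ 0 → 1 / ((1 + ε) * K) ≤ nrm (PP z u) / nrm u := by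
    intro u hu
    have hu0 : 0 < nrm u := lt_of_le_of_ne (nrm_nonneg u) (fun h => hu (nrm_eq_zero h.symm))
    obtain ⟨w, hw⟩ := aff_exists (2 * Real.pi / p) β hc u
    obtain ⟨r1, r2⟩ := nrm_rel hp hβ hw
    have := U (𝓕 w)
    rw [r1, hAK, show (1 + ε) * (K * p ^ 2) * nrm (Tq (3 * β ^ 2 / p ^ 3) (p ^ 2 / β ^ 3) (𝓕 w))
      = (1 + ε) * K * (p ^ 2 * nrm (Tq (3 * β ^ 2 / p ^ 3) (p ^ 2 / β ^ 3) (𝓕 w))) by ring, r2,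
      ← mul_assoc] at this
    have := le_of_mul_le_mul_right this hs
    rw [div_le_div_iff₀ (by positivity) hu0]
    linarith
  obtain ⟨u, hu⟩ := aff_exists (1 / (2 * Real.pi / p)) (-β / (2 * Real.pi / p)) (by positivity) (𝓕⁻ v)
  have hw : ∀ x, (𝓕⁻ v) x = u (β + 2 * Real.pi / p * x) := by
    intro x
    rw [hu]
    congr 1
    field_simp
    ring
  obtain ⟨r1, r2⟩ := nrm_rel hp hβ hw
  rw [FourierTransform.fourier_fourierInv_eq] at r1 r2
  have hupos : 0 < nrm u := by
    rcases (nrm_nonneg u).lt_or_eq with h | h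
    · exact h
    · rw [r1, ← h] at hv; simp at hv
  have hune : u ≠ 0 := by
    rintro rfl
    have : nrm (0 : 𝓢(ℝ, ℂ)) = 0 := by
      have := nrm_smul 0 (0 : 𝓢(ℝ, ℂ))
      simpa using this
    linarith
  have UB : nrm (PP z u) / nrm u ≤ 1 / ((1 - ε) * K) := by
    rw [r1, hAK, show (1 - ε) * (K * p ^ 2) * nrm (Tq (3 * β ^ 2 / p ^ 3) (p ^ 2 / β ^ 3) v)
      = (1 - ε) * K * (p ^ 2 * nrm (Tq (3 * β ^ 2 / p ^ 3) (p ^ 2 / β ^ 3) v)) by ring, r2,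
      ← mul_assoc] at L
    have := le_of_mul_le_mul_right L hs
    rw [div_le_div_iff₀ hupos (mul_pos (by linarith) hKpos)]
    linarith
  have hlow : 1 / ((1 + ε) * K) ≤ mP z := by
    rw [mP_eq]
    refine le_csInf ⟨nrm (PP z u) / nrm u, u, hune, rfl⟩ ?_
    rintro r ⟨u', hu', rfl⟩
    exact LB u' hu'
  have hup : mP z ≤ 1 / ((1 - ε) * K) := by
    rw [mP_eq]
    refine le_trans (csInf_le ⟨1 / ((1 + ε) * K), ?_⟩ ⟨u, hune, rfl⟩) UB
    rintro r ⟨u', hu', rfl⟩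
    exact LB u' hu'
  have hpos : 0 < mP z := lt_of_lt_of_le (by positivity) hlow
  refine ⟨hpos, ?_⟩
  have e1 : 1 / mP z ≤ (1 + ε) * K := by
    rw [div_le_iff₀ (by positivity)] at hlow
    rw [div_le_iff₀ hpos]; linarith
  have e2 : (1 - ε) * K ≤ 1 / mP z := by
    rw [le_div_iff₀ (mul_pos (by linarith) hKpos)] at hup
    rw [le_div_iff₀ hpos]; linarith
  rw [abs_le]
  constructor <;> linarith

lemma K_eq {p β : ℝ} (hp : 0 < p) (hβ : 0 < β) :
    Real.sqrt Real.pi *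
            Real.exp (-((β ^ 3) ^ ((5:ℝ)/6)) *
              (∫ x in -Real.sqrt (p ^ 2 / β ^ 3)..Real.sqrt (p ^ 2 / β ^ 3),
                ((1:ℂ) - Complex.I * ((p ^ 2 / β ^ 3 : ℝ) : ℂ) + Complex.I * (x:ℂ) ^ 2)
                  ^ ((1:ℂ)/3)).im)
            / (Real.sqrt 6 * (β ^ 3) ^ ((1:ℝ)/3) * (p ^ 2) ^ ((1:ℝ)/4))
      = Aa (3 * β ^ 2 / p ^ 3) (p ^ 2 / β ^ 3) / p ^ 2 := by
  have hb3 : (β ^ 3) ^ ((1:ℝ)/3) = β := by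
    rw [← Real.rpow_natCast, ← Real.rpow_mul hβ.le]; norm_num
  have hp4 : (p ^ 2) ^ ((1:ℝ)/4) = √p := by
    rw [← Real.rpow_natCast, ← Real.rpow_mul hp.le, Real.sqrt_eq_rpow]; norm_num
  have hb5 : (β ^ 3) ^ ((5:ℝ)/6) = β ^ 2 * √β := by
    rw [← Real.rpow_natCast, ← Real.rpow_mul hβ.le, Real.sqrt_eq_rpow, ← Real.rpow_natCast,
      ← Real.rpow_add hβ]; norm_num
  have hy : 0 < p ^ 2 / β ^ 3 := by positivity
  have hsy : √(p ^ 2 / β ^ 3) = p / (β * √β) := by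
    rw [Real.sqrt_eq_iff_mul_self_eq_of_pos (by positivity)]
    have := Real.mul_self_sqrt hβ.le
    field_simp
    rw [Real.sq_sqrt hβ.le]
  rw [hb3, hp4, hb5]
  set y := p ^ 2 / β ^ 3 with hydef
  have hs : 0 < √y := Real.sqrt_pos.mpr hy
  have hIntg : (∫ x in -√y..√y, ((1:ℂ) - Complex.I * (y : ℂ) + Complex.I * (x:ℂ) ^ 2) ^ ((1:ℂ)/3))
      = (√y : ℂ) * ∫ s in (-1:ℝ)..1, cr (y * (s ^ 2 - 1)) := by
    have := intervalIntegral.smul_integral_comp_mul_left (a := -1) (b := 1)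
      (fun x : ℝ => ((1:ℂ) - Complex.I * (y : ℂ) + Complex.I * (x:ℂ) ^ 2) ^ ((1:ℂ)/3)) (√y)
    rw [mul_neg, mul_one] at this
    rw [← this, Complex.real_smul]
    congr 1
    apply intervalIntegral.integral_congr
    intro s _
    simp only [cr]
    congr 1
    have h2 : (√y : ℂ) ^ 2 = (y : ℂ) := by
      rw [← Complex.ofReal_pow, Real.sq_sqrt hy.le]
    push_cast
    rw [mul_pow, h2]
    ring
  have hcont : Continuous (fun s : ℝ => cr (y * (s ^ 2 - 1))) :=
    (cr_contDiff (g := fun s : ℝ => y * (s ^ 2 - 1)) (by fun_prop)).continuous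
  have him : (∫ s in (-1:ℝ)..1, cr (y * (s ^ 2 - 1))).im = ∫ s in (-1:ℝ)..1, (cr (y * (s ^ 2 - 1))).im := by
    have := Complex.imCLM.intervalIntegral_comp_comm (μ := volume) (a := -1) (b := 1) (hcont.intervalIntegrable _ _)
    simpa using this.symm
  rw [hIntg, Complex.im_ofReal_mul, him, Aa, Ph, intervalIntegral.integral_const_mul]
  set J := ∫ s in (-1:ℝ)..1, (cr (y * (s ^ 2 - 1))).im
  have hexp : -(β ^ 2 * √β) * (√y * J) = -(3 / y * J) / (3 * β ^ 2 / p ^ 3) := by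
    rw [hsy, hydef]
    have := Real.sqrt_pos.mpr hβ
    field_simp
  rw [hexp]
  have hpre : √(Real.pi / (2 * (3 * β ^ 2 / p ^ 3))) = √Real.pi * (p * √p) / (√6 * β) := by
    rw [Real.sqrt_eq_iff_mul_self_eq_of_pos (by positivity)]
    rw [show √Real.pi * (p * √p) / (√6 * β) * (√Real.pi * (p * √p) / (√6 * β))
      = (√Real.pi) ^ 2 * p ^ 2 * (√p) ^ 2 / ((√6) ^ 2 * β ^ 2) by ring,
      Real.sq_sqrt Real.pi_pos.le, Real.sq_sqrt hp.le, Real.sq_sqrt (by norm_num)]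
    field_simp
    norm_num
  rw [hpre]
  have h6 : 0 < √(6:ℝ) := by positivity
  have hsp := Real.sqrt_pos.mpr hp
  have hspp : √p ^ 2 = p := Real.sq_sqrt hp.le
  field_simp
  rw [hspp]

end Aux


/-- Precise resolvent asymptotics for the cubic operator `𝒫 = Dₓ² + ix³` in the regime
`(Im z)^{4/9} ≪ Re z ≪ Im z`: with `y = Re z / Im z`,
`‖(𝒫 − z)^{-1}‖ = K(z)(1 + o(1)) + O((Re z)^{-1/4}(Im z)^{-1/3})`, where
`K(z) = √π exp(−(Im z)^{5/6} Im ∫_{−√y}^{√y} (1 − iy + ix²)^{1/3} dx)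
/ (√6 (Im z)^{1/3}(Re z)^{1/4})`. -/
theorem stmt_9 :
    ∀ ε : ℝ, 0 < ε → ∃ C : ℝ, 0 < C ∧ ∀ z : ℂ,
      C ≤ z.im → C * z.im ^ ((4:ℝ)/9) ≤ z.re → z.re ≤ z.im / C →
      0 < mP z ∧
      |1 / mP z
          - Real.sqrt Real.pi *
            Real.exp (-(z.im ^ ((5:ℝ)/6)) *
              (∫ x in -Real.sqrt (z.re / z.im)..Real.sqrt (z.re / z.im),
                ((1:ℂ) - Complex.I * ((z.re / z.im : ℝ) : ℂ) + Complex.I * (x:ℂ) ^ 2)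
                  ^ ((1:ℂ)/3)).im)
            / (Real.sqrt 6 * z.im ^ ((1:ℝ)/3) * z.re ^ ((1:ℝ)/4))|
        ≤ ε * (Real.sqrt Real.pi *
            Real.exp (-(z.im ^ ((5:ℝ)/6)) *
              (∫ x in -Real.sqrt (z.re / z.im)..Real.sqrt (z.re / z.im),
                ((1:ℂ) - Complex.I * ((z.re / z.im : ℝ) : ℂ) + Complex.I * (x:ℂ) ^ 2)
                  ^ ((1:ℂ)/3)).im)
            / (Real.sqrt 6 * z.im ^ ((1:ℝ)/3) * z.re ^ ((1:ℝ)/4)))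
          + C * z.re ^ (-(1:ℝ)/4) * z.im ^ (-(1:ℝ)/3) := by
  intro ε hε
  have hε'0 : 0 < min ε 1 / 2 := by positivity
  have hε'1 : min ε 1 / 2 < 1 := by
    have := min_le_right ε 1
    linarith
  have hε'2 : min ε 1 / 2 ≤ ε := by
    have := min_le_left ε 1
    have : 0 < min ε 1 := by positivity
    linarith
  obtain ⟨δ, hδ, H⟩ := mP_bounds (min ε 1 / 2) hε'0 hε'1
  refine ⟨max 1 (3 / δ), by positivity, ?_⟩
  intro z h1 h2 h3
  set C := max 1 (3 / δ) with hC
  have hC1 : 1 ≤ C := le_max_left _ _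
  have hCδ : 3 / C ≤ δ := by
    have : 3 / δ ≤ C := le_max_right _ _
    rw [div_le_iff₀ hδ] at this
    rw [div_le_iff₀ (by linarith)]
    linarith
  obtain ⟨a, b⟩ := z
  simp only at h1 h2 h3 ⊢
  have hb : 0 < b := by linarith
  have ha : 0 < a := lt_of_lt_of_le (by positivity) h2
  obtain ⟨p, hp, rfl⟩ : ∃ p : ℝ, 0 < p ∧ a = p ^ 2 :=
    ⟨√a, Real.sqrt_pos.mpr ha, (Real.sq_sqrt ha.le).symm⟩
  obtain ⟨β, hβ, rfl⟩ : ∃ β : ℝ, 0 < β ∧ b = β ^ 3 := by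
    refine ⟨b ^ ((1:ℝ)/3), by positivity, ?_⟩
    rw [← Real.rpow_natCast, ← Real.rpow_mul hb.le]
    norm_num
  have hh : 3 * β ^ 2 / p ^ 3 ≤ δ := by
    refine le_trans ?_ hCδ
    have e1 : ((β ^ 3) ^ ((4:ℝ)/9)) ^ 3 = β ^ 4 := by
      rw [← Real.rpow_natCast β 3, ← Real.rpow_mul hβ.le, ← Real.rpow_natCast, ← Real.rpow_mul hβ.le,
        ← Real.rpow_natCast]
      norm_num
    have e2 : (C * (β ^ 3) ^ ((4:ℝ)/9)) ^ 3 ≤ (p ^ 2) ^ 3 :=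
      pow_le_pow_left₀ (by positivity) h2 3
    rw [mul_pow, e1] at e2
    have e3 : (C * β ^ 2) ^ 2 ≤ (p ^ 3) ^ 2 := by
      have : C ^ 2 * β ^ 4 ≤ C ^ 3 * β ^ 4 :=
        mul_le_mul_of_nonneg_right (pow_le_pow_right₀ hC1 (by norm_num)) (by positivity)
      calc (C * β ^ 2) ^ 2 = C ^ 2 * β ^ 4 := by ring
        _ ≤ (p ^ 2) ^ 3 := this.trans e2
        _ = (p ^ 3) ^ 2 := by ring
    have e4 : C * β ^ 2 ≤ p ^ 3 := (pow_le_pow_iff_left₀ (by positivity) (by positivity) two_ne_zero).mp e3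
    rw [div_le_div_iff₀ (by positivity) (by linarith)]
    linarith
  have hy : p ^ 2 / β ^ 3 ≤ δ := by
    refine le_trans ?_ hCδ
    rw [le_div_iff₀ (by linarith)] at h3
    rw [div_le_div_iff₀ hb (by linarith)]
    linarith
  obtain ⟨hm, hK⟩ := H p β hp hβ hh hy
  refine ⟨hm, ?_⟩
  rw [K_eq hp hβ]
  refine hK.trans ?_
  have hA : 0 ≤ Aa (3 * β ^ 2 / p ^ 3) (p ^ 2 / β ^ 3) / p ^ 2 :=
    div_nonneg (mul_nonneg (Real.sqrt_nonneg _) (Real.exp_pos _).le) (by positivity)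
  have hx : 0 ≤ C * (p ^ 2) ^ (-(1:ℝ)/4) * (β ^ 3) ^ (-(1:ℝ)/3) := by positivity
  have := mul_le_mul_of_nonneg_right hε'2 hA
  linarith
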